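/- Let 1 < p, q < ∞, 1 ≤ r, s ≤ 2, and let t > 0 satisfy 1/t ≤ 1/r + 1/s, with (max(r,s) < 2 or t > rs/(r+s)), and let N > 0. There exists a constant C such that for every pair of continuous Littlewood–Paley families (f_i)_{i∈ℤ} and (g_j)_{j∈ℤ}, each with band width N, and every jump collection (N_k)_{k≥0}, one has ‖ (Σ_{k≥1} |Σ_{N_{k−1}(x) < i < j ≤ N_k(x)} f_i(x) g_j(x)|^t)^{1/t} ‖_{pq/(p+q)} ≤ C ‖(f_i)‖_{p,r} ‖(g_j)‖_{q,s}. -/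

import Mathlib

open MeasureTheory ENNReal
open scoped FourierTransform NNReal

noncomputable section

/-- A jump collection: a sequence of measurable integer-valued functions on `ℝ`,
nondecreasing in the index. -/
def IsJumpCollection (Nk : ℕ → ℝ → ℤ) : Prop :=
  (∀ k, Measurable (Nk k)) ∧ ∀ (k : ℕ) (x : ℝ), Nk k x ≤ Nk (k + 1) x

/-- A continuous Littlewood–Paley family with band width `Nb`. -/
def IsContLPFamily (Nb : ℝ) (f : ℤ → SchwartzMap ℝ ℂ) : Prop :=
  ∀ i : ℤ, ∀ ξ : ℝ, 𝓕 (⇑(f i)) ξ ≠ 0 →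
    (2 : ℝ) ^ ((i : ℝ) - Nb) < |ξ| ∧ |ξ| < (2 : ℝ) ^ ((i : ℝ) + Nb)

/-- The mixed norm `‖(f_i)‖_{p,r} = ‖(∑_i |f_i|^r)^(1/r)‖_{L^p}` for a family of
Schwartz functions. -/
def mixedNorm (p r : ℝ) (f : ℤ → SchwartzMap ℝ ℂ) : ℝ≥0∞ :=
  (∫⁻ x : ℝ, ((∑' i : ℤ, (ENNReal.ofReal ‖f i x‖) ^ r) ^ (1 / r)) ^ p) ^ (1 / p)

namespace BVP

/-! ### Chains -/

/-- Largest sum of `w` over chains from `a` to `n`. -/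
def V (w : ℕ → ℕ → ℝ≥0∞) (a n : ℕ) : ℝ≥0∞ :=
  ⨆ j : Fin n, if a ≤ (j : ℕ) then V w a j + w j n else 0
termination_by n
decreasing_by exact j.2

lemma V_step (w : ℕ → ℕ → ℝ≥0∞) {a j n : ℕ} (h1 : a ≤ j) (h2 : j < n) :
    V w a j + w j n ≤ V w a n := by
  rw [V.eq_def w a n]
  refine le_trans ?_ (le_iSup _ (⟨j, h2⟩ : Fin n))
  simp [h1]

lemma V_le (w : ℕ → ℕ → ℝ≥0∞) (a b : ℕ) (S : ℕ → ℝ≥0∞)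
    (h : ∀ j n, a ≤ j → j < n → n ≤ b → S j + w j n ≤ S n) :
    ∀ n, n ≤ b → V w a n ≤ S n := by
  intro n
  induction n using Nat.strong_induction_on with
  | _ n ih =>
    intro hn
    rw [V.eq_def w a n]
    refine iSup_le fun j => ?_
    split_ifs with hj
    · refine le_trans ?_ (h j n hj j.2 hn)
      gcongr
      exact ih j j.2 (by omega)
    · exact zero_le

lemma V_self (w : ℕ → ℕ → ℝ≥0∞) (a n : ℕ) (h : n ≤ a) : V w a n = 0 := by
  rw [V.eq_def w a n]
  simp only [ENNReal.iSup_eq_zero]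
  intro j
  have := j.2
  rw [if_neg (by omega)]

lemma V_chain (w : ℕ → ℕ → ℝ≥0∞) {a i : ℕ} (h1 : a ≤ i) :
    ∀ n, i ≤ n → V w a i + V w i n ≤ V w a n := by
  intro n
  induction n using Nat.strong_induction_on with
  | _ n ih =>
    intro hn
    rcases hn.eq_or_lt with rfl | hlt
    · rw [V_self w i i le_rfl, add_zero]
    · rw [V.eq_def w i n]
      haveI : Nonempty (Fin n) := ⟨⟨i, hlt⟩⟩
      rw [ENNReal.add_iSup]
      refine iSup_le fun j => ?_
      split_ifs with hj
      · rw [← add_assoc]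
        exact le_trans (by gcongr; exact ih j j.2 hj) (V_step w (h1.trans hj) j.2)
      · have := ih i hlt le_rfl
        rw [add_zero]
        exact le_trans le_self_add (V_step w h1 hlt)

lemma V_mono_right (w : ℕ → ℕ → ℝ≥0∞) {a i n : ℕ} (h1 : a ≤ i) (h2 : i ≤ n) :
    V w a i ≤ V w a n := le_trans le_self_add (V_chain w h1 n h2)

lemma V_mono (w w' : ℕ → ℕ → ℝ≥0∞) (a b : ℕ)
    (h : ∀ j n, a ≤ j → j < n → n ≤ b → w j n ≤ w' j n) : V w a b ≤ V w' a b := by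
  refine V_le w a b (V w' a) (fun j n h1 h2 h3 => ?_) b le_rfl
  exact le_trans (by gcongr; exact h j n h1 h2 h3) (V_step w' h1 h2)

lemma le_V (w : ℕ → ℕ → ℝ≥0∞) {a b : ℕ} (h : a < b) : w a b ≤ V w a b :=
  le_trans le_add_self (V_step w le_rfl h)

lemma V_quasi (w : ℕ → ℕ → ℝ≥0∞) (C : ℝ≥0∞) (hC : 1 ≤ C)
    (hw : ∀ a b c, a ≤ b → b ≤ c → w a c ≤ C * (w a b + w b c))
    {a T n : ℕ} (h1 : a ≤ T) (h2 : T ≤ n) : V w a n ≤ C * (V w a T + V w T n) := by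
  have key := V_le w a n (fun j => if j ≤ T then V w a j else C * (V w a T + V w T j)) ?_ n le_rfl
  · refine key.trans ?_
    split_ifs with h
    · have : n = T := le_antisymm h h2
      subst this
      calc V w a n = 1 * (V w a n) := by rw [one_mul]
        _ ≤ C * (V w a n + V w n n) := by gcongr; exact le_self_add
    · exact le_rfl
  · intro j m hj hjm hm
    by_cases hmT : m ≤ T
    · rw [if_pos hmT, if_pos (by omega)]
      exact V_step w hj hjm
    · rw [if_neg hmT]
      push Not at hmT
      split_ifs with hjT
      · rcases hjT.eq_or_lt with rfl | hlt
        · calc V w a j + w j m ≤ 1 * (V w a j + V w j m) := by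
                rw [one_mul]; gcongr; exact le_V w hjm
            _ ≤ _ := by gcongr
        · calc V w a j + w j m ≤ C * V w a j + C * (w j T + w T m) := by
                gcongr
                · calc V w a j = 1 * V w a j := by rw [one_mul]
                    _ ≤ _ := by gcongr
                · exact hw j T m hlt.le hmT.le
            _ = C * (V w a j + w j T + w T m) := by ring
            _ ≤ _ := by
                gcongr
                · exact V_step w hj hlt
                · exact le_V w hmT
      · push Not at hjT
        calc C * (V w a T + V w T j) + w j m ≤ C * (V w a T + V w T j) + C * w j m := by
              gcongr
              calc w j m = 1 * w j m := by rw [one_mul]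
                _ ≤ _ := by gcongr
          _ = C * (V w a T + (V w T j + w j m)) := by ring
          _ ≤ _ := by
              gcongr
              exact V_step w hjT.le hjm

lemma tsum_le_V (w : ℕ → ℕ → ℝ≥0∞) (hw : ∀ a, w a a = 0) (N : ℕ → ℕ) (hN : Monotone N)
    (D : ℕ) (hD : ∀ k, N k ≤ D) : ∑' k, w (N k) (N (k+1)) ≤ V w 0 D := by
  refine ENNReal.tsum_le_of_sum_range_le fun K => ?_
  have : ∀ K, ∑ k ∈ Finset.range K, w (N k) (N (k+1)) ≤ V w 0 (N K) := by
    intro K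
    induction K with
    | zero => simp
    | succ K ih =>
      rw [Finset.sum_range_succ]
      rcases (hN (Nat.le_succ K)).eq_or_lt with h | h
      · simp only [Nat.succ_eq_add_one] at h
        rw [← h, hw, add_zero]; exact ih
      · exact le_trans (by gcongr) (V_step w (Nat.zero_le _) h)
  exact (this K).trans (V_mono_right w (Nat.zero_le _) (hD K))

lemma V_const_mul (w : ℕ → ℕ → ℝ≥0∞) (c : ℝ≥0∞) (a b : ℕ) :
    V (fun i j => c * w i j) a b ≤ c * V w a b := by
  refine V_le _ a b (fun n => c * V w a n) (fun j n h1 h2 h3 => ?_) b le_rfl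
  rw [← mul_add]
  gcongr
  exact V_step w h1 h2

lemma V_measurable {Ω : Type*} [MeasurableSpace Ω] (w : Ω → ℕ → ℕ → ℝ≥0∞)
    (hw : ∀ i j, Measurable fun x => w x i j) (a n : ℕ) : Measurable fun x => V (w x) a n := by
  induction n using Nat.strong_induction_on with
  | _ n ih =>
    have : (fun x => V (w x) a n) =
      fun x => ⨆ j : Fin n, if a ≤ (j : ℕ) then V (w x) a j + w x j n else 0 := by
      funext x; rw [V.eq_def]
    rw [this]
    refine Measurable.iSup fun j => ?_
    split_ifs
    · exact (ih j j.2).add (hw _ _)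
    · exact measurable_const

/-! ### Increments -/

def dF (d : ℕ → ℂ) (a b : ℕ) : ℂ := ∑ i ∈ Finset.Ico a b, d i
def dP (d e : ℕ → ℂ) (a b : ℕ) : ℂ := ∑ j ∈ Finset.Ico a b, dF d a j * e j

lemma dF_succ (d : ℕ → ℂ) {a b : ℕ} (h : a ≤ b) : dF d a (b+1) = dF d a b + d b := by
  simp [dF, Finset.sum_Ico_succ_top h]
lemma dP_succ (d e : ℕ → ℂ) {a b : ℕ} (h : a ≤ b) :
    dP d e a (b+1) = dP d e a b + dF d a b * e b := by
  simp [dP, Finset.sum_Ico_succ_top h]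
@[simp] lemma dF_self (d : ℕ → ℂ) (a : ℕ) : dF d a a = 0 := by simp [dF]
@[simp] lemma dP_self (d e : ℕ → ℂ) (a : ℕ) : dP d e a a = 0 := by simp [dP]

lemma dF_add (d : ℕ → ℂ) {a b c : ℕ} (h1 : a ≤ b) (h2 : b ≤ c) :
    dF d a c = dF d a b + dF d b c := (Finset.sum_Ico_consecutive _ h1 h2).symm

lemma dP_add (d e : ℕ → ℂ) {a b c : ℕ} (h1 : a ≤ b) (h2 : b ≤ c) :
    dP d e a c = dP d e a b + dP d e b c + dF d a b * dF e b c := by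
  induction c, h2 using Nat.le_induction with
  | base => simp
  | succ c hc ih =>
    rw [dP_succ d e (h1.trans hc), dP_succ d e hc, dF_succ e hc, ih, dF_add d h1 hc]
    ring

lemma dF_congr {d d' : ℕ → ℂ} {a b : ℕ} (h : ∀ i, a ≤ i → i < b → d i = d' i) :
    dF d a b = dF d' a b :=
  Finset.sum_congr rfl fun i hi => h i (Finset.mem_Ico.1 hi).1 (Finset.mem_Ico.1 hi).2

lemma dP_congr {d d' e e' : ℕ → ℂ} {a b : ℕ} (h : ∀ i, a ≤ i → i < b → d i = d' i)
    (h' : ∀ i, a ≤ i → i < b → e i = e' i) :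
    dP d e a b = dP d' e' a b := by
  refine Finset.sum_congr rfl fun i hi => ?_
  have := Finset.mem_Ico.1 hi
  rw [h' i this.1 this.2, dF_congr fun j h1 h2 => h j h1 (h2.trans this.2)]

/-- combined increment size -/
def W (r s t : ℝ) (d e : ℕ → ℂ) (a b : ℕ) : ℝ≥0∞ :=
  ‖dF d a b‖ₑ ^ r + ‖dF e a b‖ₑ ^ s + ‖dP d e a b‖ₑ ^ t

lemma add_rpow_le (r : ℝ) (hr : 0 ≤ r) (x y : ℝ≥0∞) :
    (x + y) ^ r ≤ 2 ^ r * (x ^ r + y ^ r) := by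
  rcases le_total x y with h | h
  · calc (x + y) ^ r ≤ (2 * y) ^ r := by rw [two_mul]; gcongr
      _ = 2 ^ r * y ^ r := ENNReal.mul_rpow_of_nonneg _ _ hr
      _ ≤ _ := by gcongr; exact le_add_self
  · calc (x + y) ^ r ≤ (2 * x) ^ r := by rw [two_mul]; gcongr
      _ = 2 ^ r * x ^ r := ENNReal.mul_rpow_of_nonneg _ _ hr
      _ ≤ _ := by gcongr; exact le_self_add

/-- Young inequality in crude form -/
lemma young (r s t : ℝ) (hr : 0 < r) (hs : 0 < s) (ht : 0 < t) (h : 1/t = 1/r + 1/s)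
    (x y : ℝ≥0∞) : (x * y) ^ t ≤ x ^ r + y ^ s := by
  have hts : t / r + t / s = 1 := by
    have : t * (1/t) = t * (1/r+1/s) := by rw [h]
    field_simp at this ⊢
    linarith
  have a0 : 0 < t / r := by positivity
  have b0 : 0 < t / s := by positivity
  rw [ENNReal.mul_rpow_of_nonneg _ _ ht.le]
  have e1 : x ^ t = (x ^ r) ^ (t/r) := by rw [← ENNReal.rpow_mul]; congr 1; field_simp
  have e2 : y ^ t = (y ^ s) ^ (t/s) := by rw [← ENNReal.rpow_mul]; congr 1; field_simp
  rw [e1, e2]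
  set X := x ^ r
  set Y := y ^ s
  calc X ^ (t/r) * Y ^ (t/s) ≤ (X + Y) ^ (t/r) * (X + Y) ^ (t/s) := by
        gcongr
        · exact le_self_add
        · exact le_add_self
    _ = X + Y := by
        rw [← ENNReal.rpow_add_of_nonneg _ _ a0.le b0.le, hts, ENNReal.rpow_one]

lemma W_quasi (r s t : ℝ) (hr : 0 < r) (hs : 0 < s) (ht : 0 < t) (h : 1/t = 1/r + 1/s) :
    ∃ C : ℝ≥0, 1 ≤ C ∧ ∀ (d e : ℕ → ℂ) (a b c : ℕ), a ≤ b → b ≤ c →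
      W r s t d e a c ≤ C * (W r s t d e a b + W r s t d e b c) := by
  let C : ℝ≥0 := 2 ^ r + 2 ^ s + 2 ^ t * (2 ^ t + 1)+1
  refine ⟨C, by simp [C], ?_⟩
  intro d e a b c h1 h2
  unfold W
  rw [dF_add d h1 h2, dF_add e h1 h2, dP_add d e h1 h2]
  set f1 := dF d a b
  set f2 := dF d b c
  set g1 := dF e a b
  set g2 := dF e b c
  set p1 := dP d e a b
  set p2 := dP d e b c
  have e1 : ‖f1 + f2‖ₑ ^ r ≤ 2 ^ r * (‖f1‖ₑ ^ r + ‖f2‖ₑ ^ r) :=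
    le_trans (by gcongr; exact enorm_add_le _ _) (add_rpow_le r hr.le _ _)
  have e2 : ‖g1 + g2‖ₑ ^ s ≤ 2 ^ s * (‖g1‖ₑ ^ s + ‖g2‖ₑ ^ s) :=
    le_trans (by gcongr; exact enorm_add_le _ _) (add_rpow_le s hs.le _ _)
  have e3 : ‖p1 + p2 + f1 * g2‖ₑ ^ t ≤ 2 ^ t * (2 ^ t * (‖p1‖ₑ ^ t + ‖p2‖ₑ ^ t) +
      (‖f1‖ₑ ^ r + ‖g2‖ₑ ^ s)) := by
    refine le_trans (b := (‖p1 + p2‖ₑ + ‖f1 * g2‖ₑ) ^ t) (by gcongr; exact enorm_add_le _ _) ?_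
    refine le_trans (add_rpow_le t ht.le _ _) ?_
    gcongr
    · exact le_trans (by gcongr; exact enorm_add_le _ _) (add_rpow_le t ht.le _ _)
    · rw [enorm_mul]; exact young r s t hr hs ht h _ _
  have hCe : (C : ℝ≥0∞) = 2 ^ r + 2 ^ s + 2 ^ t * (2 ^ t + 1) + 1 := by
    have : ∀ z : ℝ, ((2 ^ z : ℝ≥0) : ℝ≥0∞) = 2 ^ z := fun z => by
      rw [ENNReal.coe_rpow_of_ne_zero (by norm_num)]; simp
    simp [C, this]
  set F1 := ‖f1‖ₑ ^ r
  set F2 := ‖f2‖ₑ ^ r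
  set G1 := ‖g1‖ₑ ^ s
  set G2 := ‖g2‖ₑ ^ s
  set P1 := ‖p1‖ₑ ^ t
  set P2 := ‖p2‖ₑ ^ t
  calc _ ≤ 2 ^ r * (F1 + F2) + 2 ^ s * (G1 + G2) + 2 ^ t * (2 ^ t * (P1 + P2) + (F1 + G2)) :=
        add_le_add (add_le_add e1 e2) e3
    _ ≤ 2 ^ r * (F1 + F2) + 2 ^ s * (G1 + G2) + 2 ^ t * (2 ^ t * (P1 + P2) + (F1 + G2)) +
        (2 ^ r * (G1 + G2 + P1 + P2) + 2 ^ s * (F1 + F2 + P1 + P2) +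
         2 ^ t * (2 ^ t * (F1 + F2 + G1 + G2) + (F2 + G1 + P1 + P2)) + (F1+F2+G1+G2+P1+P2)) :=
        le_self_add
    _ = C * (F1 + G1 + P1 + (F2 + G2 + P2)) := by rw [hCe]; ring

lemma W_scale (r s t : ℝ) (hr : 0 ≤ r) (hs : 0 ≤ s) (ht : 0 ≤ t) (d e : ℕ → ℂ) (x y : ℝ)
    (a b : ℕ) :
    W r s t (fun i => x * d i) (fun i => y * e i) a b =
      ‖x‖ₑ ^ r * ‖dF d a b‖ₑ ^ r + ‖y‖ₑ ^ s * ‖dF e a b‖ₑ ^ s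
        + (‖x‖ₑ * ‖y‖ₑ) ^ t * ‖dP d e a b‖ₑ ^ t := by
  have h1 : ∀ (z : ℝ) (u : ℕ → ℂ) (a b : ℕ), dF (fun i => z * u i) a b = z * dF u a b := by
    intro z u a b; simp [dF, Finset.mul_sum]
  have h2 : dP (fun i => x * d i) (fun i => y * e i) a b = (x * y) * dP d e a b := by
    simp only [dP, h1, Finset.mul_sum]
    exact Finset.sum_congr rfl fun i _ => by ring
  have hn : ∀ z : ℝ, ‖(z : ℂ)‖ₑ = ‖z‖ₑ := fun z => by simp [enorm, nnnorm]
  unfold W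
  rw [h1, h1, h2, enorm_mul, enorm_mul, enorm_mul, enorm_mul, hn, hn,
    ENNReal.mul_rpow_of_nonneg _ _ hr, ENNReal.mul_rpow_of_nonneg _ _ hs,
    ENNReal.mul_rpow_of_nonneg _ _ ht]

lemma V_W_crude (r s t : ℝ) (C : ℝ≥0∞) (hC : 1 ≤ C) (d e : ℕ → ℂ)
    (hw : ∀ a b c, a ≤ b → b ≤ c → W r s t d e a c ≤ C * (W r s t d e a b + W r s t d e b c))
    (ht : 0 < t) (n : ℕ) :
    V (W r s t d e) 0 n ≤ C ^ n * ∑ i ∈ Finset.range n, (‖d i‖ₑ ^ r + ‖e i‖ₑ ^ s) := by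
  induction n with
  | zero => simp [V_self]
  | succ n ih =>
    have h1 := V_quasi (W r s t d e) C hC hw (Nat.zero_le n) (Nat.le_succ n)
    have h2 : V (W r s t d e) n (n+1) ≤ ‖d n‖ₑ ^ r + ‖e n‖ₑ ^ s := by
      refine V_le _ n (n+1) (fun j => if j = n then 0 else ‖d n‖ₑ ^ r + ‖e n‖ₑ ^ s) ?_ (n+1) le_rfl
        |>.trans ?_
      · intro j m h1 h2 h3
        have : j = n := by omega
        have : m = n + 1 := by omega
        subst_vars
        simp [W, dF_succ, dP_succ, ht]
      · simp
    refine h1.trans ?_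
    rw [Finset.sum_range_succ, pow_succ, mul_comm (C^n) C, mul_assoc]
    gcongr
    rw [mul_add]
    have : 1 ≤ C ^ n := one_le_pow₀ hC
    refine add_le_add ih (h2.trans ?_)
    calc _ = 1 * (‖d n‖ₑ ^ r + ‖e n‖ₑ ^ s) := (one_mul _).symm
      _ ≤ _ := by gcongr

/-! ### The greedy stopping machine -/

structure St where
  c : ℕ
  f : ℂ
  g : ℂ
  q : ℂ

open Classical in
def St.step (s : St) (d e : ℂ) : St :=
  if ‖s.f + d‖ ≤ 1/4 ∧ ‖s.g + e‖ ≤ 1/4 ∧ ‖s.q + s.f * e‖ ≤ 1/4 then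
    ⟨s.c, s.f + d, s.g + e, s.q + s.f * e⟩ else ⟨s.c + 1, 0, 0, 0⟩

def St.ok (s : St) : Prop := ‖s.f‖ ≤ 1/4 ∧ ‖s.g‖ ≤ 1/4 ∧ ‖s.q‖ ≤ 1/4

def St.Phi (s : St) : ℝ := s.c + 16 * (‖s.f‖^2 + ‖s.g‖^2 + ‖s.q‖^2)

lemma St.step_ok (s : St) (d e : ℂ) : (s.step d e).ok := by
  unfold St.step
  split_ifs with h
  · exact h
  · simp [St.ok]

lemma St.Phi_step1 (s : St) (d e : ℂ) :
    (s.step d e).Phi ≤ s.c + 16 * (‖s.f + d‖^2 + ‖s.g + e‖^2 + ‖s.q + s.f * e‖^2) := by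
  unfold St.step
  split_ifs with h
  · simp [St.Phi]
  · simp only [St.Phi]
    push_cast
    have h0 := sq_nonneg ‖s.f + d‖
    have h1 := sq_nonneg ‖s.g + e‖
    have h2 := sq_nonneg ‖s.q + s.f * e‖
    have : (1:ℝ) ≤ 16 * (‖s.f + d‖^2 + ‖s.g + e‖^2 + ‖s.q + s.f * e‖^2) := by
      by_contra hc
      apply h
      refine ⟨?_, ?_, ?_⟩ <;> nlinarith
    simp; linarith

lemma St.Phi_le (s : St) (h : s.ok) : s.Phi ≤ s.c + 3 := by
  obtain ⟨h1, h2, h3⟩ := h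
  have := norm_nonneg s.f
  have := norm_nonneg s.g
  have := norm_nonneg s.q
  unfold St.Phi; nlinarith

lemma St.Phi_step2 (s : St) (d e : ℂ) : (s.step d e).Phi ≤ s.c + 3 := by
  unfold St.step
  split_ifs with h
  · exact St.Phi_le _ h
  · simp [St.Phi]

lemma par (x y : ℂ) : ‖x + y‖^2 + ‖x + -y‖^2 = 2 * ‖x‖^2 + 2 * ‖y‖^2 := by
  have := parallelogram_law_with_norm ℝ x y
  rw [← sub_eq_add_neg]; nlinarith

lemma St.Phi_avg (s : St) (h : s.ok) (d e : ℂ) :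
    (s.step d e).Phi + (s.step (-d) (-e)).Phi ≤
      2 * s.Phi + 64 * (min 1 (‖d‖^2) + min 1 (‖e‖^2)) := by
  have hc : (s.c : ℝ) ≤ s.Phi := by unfold St.Phi; nlinarith [sq_nonneg ‖s.f‖, sq_nonneg ‖s.g‖, sq_nonneg ‖s.q‖]
  have a2 := St.Phi_step2 s d e
  have b2 := St.Phi_step2 s (-d) (-e)
  have a1 := St.Phi_step1 s d e
  have b1 := St.Phi_step1 s (-d) (-e)
  have n1 : (0:ℝ) ≤ min 1 (‖d‖^2) := le_min zero_le_one (sq_nonneg _)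
  have n2 : (0:ℝ) ≤ min 1 (‖e‖^2) := le_min zero_le_one (sq_nonneg _)
  rcases le_total 1 (‖d‖^2) with hd | hd
  · rw [min_eq_left hd]; linarith
  rcases le_total 1 (‖e‖^2) with he | he
  · rw [min_eq_left he]; linarith
  rw [min_eq_right hd, min_eq_right he]
  have p1 := par s.f d
  have p2 := par s.g e
  have p3 := par s.q (s.f * e)
  rw [norm_mul] at p3
  have : s.f * -e = -(s.f * e) := by ring
  rw [this] at b1
  have hf : ‖s.f‖^2 ≤ 1/16 := by nlinarith [h.1, norm_nonneg s.f]
  have : (‖s.f‖ * ‖e‖)^2 ≤ 1/16 * ‖e‖^2 := by rw [mul_pow]; gcongr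
  have : s.Phi = s.c + 16 * (‖s.f‖^2 + ‖s.g‖^2 + ‖s.q‖^2) := rfl
  nlinarith [sq_nonneg ‖d‖, sq_nonneg ‖e‖]

def run (d e : ℕ → ℂ) : ℕ → St
  | 0 => ⟨0, 0, 0, 0⟩
  | n+1 => (run d e n).step (d n) (e n)

lemma run_ok (d e : ℕ → ℂ) (n : ℕ) : (run d e n).ok := by
  cases n with
  | zero => simp [run, St.ok]
  | succ n => exact St.step_ok _ _ _

lemma run_congr {d e d' e' : ℕ → ℂ} {n : ℕ} (h : ∀ i < n, d i = d' i) (h' : ∀ i < n, e i = e' i) :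
    run d e n = run d' e' n := by
  induction n with
  | zero => rfl
  | succ n ih =>
    simp only [run]
    rw [ih (fun i hi => h i (by omega)) (fun i hi => h' i (by omega)), h n (by omega),
      h' n (by omega)]

lemma run_zero {d e : ℕ → ℂ} {n : ℕ} (h : ∀ i < n, d i = 0) (h' : ∀ i < n, e i = 0) :
    run d e n = ⟨0, 0, 0, 0⟩ := by
  rw [run_congr (d' := fun _ => 0) (e' := fun _ => 0) h h']
  clear h h'
  induction n with
  | zero => rfl
  | succ n ih => simp [run, ih, St.step]

lemma run_c_mono (d e : ℕ → ℂ) : Monotone fun n => (run d e n).c := by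
  refine monotone_nat_of_le_succ fun n => ?_
  simp only [run, St.step]
  split_ifs <;> simp

lemma run_same (d e : ℕ → ℂ) {a b : ℕ} (h : a ≤ b) (hc : (run d e b).c = (run d e a).c) :
    (run d e b).f = (run d e a).f + dF d a b ∧ (run d e b).g = (run d e a).g + dF e a b ∧
    (run d e b).q = (run d e a).q + dP d e a b + (run d e a).f * dF e a b := by
  induction b, h using Nat.le_induction with
  | base => simp
  | succ b hb ih =>
    have m1 := run_c_mono d e hb
    have m2 := run_c_mono d e (Nat.le_succ b)
    simp only [Nat.succ_eq_add_one] at m1 m2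
    have hc' : (run d e b).c = (run d e a).c := by omega
    obtain ⟨i1, i2, i3⟩ := ih hc'
    rw [dF_succ d hb, dF_succ e hb, dP_succ d e hb]
    have hcc : (run d e (b+1)).c = (run d e b).c := by omega
    simp only [run, St.step] at hcc ⊢
    split_ifs at hcc ⊢ with hh
    · simp only [i1, i2, i3]
      refine ⟨by ring, by ring, by ring⟩
    · simp at hcc

lemma run_same_bound (d e : ℕ → ℂ) {a b : ℕ} (h : a ≤ b)
    (hc : (run d e b).c = (run d e a).c) :
    ‖dF d a b‖ ≤ 1 ∧ ‖dF e a b‖ ≤ 1 ∧ ‖dP d e a b‖ ≤ 1 := by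
  obtain ⟨h1, h2, h3⟩ := run_same d e h hc
  obtain ⟨a1, a2, a3⟩ := run_ok d e a
  obtain ⟨b1, b2, b3⟩ := run_ok d e b
  have e1 : dF d a b = (run d e b).f - (run d e a).f := by rw [h1]; ring
  have e2 : dF e a b = (run d e b).g - (run d e a).g := by rw [h2]; ring
  have e3 : dP d e a b = (run d e b).q - (run d e a).q - (run d e a).f * dF e a b := by
    rw [h3]; ring
  have k1 : ‖dF d a b‖ ≤ 1/2 := by rw [e1]; exact (norm_sub_le _ _).trans (by linarith)
  have k2 : ‖dF e a b‖ ≤ 1/2 := by rw [e2]; exact (norm_sub_le _ _).trans (by linarith)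
  refine ⟨by linarith, by linarith, ?_⟩
  rw [e3]
  have : ‖(run d e a).f * dF e a b‖ ≤ 1/4 * (1/2) := by rw [norm_mul]; gcongr
  have := norm_sub_le ((run d e b).q - (run d e a).q) ((run d e a).f * dF e a b)
  have := norm_sub_le ((run d e b).q) ((run d e a).q)
  linarith

end BVP

namespace BVP

/-! ### Martingale core, one scale -/

lemma run_meas {Ω : Type*} [MeasurableSpace Ω] (d e : ℕ → Ω → ℂ) (hd : ∀ i, Measurable (d i))
    (he : ∀ i, Measurable (e i)) (n : ℕ) :
    Measurable (fun ω => (run (fun i => d i ω) (fun i => e i ω) n).c) ∧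
    Measurable (fun ω => (run (fun i => d i ω) (fun i => e i ω) n).f) ∧
    Measurable (fun ω => (run (fun i => d i ω) (fun i => e i ω) n).g) ∧
    Measurable (fun ω => (run (fun i => d i ω) (fun i => e i ω) n).q) := by
  induction n with
  | zero => simp [run]
  | succ n ih =>
    obtain ⟨hc, hf, hg, hq⟩ := ih
    set R := fun ω => run (fun i => d i ω) (fun i => e i ω) n with hR
    have hm : MeasurableSet {ω | ‖(R ω).f + d n ω‖ ≤ 1/4 ∧ ‖(R ω).g + e n ω‖ ≤ 1/4 ∧
        ‖(R ω).q + (R ω).f * e n ω‖ ≤ 1/4} := by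
      refine (measurableSet_le (hf.add (hd n)).norm measurable_const).inter
        ((measurableSet_le (hg.add (he n)).norm measurable_const).inter
        (measurableSet_le (hq.add (hf.mul (he n))).norm measurable_const))
    have h0 : ∀ ω, run (fun i => d i ω) (fun i => e i ω) (n+1) = (R ω).step (d n ω) (e n ω) :=
      fun ω => rfl
    simp only [h0, St.step, apply_ite St.c, apply_ite St.f, apply_ite St.g, apply_ite St.q]
    refine ⟨Measurable.ite hm hc (hc.add_const 1), Measurable.ite hm (hf.add (hd n)) measurable_const,
      Measurable.ite hm (hg.add (he n)) measurable_const,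
      Measurable.ite hm (hq.add (hf.mul (he n))) measurable_const⟩

lemma Phi_meas {Ω : Type*} [MeasurableSpace Ω] (d e : ℕ → Ω → ℂ) (hd : ∀ i, Measurable (d i))
    (he : ∀ i, Measurable (e i)) (n : ℕ) :
    Measurable (fun ω => ENNReal.ofReal (run (fun i => d i ω) (fun i => e i ω) n).Phi) := by
  obtain ⟨hc, hf, hg, hq⟩ := run_meas d e hd he n
  unfold St.Phi
  refine Measurable.ennreal_ofReal ?_
  have : Measurable fun ω => (((run (fun i => d i ω) (fun i => e i ω) n).c : ℕ) : ℝ) :=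
    (measurable_from_top (f := fun k : ℕ => (k : ℝ))).comp hc
  exact this.add (measurable_const.mul (((hf.norm.pow_const 2).add (hg.norm.pow_const 2)).add
    (hq.norm.pow_const 2)))

lemma ofReal_min_sq (z : ℂ) : ENNReal.ofReal (min 1 (‖z‖^2)) = min 1 (‖z‖ₑ ^ 2) := by
  rw [ENNReal.ofReal_min, ENNReal.ofReal_pow (norm_nonneg _), ofReal_norm_eq_enorm]; simp

lemma St.Phi_nonneg (s : St) : 0 ≤ s.Phi := by unfold St.Phi; positivity

lemma count_bound {Ω : Type*} [MeasurableSpace Ω] (μ : Measure Ω) (θ : ℕ → Ω → Ω)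
    (hθ : ∀ n, MeasurePreserving (θ n) μ μ) (d e : ℕ → Ω → ℂ)
    (hd : ∀ i, Measurable (d i)) (he : ∀ i, Measurable (e i))
    (T : ℕ) (B : Set Ω) (hB : MeasurableSet B) (hinv : ∀ n, T ≤ n → θ n ⁻¹' B = B)
    (hd1 : ∀ n ω i, i < n → d i (θ n ω) = d i ω) (hd2 : ∀ n ω, d n (θ n ω) = - d n ω)
    (he1 : ∀ n ω i, i < n → e i (θ n ω) = e i ω) (he2 : ∀ n ω, e n (θ n ω) = - e n ω)
    (hzd : ∀ i < T, ∀ ω, d i ω = 0) (hze : ∀ i < T, ∀ ω, e i ω = 0) (D : ℕ) (hD : T ≤ D) :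
    ∫⁻ ω in B, ((run (fun i => d i ω) (fun i => e i ω) D).c : ℝ≥0∞) ∂μ ≤
      32 * ∑ i ∈ Finset.range D, ∫⁻ ω in B, (min 1 (‖d i ω‖ₑ ^ 2) + min 1 (‖e i ω‖ₑ ^ 2)) ∂μ := by
  have key : ∫⁻ ω in B, ENNReal.ofReal (run (fun i => d i ω) (fun i => e i ω) D).Phi ∂μ ≤
      32 * ∑ i ∈ Finset.range D, ∫⁻ ω in B, (min 1 (‖d i ω‖ₑ ^ 2) + min 1 (‖e i ω‖ₑ ^ 2)) ∂μ := by
    induction D, hD using Nat.le_induction with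
    | base =>
      refine le_trans (le_of_eq ?_) (zero_le)
      refine (lintegral_congr fun ω => ?_).trans lintegral_zero
      rw [run_zero (fun i hi => hzd i hi ω) (fun i hi => hze i hi ω)]
      simp [St.Phi]
    | succ n hn ih =>
      have e0 := (hθ n).setLIntegral_comp_preimage hB (Phi_meas d e hd he (n+1))
      rw [hinv n hn] at e0
      have e1 : 2 * ∫⁻ ω in B, ENNReal.ofReal (run (fun i => d i ω) (fun i => e i ω) (n+1)).Phi ∂μ
        ≤ 2 * (∫⁻ ω in B, ENNReal.ofReal (run (fun i => d i ω) (fun i => e i ω) n).Phi ∂μ +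
          32 * ∫⁻ ω in B, (min 1 (‖d n ω‖ₑ ^ 2) + min 1 (‖e n ω‖ₑ ^ 2)) ∂μ) := by
        conv_lhs => rw [two_mul]
        conv_lhs => arg 2; rw [← e0]
        rw [← lintegral_add_left (Phi_meas d e hd he (n+1)), ← lintegral_const_mul' _ _ (by simp),
          ← lintegral_add_left (Phi_meas d e hd he n), ← lintegral_const_mul' _ _ (by simp)]
        refine lintegral_mono fun ω => ?_
        have h2 : run (fun i => d i (θ n ω)) (fun i => e i (θ n ω)) (n+1) =
            (run (fun i => d i ω) (fun i => e i ω) n).step (- d n ω) (- e n ω) := by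
          simp only [run]
          rw [hd2, he2, run_congr (fun i hi => hd1 n ω i hi) (fun i hi => he1 n ω i hi)]
        simp only [h2]
        rw [← ofReal_min_sq, ← ofReal_min_sq, ← ENNReal.ofReal_add (St.Phi_nonneg _) (St.Phi_nonneg _),
          ← ENNReal.ofReal_add (by positivity) (by positivity)]
        have h32 : (32 : ℝ≥0∞) = ENNReal.ofReal 32 := by simp
        have h2' : (2 : ℝ≥0∞) = ENNReal.ofReal 2 := by simp
        rw [h32, h2', ← ENNReal.ofReal_mul (by norm_num),
          ← ENNReal.ofReal_add (St.Phi_nonneg _) (by positivity), ← ENNReal.ofReal_mul (by norm_num)]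
        refine ENNReal.ofReal_le_ofReal ?_
        have := St.Phi_avg _ (run_ok (fun i => d i ω) (fun i => e i ω) n) (d n ω) (e n ω)
        simp only [run]
        linarith
      rw [ENNReal.mul_le_mul_iff_right (by simp) (by simp)] at e1
      rw [Finset.sum_range_succ, mul_add]
      exact e1.trans (by gcongr)
  refine le_trans (lintegral_mono fun ω => ?_) key
  set S := run (fun i => d i ω) (fun i => e i ω) D
  rw [← ENNReal.ofReal_natCast]
  refine ENNReal.ofReal_le_ofReal ?_
  unfold St.Phi
  have : 0 ≤ 16 * (‖S.f‖^2 + ‖S.g‖^2 + ‖S.q‖^2) := by positivity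
  linarith

end BVP

namespace BVP

/-! ### All scales -/

def cm (r s : ℝ) (m : ℕ) (d e : ℕ → ℂ) (n : ℕ) : ℕ :=
  (run (fun i => ((2 ^ (m / r) : ℝ) : ℂ) * d i) (fun i => ((2 ^ (m / s) : ℝ) : ℂ) * e i) n).c

lemma enorm_two_rpow (z : ℝ) : ‖(2 : ℝ) ^ z‖ₑ = (2 : ℝ≥0∞) ^ z := by
  rw [Real.enorm_of_nonneg (by positivity), ← ENNReal.ofReal_rpow_of_pos (by norm_num)]; simp

lemma W_small (r s t : ℝ) (hr : 0 < r) (hs : 0 < s) (ht : 0 < t) (h : 1/t = 1/r + 1/s)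
    (m : ℕ) (d e : ℕ → ℂ) {a b : ℕ} (hab : a ≤ b) (hc : cm r s m d e b = cm r s m d e a) :
    W r s t d e a b ≤ 3 * (2⁻¹) ^ m := by
  have h1 := run_same_bound _ _ hab hc
  have h2 := W_scale r s t hr.le hs.le ht.le d e (2 ^ (m / r)) (2 ^ (m / s)) a b
  have e1 : ∀ z : ℂ, ‖z‖ ≤ 1 → ‖z‖ₑ ≤ 1 := fun z hz => by
    rw [← ofReal_norm]; simpa using ENNReal.ofReal_le_ofReal hz
  have h3 : W r s t (fun i => ((2 ^ (m / r) : ℝ) : ℂ) * d i)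
      (fun i => ((2 ^ (m / s) : ℝ) : ℂ) * e i) a b ≤ 3 := by
    unfold W
    calc _ ≤ (1:ℝ≥0∞) ^ r + 1 ^ s + 1 ^ t := by
          gcongr
          exacts [e1 _ h1.1, e1 _ h1.2.1, e1 _ h1.2.2]
      _ = 3 := by simp; norm_num
  rw [h2, enorm_two_rpow, enorm_two_rpow, ← ENNReal.rpow_add _ _ (by simp) (by simp),
    ← ENNReal.rpow_mul, ← ENNReal.rpow_mul, ← ENNReal.rpow_mul] at h3
  have a1 : (m : ℝ) / r * r = m := by field_simp
  have a2 : (m : ℝ) / s * s = m := by field_simp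
  have a3 : ((m : ℝ) / r + m / s) * t = m := by
    have : t * (1/t) = t * (1/r+1/s) := by rw [h]
    have e4 : t * (1/t) = 1 := by field_simp
    calc _ = m * (t * (1/r+1/s)) := by ring
      _ = m := by rw [← this, e4, mul_one]
  rw [a1, a2, a3, ENNReal.rpow_natCast, ← mul_add, ← mul_add] at h3
  change 2 ^ m * W r s t d e a b ≤ 3 at h3
  rw [← ENNReal.inv_pow]
  calc W r s t d e a b = (2 ^ m * W r s t d e a b) * (2 ^ m)⁻¹ := by
        rw [mul_comm (2^m), mul_assoc, ENNReal.mul_inv_cancel (by simp) (by simp), mul_one]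
    _ ≤ _ := by gcongr

lemma cm_mono (r s : ℝ) (m : ℕ) (d e : ℕ → ℂ) : Monotone (cm r s m d e) := run_c_mono _ _

lemma V_le_U (r s t : ℝ) (hr : 0 < r) (hs : 0 < s) (ht : 0 < t) (h : 1/t = 1/r + 1/s)
    (d e : ℕ → ℂ) (D : ℕ) (hU : ∑' m : ℕ, (2⁻¹ : ℝ≥0∞) ^ m * (cm r s m d e D : ℝ≥0∞) < 1) :
    V (W r s t d e) 0 D ≤ 6 := by
  set U := fun n => ∑' m : ℕ, (2⁻¹ : ℝ≥0∞) ^ m * (cm r s m d e n : ℝ≥0∞) with hUdef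
  have hc0 : cm r s 0 d e D = 0 := by
    by_contra hne
    have : (1:ℝ≥0∞) ≤ (2⁻¹ : ℝ≥0∞) ^ 0 * (cm r s 0 d e D : ℝ≥0∞) := by
      simp; exact_mod_cast Nat.one_le_iff_ne_zero.2 hne
    exact absurd (lt_of_le_of_lt (this.trans (ENNReal.le_tsum 0)) hU) (lt_irrefl _)
  have key := V_le (W r s t d e) 0 D (fun n => 6 * U n) ?_ D le_rfl
  · refine key.trans ?_
    calc 6 * U D ≤ 6 * 1 := by gcongr
      _ = 6 := mul_one _
  intro a b _ hab hbD
  change 6 * U a + W r s t d e a b ≤ 6 * U b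
  by_cases hex : ∃ m, cm r s m d e b ≠ cm r s m d e a
  · classical
    set m := Nat.find hex with hm
    have h1 : cm r s m d e b ≠ cm r s m d e a := Nat.find_spec hex
    have hm0 : m ≠ 0 := by
      intro h0
      rw [h0] at h1
      have b1 := cm_mono r s 0 d e hbD
      have b2 := cm_mono r s 0 d e hab.le
      omega
    obtain ⟨k, hk⟩ := Nat.exists_eq_succ_of_ne_zero hm0
    have h2 : cm r s k d e b = cm r s k d e a := by
      have := Nat.find_min hex (m := k) (by rw [← hm]; omega)
      simpa using this
    have h3 := W_small r s t hr hs ht h k d e hab.le h2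
    have h4 : W r s t d e a b ≤ 6 * (2⁻¹) ^ m := by
      refine h3.trans (le_of_eq ?_)
      rw [hk, Nat.succ_eq_add_one, pow_succ]
      have : (6:ℝ≥0∞) * 2⁻¹ = 3 := by
        rw [show (6:ℝ≥0∞) = 3 * 2 by norm_num, mul_assoc, ENNReal.mul_inv_cancel (by simp) (by simp), mul_one]
      rw [mul_comm ((2⁻¹:ℝ≥0∞)^k), ← mul_assoc, this]
    calc 6 * U a + W r s t d e a b ≤ 6 * U a + 6 * (2⁻¹) ^ m := by gcongr
      _ = 6 * (U a + (2⁻¹) ^ m) := by ring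
      _ = 6 * (∑' k : ℕ, ((2⁻¹ : ℝ≥0∞) ^ k * (cm r s k d e a : ℝ≥0∞) +
          if k = m then (2⁻¹) ^ m else 0)) := by
          rw [ENNReal.tsum_add, tsum_ite_eq]
      _ ≤ 6 * U b := by
          refine mul_le_mul_right (ENNReal.tsum_le_tsum fun k => ?_) _
          have hmon := cm_mono r s k d e hab.le
          split_ifs with hkm
          · rw [hkm] at hmon ⊢
            have : (cm r s m d e a : ℝ≥0∞) + 1 ≤ cm r s m d e b := by
              exact_mod_cast (lt_of_le_of_ne hmon (Ne.symm h1))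
            calc _ = (2⁻¹ : ℝ≥0∞) ^ m * (cm r s m d e a + 1) := by ring
              _ ≤ _ := by gcongr
          · rw [add_zero]; gcongr
  · push Not at hex
    have hW : W r s t d e a b = 0 := by
      have : ∀ m : ℕ, W r s t d e a b ≤ 3 * (2⁻¹) ^ m := fun m =>
        W_small r s t hr hs ht h m d e hab.le (hex m)
      have lim : Filter.Tendsto (fun m : ℕ => (3:ℝ≥0∞) * (2⁻¹) ^ m) Filter.atTop (nhds (3 * 0)) :=
        ENNReal.Tendsto.const_mul (ENNReal.tendsto_pow_atTop_nhds_zero_of_lt_one (by simp)) (by simp)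
      rw [mul_zero] at lim
      exact le_antisymm (ge_of_tendsto' lim this) (zero_le)
    rw [hW, add_zero]
    refine mul_le_mul_right (ENNReal.tsum_le_tsum fun m => ?_) _
    gcongr
    exact cm_mono r s m d e hab.le

/-- elementwise sum over scales, open range -/
lemma elem1 (r ρ : ℝ) (hr0 : 0 < r) (hr2 : r ≤ 2) (hρ : r < ρ) :
    ∃ C : ℝ≥0, ∀ y : ℝ≥0∞, ∑' m : ℕ, (2⁻¹ : ℝ≥0∞) ^ m * min 1 ((2 ^ (m / ρ) * y) ^ 2) ≤ C * y ^ r := by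
  set κ : ℝ≥0∞ := 2⁻¹ * 2 ^ (r/ρ) with hκ
  have hκ1 : κ < 1 := by
    have : κ = 2 ^ (r/ρ - 1) := by
      rw [hκ, ENNReal.rpow_sub _ _ (by simp) (by simp), ENNReal.rpow_one, mul_comm, ENNReal.div_eq_inv_mul, mul_comm]
    rw [this]
    refine ENNReal.rpow_lt_one_of_one_lt_of_neg (by simp) ?_
    have : r/ρ < 1 := by rw [div_lt_one (hr0.trans hρ)]; exact hρ
    linarith
  have hfin : (1 - κ)⁻¹ ≠ ∞ := by
    rw [Ne, ENNReal.inv_eq_top]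
    exact (tsub_pos_of_lt hκ1).ne'
  refine ⟨((1 - κ)⁻¹).toNNReal, fun y => ?_⟩
  rw [ENNReal.coe_toNNReal hfin]
  have hmin : ∀ z : ℝ≥0∞, min 1 (z ^ 2) ≤ z ^ r := by
    intro z
    rcases le_total z 1 with hz | hz
    · refine (min_le_right _ _).trans ?_
      rw [← ENNReal.rpow_natCast]
      exact ENNReal.rpow_le_rpow_of_exponent_ge hz (by simpa using hr2)
    · exact (min_le_left _ _).trans (ENNReal.one_le_rpow hz hr0)
  calc _ ≤ ∑' m : ℕ, (κ ^ m * y ^ r) := by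
        refine ENNReal.tsum_le_tsum fun m => ?_
        refine le_trans (mul_le_mul_right (hmin _) _) (le_of_eq ?_)
        rw [ENNReal.mul_rpow_of_nonneg _ _ hr0.le, ← ENNReal.rpow_mul, hκ, mul_pow, mul_assoc]
        congr 2
        rw [← ENNReal.rpow_natCast, ← ENNReal.rpow_mul]
        congr 1; ring
    _ = _ := by rw [ENNReal.tsum_mul_right, ENNReal.tsum_geometric]

lemma elem2 (ρ : ℝ) (hr0 : 0 < ρ) (hr2 : ρ < 2) :
    ∃ C : ℝ≥0, ∀ y : ℝ≥0∞, ∑' m : ℕ, (2⁻¹ : ℝ≥0∞) ^ m * min 1 ((2 ^ (m / ρ) * y) ^ 2) ≤ C * y ^ ρ := by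
  set h : ℝ≥0∞ → ℝ≥0∞ := fun y => ∑' m : ℕ, (2⁻¹ : ℝ≥0∞) ^ m * min 1 ((2 ^ (m / ρ) * y) ^ 2) with hh
  set α : ℝ≥0 := 2 ^ (1/ρ) with hα
  have hαe : (α : ℝ≥0∞) = 2 ^ (1/ρ) := by
    rw [hα, ENNReal.coe_rpow_of_ne_zero (by norm_num)]; simp
  have hα1 : 1 ≤ α := NNReal.one_le_rpow (by norm_num) (by positivity)
  have hrec : ∀ y, h y = min 1 (y^2) + 2⁻¹ * h (α * y) := by
    intro y
    simp only [hh]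
    rw [tsum_eq_zero_add' ENNReal.summable, ← ENNReal.tsum_mul_left]
    congr 1
    · simp
    · refine tsum_congr fun m => ?_
      rw [pow_succ, hαe, ← mul_assoc (2 ^ ((m:ℝ)/ρ)), ← ENNReal.rpow_add _ _ (by simp) (by simp)]
      push_cast
      rw [add_div, mul_comm ((2⁻¹:ℝ≥0∞)^m), mul_assoc]
  have hle2 : ∀ y, h y ≤ 2 := by
    intro y
    calc h y ≤ ∑' m : ℕ, (2⁻¹ : ℝ≥0∞) ^ m * 1 := by
          simp only [hh]; gcongr; exact min_le_left _ _
      _ = 2 := by simp [ENNReal.tsum_geometric]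
  have hgt : (1:ℝ≥0) < α^2 / 2 := by
    rw [lt_div_iff₀ (by norm_num), one_mul]
    rw [hα, ← NNReal.rpow_natCast, ← NNReal.rpow_mul]
    nth_rewrite 1 [← NNReal.rpow_one 2]
    refine NNReal.rpow_lt_rpow_of_exponent_lt (by norm_num) ?_
    push_cast
    rw [div_mul_eq_mul_div, lt_div_iff₀ hr0]; linarith
  set K : ℝ≥0 := (α^2/2 - 1)⁻¹ with hK
  have hKK : 1 + K = K * (α^2/2) := by
    have h0 : α^2/2 - 1 ≠ 0 := (tsub_pos_of_lt hgt).ne'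
    have : K * (α^2/2 - 1 + 1) = 1 + K := by
      rw [mul_add, hK, inv_mul_cancel₀ h0, mul_one]
    rw [← this, tsub_add_cancel_of_le hgt.le]
  set C : ℝ≥0 := 2 + K * α ^ 2 with hC
  have main : ∀ (n : ℕ) (y : ℝ≥0), y ≤ α → 1 ≤ α ^ n * y → h y + K * (y:ℝ≥0∞)^2 ≤ C * (y:ℝ≥0∞) ^ ρ := by
    intro n
    have big : ∀ y : ℝ≥0, y ≤ α → 1 ≤ y → h y + K * (y:ℝ≥0∞)^2 ≤ C * (y:ℝ≥0∞) ^ ρ := by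
      intro y hy h1
      have h1' : (1:ℝ≥0∞) ≤ y := by exact_mod_cast h1
      have hy' : (y:ℝ≥0∞) ≤ α := by exact_mod_cast hy
      calc h y + K * (y:ℝ≥0∞)^2 ≤ 2 + K * (α:ℝ≥0∞)^2 := by gcongr; exact hle2 _
        _ = (C:ℝ≥0∞) * 1 := by rw [hC]; push_cast; ring
        _ ≤ _ := by gcongr; exact ENNReal.one_le_rpow h1' hr0
    induction n with
    | zero => intro y hy h1; exact big y hy (by simpa using h1)
    | succ n ih =>
      intro y hy h1
      rcases le_total 1 y with h' | h'
      · exact big y hy h'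
      have i1 := ih (α * y) (by
        calc α * y ≤ α * 1 := by gcongr
          _ = α := mul_one _) (by rw [← mul_assoc, ← pow_succ]; exact h1)
      have e1 : (((α * y : ℝ≥0) : ℝ≥0∞)) ^ ρ = 2 * (y:ℝ≥0∞)^ρ := by
        push_cast
        rw [ENNReal.mul_rpow_of_nonneg _ _ hr0.le, hαe, ← ENNReal.rpow_mul]
        congr 1
        rw [one_div, inv_mul_cancel₀ hr0.ne', ENNReal.rpow_one]
      rw [e1] at i1
      rw [hrec]
      have hK2 : (y:ℝ≥0∞)^2 + K * (y:ℝ≥0∞)^2 = 2⁻¹ * (K * ((α * y : ℝ≥0) : ℝ≥0∞)^2) := by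
        have : (2⁻¹ : ℝ≥0∞) = ((2⁻¹ : ℝ≥0) : ℝ≥0∞) := by rw [ENNReal.coe_inv (by norm_num)]; simp
        rw [this]
        norm_cast
        calc y^2 + K * y^2 = (1 + K) * y^2 := by ring
          _ = _ := by rw [hKK]; ring
      calc min 1 ((y:ℝ≥0∞)^2) + 2⁻¹ * h (α * y) + K * (y:ℝ≥0∞)^2
          ≤ (y:ℝ≥0∞)^2 + 2⁻¹ * h (α * y) + K * (y:ℝ≥0∞)^2 := by gcongr; exact min_le_right _ _
        _ = 2⁻¹ * h (α * y) + ((y:ℝ≥0∞)^2 + K * (y:ℝ≥0∞)^2) := by ring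
        _ = 2⁻¹ * (h ((α * y : ℝ≥0) : ℝ≥0∞) + K * ((α * y : ℝ≥0) : ℝ≥0∞)^2) := by
            rw [hK2, mul_add]; push_cast; rfl
        _ ≤ 2⁻¹ * (C * (2 * (y:ℝ≥0∞)^ρ)) := by gcongr
        _ = (2⁻¹ * 2) * (C * (y:ℝ≥0∞)^ρ) := by ring
        _ = _ := by rw [ENNReal.inv_mul_cancel (by simp) (by simp), one_mul]
  have hα1' : 1 < α := NNReal.one_lt_rpow (by norm_num) (by positivity)
  refine ⟨C, fun y => ?_⟩
  change h y ≤ _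
  rcases le_total 1 y with h1 | h1
  · calc h y ≤ 2 * 1 := by rw [mul_one]; exact hle2 y
      _ ≤ C * y ^ ρ := by
        gcongr
        · rw [hC]; push_cast; exact le_self_add
        · exact ENNReal.one_le_rpow h1 hr0
  lift y to ℝ≥0 using (lt_of_le_of_lt h1 (by simp)).ne
  rcases eq_or_ne y 0 with rfl | hy
  · simp [hh]
  have h1' : y ≤ 1 := by exact_mod_cast h1
  obtain ⟨n, hn⟩ := pow_unbounded_of_one_lt (y⁻¹) hα1'
  refine le_trans le_self_add (main n y (h1'.trans hα1) ?_)
  calc 1 = y⁻¹ * y := (inv_mul_cancel₀ hy).symm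
    _ ≤ _ := by gcongr

lemma elem (r ρ : ℝ) (hr0 : 0 < r) (hr2 : r ≤ 2) (hρ : r ≤ ρ) (hρ2 : ρ ≠ 2) :
    ∃ C : ℝ≥0, ∀ y : ℝ≥0∞, ∑' m : ℕ, (2⁻¹ : ℝ≥0∞) ^ m * min 1 ((2 ^ (m / ρ) * y) ^ 2) ≤ C * y ^ r := by
  rcases hρ.eq_or_lt with rfl | h
  · exact elem2 r hr0 (lt_of_le_of_ne hr2 hρ2)
  · exact elem1 r ρ hr0 hr2 h

end BVP

namespace BVP

/-- admissible exponents -/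
structure Exps (r s r1 s1 t : ℝ) : Prop where
  r0 : 0 < r
  r2 : r ≤ 2
  rr : r ≤ r1
  rne : r1 ≠ 2
  s0 : 0 < s
  s2 : s ≤ 2
  ss : s ≤ s1
  sne : s1 ≠ 2
  t0 : 0 < t
  tt : 1/t = 1/r1 + 1/s1

lemma Exps.r10 {r s r1 s1 t : ℝ} (h : Exps r s r1 s1 t) : 0 < r1 := h.r0.trans_le h.rr
lemma Exps.s10 {r s r1 s1 t : ℝ} (h : Exps r s r1 s1 t) : 0 < s1 := h.s0.trans_le h.ss

/-- martingale differences with respect to flips -/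
structure Mart {Ω : Type*} (θ : ℕ → Ω → Ω) (d : ℕ → Ω → ℂ) : Prop where
  h1 : ∀ n ω i, i < n → d i (θ n ω) = d i ω
  h2 : ∀ n ω, d n (θ n ω) = - d n ω

lemma Mart.smul {Ω : Type*} {θ : ℕ → Ω → Ω} {d : ℕ → Ω → ℂ} (h : Mart θ d) (c : ℂ) :
    Mart θ (fun i ω => c * d i ω) :=
  ⟨fun n ω i hi => by simp only [h.h1 n ω i hi], fun n ω => by simp only [h.h2 n ω]; ring⟩

lemma W_meas {Ω : Type*} [MeasurableSpace Ω] (r s t : ℝ) (d e : ℕ → Ω → ℂ)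
    (hd : ∀ i, Measurable (d i)) (he : ∀ i, Measurable (e i)) (a b : ℕ) :
    Measurable fun ω => W r s t (fun i => d i ω) (fun i => e i ω) a b := by
  have hF : ∀ d : ℕ → Ω → ℂ, (∀ i, Measurable (d i)) → ∀ a b, Measurable fun ω => dF (fun i => d i ω) a b :=
    fun d hd a b => Finset.measurable_sum _ fun i _ => hd i
  have hP : Measurable fun ω => dP (fun i => d i ω) (fun i => e i ω) a b :=
    Finset.measurable_sum _ fun i _ => (hF d hd _ _).mul (he i)
  unfold W
  exact (((hF d hd a b).enorm.pow_const r).add ((hF e he a b).enorm.pow_const s)).add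
    (hP.enorm.pow_const t)

lemma tail_bound {r s r1 s1 t : ℝ} (hx : Exps r s r1 s1 t) : ∃ C : ℝ≥0,
    ∀ {Ω : Type} [MeasurableSpace Ω] (μ : Measure Ω) (θ : ℕ → Ω → Ω)
    (_ : ∀ n, MeasurePreserving (θ n) μ μ) (d e : ℕ → Ω → ℂ)
    (_ : ∀ i, Measurable (d i)) (_ : ∀ i, Measurable (e i))
    (T : ℕ) (B : Set Ω) (_ : MeasurableSet B) (_ : ∀ n, T ≤ n → θ n ⁻¹' B = B)
    (_ : Mart θ d) (_ : Mart θ e)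
    (_ : ∀ i < T, ∀ ω, d i ω = 0) (_ : ∀ i < T, ∀ ω, e i ω = 0) (D : ℕ) (_ : T ≤ D),
    μ (B ∩ {ω | 6 < V (W r1 s1 t (fun i => d i ω) (fun i => e i ω)) 0 D}) ≤
      C * ∫⁻ ω in B, (∑ i ∈ Finset.range D, ‖d i ω‖ₑ ^ r + ∑ i ∈ Finset.range D, ‖e i ω‖ₑ ^ s) ∂μ := by
  obtain ⟨C1, hC1⟩ := elem r r1 hx.r0 hx.r2 hx.rr hx.rne
  obtain ⟨C2, hC2⟩ := elem s s1 hx.s0 hx.s2 hx.ss hx.sne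
  refine ⟨32 * (C1 + C2), ?_⟩
  intro Ω _ μ θ hθ d e hd he T B hB hinv hmd hme hzd hze D hD
  set U : Ω → ℝ≥0∞ := fun ω => ∑' m : ℕ, (2⁻¹ : ℝ≥0∞) ^ m *
    (cm r1 s1 m (fun i => d i ω) (fun i => e i ω) D : ℝ≥0∞) with hU
  have hdm : ∀ m : ℕ, ∀ i, Measurable fun ω => ((2 ^ ((m:ℝ) / r1) : ℝ) : ℂ) * d i ω :=
    fun m i => (hd i).const_mul _
  have hem : ∀ m : ℕ, ∀ i, Measurable fun ω => ((2 ^ ((m:ℝ) / s1) : ℝ) : ℂ) * e i ω :=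
    fun m i => (he i).const_mul _
  have hcm : ∀ m : ℕ, Measurable fun ω =>
      (2⁻¹ : ℝ≥0∞) ^ m * (cm r1 s1 m (fun i => d i ω) (fun i => e i ω) D : ℝ≥0∞) := fun m =>
    ((measurable_from_top (f := fun k : ℕ => (k : ℝ≥0∞))).comp
      (run_meas _ _ (hdm m) (hem m) D).1).const_mul _
  have hUm : Measurable U := Measurable.ennreal_tsum hcm
  have hc : ∀ m : ℕ, ∫⁻ ω in B, (cm r1 s1 m (fun i => d i ω) (fun i => e i ω) D : ℝ≥0∞) ∂μ ≤
      32 * ∑ i ∈ Finset.range D, ∫⁻ ω in B, (min 1 ((2 ^ (m / r1) * ‖d i ω‖ₑ) ^ 2) +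
        min 1 ((2 ^ (m / s1) * ‖e i ω‖ₑ) ^ 2)) ∂μ := by
    intro m
    have m1 := hmd.smul ((2 ^ ((m:ℝ) / r1) : ℝ) : ℂ)
    have m2 := hme.smul ((2 ^ ((m:ℝ) / s1) : ℝ) : ℂ)
    have := count_bound μ θ hθ _ _ (hdm m) (hem m) T B hB hinv m1.h1 m1.h2 m2.h1 m2.h2
      (fun i hi ω => by simp [hzd i hi ω]) (fun i hi ω => by simp [hze i hi ω]) D hD
    have hn : ∀ z : ℝ, ‖(z : ℂ)‖ₑ = ‖z‖ₑ := fun z => by simp [enorm, nnnorm]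
    simp only [enorm_mul, hn, enorm_two_rpow] at this
    exact this
  calc μ (B ∩ {ω | 6 < V (W r1 s1 t (fun i => d i ω) (fun i => e i ω)) 0 D})
      ≤ μ (B ∩ {ω | 1 ≤ U ω}) := by
        refine measure_mono (Set.inter_subset_inter_right _ fun ω hω => ?_)
        by_contra hcon
        have := V_le_U r1 s1 t hx.r10 hx.s10 hx.t0 hx.tt (fun i => d i ω) (fun i => e i ω) D
          (by simpa [hU] using hcon)
        exact absurd hω (not_lt.2 this)
    _ = 1 * (μ.restrict B) {ω | 1 ≤ U ω} := by
        rw [one_mul, Measure.restrict_apply (measurableSet_le measurable_const hUm), Set.inter_comm]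
    _ ≤ ∫⁻ ω in B, U ω ∂μ := mul_meas_ge_le_lintegral hUm 1
    _ = ∑' m : ℕ, (2⁻¹ : ℝ≥0∞) ^ m *
          ∫⁻ ω in B, (cm r1 s1 m (fun i => d i ω) (fun i => e i ω) D : ℝ≥0∞) ∂μ := by
        rw [hU, lintegral_tsum fun m => (hcm m).aemeasurable]
        refine tsum_congr fun m => lintegral_const_mul' _ _ (by simp)
    _ ≤ ∑' m : ℕ, (2⁻¹ : ℝ≥0∞) ^ m * (32 * ∑ i ∈ Finset.range D,
          ∫⁻ ω in B, (min 1 ((2 ^ (m / r1) * ‖d i ω‖ₑ) ^ 2) +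
          min 1 ((2 ^ (m / s1) * ‖e i ω‖ₑ) ^ 2)) ∂μ) := by
        refine ENNReal.tsum_le_tsum fun m => ?_
        gcongr
        exact hc m
    _ = 32 * ∑' m : ℕ, ∫⁻ ω in B, ∑ i ∈ Finset.range D,
          ((2⁻¹ : ℝ≥0∞) ^ m * min 1 ((2 ^ (m / r1) * ‖d i ω‖ₑ) ^ 2) +
          (2⁻¹ : ℝ≥0∞) ^ m * min 1 ((2 ^ (m / s1) * ‖e i ω‖ₑ) ^ 2)) ∂μ := by
        rw [← ENNReal.tsum_mul_left]
        refine tsum_congr fun m => ?_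
        rw [lintegral_finsetSum' _ fun i _ => ?_, mul_left_comm, Finset.mul_sum]
        · congr 1
          refine Finset.sum_congr rfl fun i _ => ?_
          rw [← lintegral_const_mul' _ _ (by simp)]
          simp only [mul_add]
        · have := (hd i).enorm
          have := (he i).enorm
          fun_prop
    _ = 32 * ∫⁻ ω in B, ∑' m : ℕ, ∑ i ∈ Finset.range D,
          ((2⁻¹ : ℝ≥0∞) ^ m * min 1 ((2 ^ (m / r1) * ‖d i ω‖ₑ) ^ 2) +
          (2⁻¹ : ℝ≥0∞) ^ m * min 1 ((2 ^ (m / s1) * ‖e i ω‖ₑ) ^ 2)) ∂μ := by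
        rw [lintegral_tsum]
        intro m
        refine Finset.aemeasurable_fun_sum _ fun i _ => ?_
        have := (hd i).enorm
        have := (he i).enorm
        fun_prop
    _ ≤ 32 * ∫⁻ ω in B, (C1 + C2) * (∑ i ∈ Finset.range D, ‖d i ω‖ₑ ^ r +
          ∑ i ∈ Finset.range D, ‖e i ω‖ₑ ^ s) ∂μ := by
        refine mul_le_mul_right (lintegral_mono fun ω => ?_) _
        beta_reduce
        rw [Summable.tsum_finsetSum fun i _ => ENNReal.summable, ← Finset.sum_add_distrib,
          Finset.mul_sum]
        refine Finset.sum_le_sum fun i _ => ?_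
        rw [ENNReal.tsum_add, mul_add]
        refine add_le_add ((hC1 _).trans ?_) ((hC2 _).trans ?_)
        · gcongr; exact le_self_add
        · gcongr; exact le_add_self
    _ = _ := by
        rw [lintegral_const_mul' _ _ (by simp)]
        push_cast
        ring

end BVP

namespace BVP

lemma V_congr (w w' : ℕ → ℕ → ℝ≥0∞) (a b : ℕ)
    (h : ∀ j n, a ≤ j → j < n → n ≤ b → w j n = w' j n) : V w a b = V w' a b :=
  le_antisymm (V_mono _ _ _ _ fun j n h1 h2 h3 => (h j n h1 h2 h3).le)
    (V_mono _ _ _ _ fun j n h1 h2 h3 => (h j n h1 h2 h3).ge)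

lemma W_congr (r s t : ℝ) {d d' e e' : ℕ → ℂ} {a b : ℕ} (h : ∀ i, a ≤ i → i < b → d i = d' i)
    (h' : ∀ i, a ≤ i → i < b → e i = e' i) : W r s t d e a b = W r s t d' e' a b := by
  unfold W
  rw [dF_congr h, dF_congr h', dP_congr h h']

lemma V_right_le (w : ℕ → ℕ → ℝ≥0∞) {a b : ℕ} (h : a ≤ b) : V w a b ≤ V w 0 b :=
  le_trans le_add_self (V_chain w (Nat.zero_le a) b h)

lemma trunc_sum (x : ℕ → ℝ≥0∞) (δ : ℝ≥0∞) (P : ℕ → Prop) [DecidablePred P]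
    (hP : ∀ i, P i → ∑ j ∈ Finset.range (i+1), x j ≤ δ) (n : ℕ) :
    ∑ i ∈ Finset.range n, (if P i then x i else 0) ≤ δ := by
  have h0 : ∀ n, ∑ i ∈ Finset.range n, (if P i then x i else 0) ≤ ∑ i ∈ Finset.range n, x i :=
    fun n => Finset.sum_le_sum fun i _ => by split_ifs <;> simp
  induction n with
  | zero => simp
  | succ n ih =>
    by_cases h : P n
    · exact (h0 _).trans (hP n h)
    · rw [Finset.sum_range_succ, if_neg h, add_zero]; exact ih

lemma good_lambda {r s r1 s1 t : ℝ} (hx : Exps r s r1 s1 t) : ∃ K0 : ℝ≥0, 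
    ∀ ε : ℝ≥0, 0 < ε → ∃ δ : ℝ≥0, 0 < δ ∧
    ∀ {Ω : Type} [MeasurableSpace Ω] (μ : Measure Ω) (θ : ℕ → Ω → Ω)
    (_ : ∀ n, MeasurePreserving (θ n) μ μ) (d e : ℕ → Ω → ℂ)
    (_ : ∀ i, Measurable (d i)) (_ : ∀ i, Measurable (e i))
    (_ : Mart θ d) (_ : Mart θ e) (D : ℕ),
    μ {ω | K0 < V (W r1 s1 t (fun i => d i ω) (fun i => e i ω)) 0 D} ≤
      ε * μ {ω | 1 < V (W r1 s1 t (fun i => d i ω) (fun i => e i ω)) 0 D} +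
      μ {ω | δ < ∑ i ∈ Finset.range D, ‖d i ω‖ₑ ^ r} +
      μ {ω | δ < ∑ i ∈ Finset.range D, ‖e i ω‖ₑ ^ s} := by
  classical
  obtain ⟨C, hC⟩ := tail_bound hx
  obtain ⟨C0, hC01, hC0⟩ := W_quasi r1 s1 t hx.r10 hx.s10 hx.t0 hx.tt
  have hC01' : (1:ℝ≥0∞) ≤ C0 := by exact_mod_cast hC01
  refine ⟨C0 * (3 * C0 + 6), fun ε hε => ?_⟩
  set δ : ℝ≥0 := min 1 (ε / (2 * C + 1)) with hδ
  have hδ0 : 0 < δ := lt_min one_pos (by positivity)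
  have hδ1 : (δ : ℝ≥0∞) ≤ 1 := by exact_mod_cast min_le_left _ _
  have hδε : (C : ℝ≥0∞) * (δ + δ) ≤ ε := by
    norm_cast
    calc C * (δ + δ) = 2 * C * δ := by ring
      _ ≤ (2 * C + 1) * (ε / (2 * C + 1)) := by gcongr; exact le_self_add; exact min_le_right _ _
      _ = ε := by field_simp
  refine ⟨δ, hδ0, ?_⟩
  intro Ω _ μ θ hθ d e hd he hmd hme D
  set v : ℕ → Ω → ℝ≥0∞ := fun n ω => V (W r1 s1 t (fun i => d i ω) (fun i => e i ω)) 0 n with hv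
  have hvm : ∀ n, Measurable (v n) := fun n => V_measurable _ (fun i j => W_meas r1 s1 t d e hd he i j) 0 n
  set A : ℕ → Ω → ℝ≥0∞ := fun i ω => ∑ j ∈ Finset.range (i+1), ‖d j ω‖ₑ ^ r with hA
  set A' : ℕ → Ω → ℝ≥0∞ := fun i ω => ∑ j ∈ Finset.range (i+1), ‖e j ω‖ₑ ^ s with hA'
  have hAm : ∀ i, Measurable (A i) := fun i =>
    Finset.measurable_sum _ fun j _ => (hd j).enorm.pow_const r
  have hAm' : ∀ i, Measurable (A' i) := fun i =>
    Finset.measurable_sum _ fun j _ => (he j).enorm.pow_const s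
  have hnorm : ∀ (u : ℕ → Ω → ℂ), Mart θ u → ∀ n ω i, i ≤ n → ‖u i (θ n ω)‖ₑ = ‖u i ω‖ₑ := by
    intro u hu n ω i hi
    rcases hi.eq_or_lt with rfl | h
    · rw [hu.h2, enorm_neg]
    · rw [hu.h1 n ω i h]
  have hAi : ∀ n ω i, i ≤ n → A i (θ n ω) = A i ω := fun n ω i hi =>
    Finset.sum_congr rfl fun j hj => by
      rw [hnorm d hmd n ω j (by have := Finset.mem_range.1 hj; omega)]
  have hAi' : ∀ n ω i, i ≤ n → A' i (θ n ω) = A' i ω := fun n ω i hi =>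
    Finset.sum_congr rfl fun j hj => by
      rw [hnorm e hme n ω j (by have := Finset.mem_range.1 hj; omega)]
  have hvi : ∀ n ω m, m ≤ n → v m (θ n ω) = v m ω := fun n ω m hm =>
    V_congr _ _ _ _ fun j k _ _ hk => W_congr _ _ _ (fun i _ hi => hmd.h1 n ω i (by omega))
      (fun i _ hi => hme.h1 n ω i (by omega))
  -- the stopping sets
  set B : ℕ → Set Ω := fun k => {ω | v k ω ≤ 1} ∩ {ω | 1 < v (k+1) ω} with hB
  have hBm : ∀ k, MeasurableSet (B k) := fun k =>
    (measurableSet_le (hvm k) measurable_const).inter (measurableSet_lt measurable_const (hvm _))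
  have hBi : ∀ k n, k + 1 ≤ n → θ n ⁻¹' (B k) = B k := by
    intro k n hk
    ext ω
    simp only [hB, Set.mem_preimage, Set.mem_inter_iff, Set.mem_setOf_eq]
    rw [hvi n ω k (by omega), hvi n ω (k+1) hk]
  -- truncated differences
  let P : ℕ → Ω → ℕ → Prop := fun k ω i => k + 1 ≤ i ∧ A i ω ≤ δ ∧ A' i ω ≤ δ
  have hPm : ∀ k i, MeasurableSet {ω | P k ω i} := fun k i =>
    (MeasurableSet.const _).inter ((measurableSet_le (hAm i) measurable_const).inter
      (measurableSet_le (hAm' i) measurable_const))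
  have hPi : ∀ k n ω i, i ≤ n → (P k (θ n ω) i ↔ P k ω i) := by
    intro k n ω i hi
    simp only [P]
    rw [hAi n ω i hi, hAi' n ω i hi]
  let tr : ℕ → (ℕ → Ω → ℂ) → ℕ → Ω → ℂ := fun k u i ω => if P k ω i then u i ω else 0
  have htrm : ∀ k u, (∀ i, Measurable (u i)) → ∀ i, Measurable (tr k u i) := fun k u hu i =>
    Measurable.ite (hPm k i) (hu i) measurable_const
  have htrM : ∀ k u, Mart θ u → Mart θ (tr k u) := by
    intro k u hu
    refine ⟨fun n ω i hi => ?_, fun n ω => ?_⟩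
    · simp only [tr, hPi k n ω i hi.le, hu.h1 n ω i hi]
    · simp only [tr, hPi k n ω n le_rfl, hu.h2 n ω]
      split_ifs <;> simp
  have htrz : ∀ k u, ∀ i < k + 1, ∀ ω, tr k u i ω = 0 := by
    intro k u i hi ω
    simp only [tr]
    rw [if_neg]
    intro hp
    have := hp.1
    omega
  -- bound on each piece
  have hpiece : ∀ k < D, μ (B k ∩ {ω | 6 < V (W r1 s1 t (fun i => tr k d i ω) (fun i => tr k e i ω)) 0 D})
      ≤ ε * μ (B k) := by
    intro k hk
    refine (hC μ θ hθ _ _ (htrm k d hd) (htrm k e he) (k+1) (B k) (hBm k) (hBi k) (htrM k d hmd)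
      (htrM k e hme) (htrz k d) (htrz k e) D hk).trans ?_
    calc _ ≤ (C : ℝ≥0∞) * ∫⁻ ω in B k, (δ + δ : ℝ≥0∞) ∂μ := by
          gcongr with ω
          · refine le_trans (le_of_eq ?_) (trunc_sum (fun i => ‖d i ω‖ₑ ^ r) δ (P k ω)
              (fun i hi => hi.2.1) D)
            refine Finset.sum_congr rfl fun i _ => ?_
            simp only [tr]
            split_ifs <;> simp [hx.r0]
          · refine le_trans (le_of_eq ?_) (trunc_sum (fun i => ‖e i ω‖ₑ ^ s) δ (P k ω)
              (fun i hi => hi.2.2) D)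
            refine Finset.sum_congr rfl fun i _ => ?_
            simp only [tr]
            split_ifs <;> simp [hx.s0]
      _ = C * (δ + δ) * μ (B k) := by
          rw [lintegral_const, Measure.restrict_apply_univ, mul_assoc]
      _ ≤ _ := by gcongr
  -- disjointness
  have hdisj : ∑ k ∈ Finset.range D, μ (B k) ≤ μ {ω | 1 < v D ω} := by
    rw [← measure_biUnion_finset]
    · refine measure_mono ?_
      intro ω hω
      simp only [Set.mem_iUnion] at hω
      obtain ⟨k, hk, hω⟩ := hω
      exact lt_of_lt_of_le hω.2 (V_mono_right _ (Nat.zero_le _) (Finset.mem_range.1 hk))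
    · have : ∀ k l, k < l → Disjoint (B k) (B l) := by
        intro k l hkl
        rw [Set.disjoint_left]
        intro ω h1 h2
        have : v (k+1) ω ≤ v l ω := V_mono_right _ (Nat.zero_le _) hkl
        exact absurd (lt_of_lt_of_le h1.2 (this.trans h2.1)) (lt_irrefl _)
      intro k _ l _ hkl
      rcases lt_or_gt_of_ne hkl with h | h
      · exact this k l h
      · exact (this l k h).symm
    · exact fun k _ => hBm k
  -- covering
  have hcov : {ω | ((C0 * (3 * C0 + 6) : ℝ≥0) : ℝ≥0∞) < v D ω} ⊆
      ((⋃ k ∈ Finset.range D, B k ∩ {ω | 6 < V (W r1 s1 t (fun i => tr k d i ω)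
        (fun i => tr k e i ω)) 0 D}) ∪ {ω | δ < ∑ i ∈ Finset.range D, ‖d i ω‖ₑ ^ r}) ∪
        {ω | δ < ∑ i ∈ Finset.range D, ‖e i ω‖ₑ ^ s} := by
    intro ω hω
    by_cases h1 : (δ:ℝ≥0∞) < ∑ i ∈ Finset.range D, ‖d i ω‖ₑ ^ r
    · exact Or.inl (Or.inr h1)
    by_cases h2 : (δ:ℝ≥0∞) < ∑ i ∈ Finset.range D, ‖e i ω‖ₑ ^ s
    · exact Or.inr h2
    refine Or.inl (Or.inl ?_)
    push Not at h1 h2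
    have hbig : 1 < v D ω := by
      refine lt_of_le_of_lt ?_ hω
      push_cast
      calc (1:ℝ≥0∞) = 1 * 1 := (one_mul _).symm
        _ ≤ C0 * (3 * C0 + 6) := by
          gcongr
          exact le_trans (b := (6:ℝ≥0∞)) (by norm_num) le_add_self
    have hex : ∃ n, 1 < v n ω := ⟨D, hbig⟩
    have hn := Nat.find_spec hex
    have hnD : Nat.find hex ≤ D := Nat.find_min' hex hbig
    have hn0 : Nat.find hex ≠ 0 := by
      intro h0
      rw [h0] at hn
      simp [hv, V_self] at hn
    obtain ⟨k, hk⟩ := Nat.exists_eq_succ_of_ne_zero hn0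
    have hk1 : v k ω ≤ 1 := not_lt.1 (Nat.find_min hex (m := k) (by omega))
    rw [hk] at hn hnD
    simp only [Set.mem_iUnion]
    refine ⟨k, Finset.mem_range.2 hnD, ⟨hk1, hn⟩, ?_⟩
    by_contra hle
    simp only [Set.mem_setOf_eq, not_lt] at hle
    have hW : V (W r1 s1 t (fun i => d i ω) (fun i => e i ω)) (k+1) D ≤ 6 := by
      refine le_trans (le_of_eq ?_) ((V_right_le _ hnD).trans hle)
      refine V_congr _ _ _ _ fun a b ha _ hb => ?_
      have hPk : ∀ i, a ≤ i → i < b → P k ω i := by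
        intro i hai hib
        refine ⟨ha.trans hai, ?_, ?_⟩
        · exact (Finset.sum_le_sum_of_subset (Finset.range_subset_range.2 (by omega))).trans h1
        · exact (Finset.sum_le_sum_of_subset (Finset.range_subset_range.2 (by omega))).trans h2
      refine W_congr _ _ _ (fun i h3 h4 => ?_) (fun i h3 h4 => ?_)
      · simp only [tr]; rw [if_pos (hPk i h3 h4)]
      · simp only [tr]; rw [if_pos (hPk i h3 h4)]
    have hlast : V (W r1 s1 t (fun i => d i ω) (fun i => e i ω)) k (k+1) ≤ 2 := by
      have one : ∀ (u : ℂ) (a b : ℝ), 0 < a → a ≤ b → ‖u‖ₑ ^ a ≤ δ → ‖u‖ₑ ^ b ≤ 1 := by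
        intro u a b ha hab h
        have h1 : ‖u‖ₑ ≤ 1 := by
          by_contra hc
          push Not at hc
          exact absurd (h.trans hδ1) (not_le.2 (ENNReal.one_lt_rpow hc ha))
        exact ENNReal.rpow_le_one h1 (ha.le.trans hab)
      refine (V_le _ k (k+1) (fun j => if j = k then 0 else 2) ?_ (k+1) le_rfl).trans ?_
      · intro j m h3 h4 h5
        have : j = k := by omega
        have : m = k + 1 := by omega
        subst_vars
        have f1 : ‖d j ω‖ₑ ^ r1 ≤ 1 := one _ r r1 hx.r0 hx.rr
          ((Finset.single_le_sum (f := fun i => ‖d i ω‖ₑ ^ r) (fun _ _ => zero_le)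
            (Finset.mem_range.2 hnD)).trans h1)
        have f2 : ‖e j ω‖ₑ ^ s1 ≤ 1 := one _ s s1 hx.s0 hx.ss
          ((Finset.single_le_sum (f := fun i => ‖e i ω‖ₑ ^ s) (fun _ _ => zero_le)
            (Finset.mem_range.2 hnD)).trans h2)
        simp only [W, dF_succ _ le_rfl, dP_succ _ _ le_rfl]
        simp only [dF_self, dP_self, zero_add, zero_mul, enorm_zero, ENNReal.zero_rpow_of_pos hx.t0,
          if_true, add_zero, Nat.succ_ne_self, if_false]
        calc _ ≤ (1:ℝ≥0∞) + 1 := add_le_add f1 f2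
          _ = _ := by norm_num
      · simp
    have q1 := V_quasi (W r1 s1 t (fun i => d i ω) (fun i => e i ω)) C0 hC01' (hC0 _ _)
      (Nat.zero_le (k+1)) hnD
    have q2 := V_quasi (W r1 s1 t (fun i => d i ω) (fun i => e i ω)) C0 hC01' (hC0 _ _)
      (Nat.zero_le k) (Nat.le_succ k)
    have : v D ω ≤ ((C0 * (3 * C0 + 6) : ℝ≥0) : ℝ≥0∞) := by
      push_cast
      calc v D ω ≤ _ := q1
        _ ≤ C0 * (C0 * (1 + 2) + 6) := by
          gcongr
          exact q2.trans (by gcongr)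
        _ = _ := by ring
    exact absurd hω (not_lt.2 this)
  calc _ ≤ _ := measure_mono hcov
    _ ≤ _ := (measure_union_le _ _).trans (add_le_add_left (measure_union_le _ _) _)
    _ ≤ _ := by
      refine add_le_add_left (add_le_add_left ?_ _) _
      calc _ ≤ ∑ k ∈ Finset.range D, μ (B k ∩ {ω | 6 < V (W r1 s1 t (fun i => tr k d i ω)
            (fun i => tr k e i ω)) 0 D}) := measure_biUnion_finset_le _ _
        _ ≤ ∑ k ∈ Finset.range D, ε * μ (B k) :=
            Finset.sum_le_sum fun k hk => hpiece k (Finset.mem_range.1 hk)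
        _ = ε * ∑ k ∈ Finset.range D, μ (B k) := by rw [Finset.mul_sum]
        _ ≤ _ := by gcongr

end BVP

namespace BVP

lemma lint_scale (K : ℝ) (hK : 0 < K) (G : ℝ → ℝ≥0∞) : ∫⁻ l in Set.Ioi (0:ℝ), G (K * l) = ENNReal.ofReal (K⁻¹) * ∫⁻ l in Set.Ioi (0:ℝ), G l := by
  rw [← lintegral_indicator measurableSet_Ioi, ← lintegral_indicator measurableSet_Ioi]
  have e1 : ∀ l, (Set.Ioi (0:ℝ)).indicator (fun l => G (K*l)) l = ((Set.Ioi (0:ℝ)).indicator G) (K * l) := by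
    intro l
    simp [Set.indicator, hK]
  simp_rw [e1]
  have h := (Homeomorph.mulLeft₀ K hK.ne').measurableEmbedding.lintegral_map (μ := volume) ((Set.Ioi (0:ℝ)).indicator G)
  have h2 : Measure.map (Homeomorph.mulLeft₀ K hK.ne') volume = ENNReal.ofReal |K⁻¹| • (volume : Measure ℝ) := Real.map_volume_mul_left hK.ne'
  rw [h2, lintegral_smul_measure] at h
  rw [abs_of_pos (by positivity)] at h
  simpa using h.symm

lemma one_lt_iff (l : ℝ≥0∞) (hl : l ≠ 0) (hl' : l ≠ ∞) (a : ℝ) (ha : 0 < a) (X : ℝ≥0∞) : 1 < l ^ (-a) * X ↔ l < X ^ a⁻¹ := by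
  rw [ENNReal.lt_rpow_inv_iff ha, ENNReal.rpow_neg]
  have h0 : l ^ a ≠ 0 := by simp [hl, hl', ha.le]
  have h1 : l ^ a ≠ ∞ := ENNReal.rpow_ne_top_of_nonneg ha.le hl'
  constructor
  · intro h
    by_contra hc
    push Not at hc
    refine absurd h (not_lt.2 ?_)
    calc _ ≤ (l^a)⁻¹ * l ^ a := by gcongr
      _ = 1 := ENNReal.inv_mul_cancel h0 h1
  · intro h
    by_contra hc
    push Not at hc
    refine absurd h (not_lt.2 ?_)
    calc X = l ^ a * ((l ^ a)⁻¹ * X) := by rw [← mul_assoc, ENNReal.mul_inv_cancel h0 h1, one_mul]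
      _ ≤ l ^ a * 1 := by gcongr
      _ = _ := mul_one _

lemma layer_cake {Ω : Type} [MeasurableSpace Ω] (μ : Measure Ω) [SigmaFinite μ] (Y : Ω → ℝ≥0∞) (hY : Measurable Y) :
   ∫⁻ ω, Y ω ∂μ = ∫⁻ l in Set.Ioi (0:ℝ), μ {ω | ENNReal.ofReal l < Y ω} := by
  have h1 : ∀ y : ℝ≥0∞, y = ∫⁻ l in Set.Ioi (0:ℝ), ({l : ℝ | ENNReal.ofReal l < y}.indicator 1 l) := by
    intro y
    have hm : MeasurableSet {l : ℝ | ENNReal.ofReal l < y} := measurableSet_lt (by fun_prop) measurable_const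
    rw [lintegral_indicator_one hm, Measure.restrict_apply hm]
    rcases eq_or_ne y ∞ with rfl | hy
    · simp
    · have : {l : ℝ | ENNReal.ofReal l < y} ∩ Set.Ioi 0 = Set.Ioo 0 y.toReal := by
        ext l
        simp only [Set.mem_inter_iff, Set.mem_setOf_eq, Set.mem_Ioi, Set.mem_Ioo]
        constructor
        · rintro ⟨h1, h2⟩
          exact ⟨h2, (ENNReal.ofReal_lt_iff_lt_toReal h2.le hy).1 h1⟩
        · rintro ⟨h1, h2⟩
          exact ⟨(ENNReal.ofReal_lt_iff_lt_toReal h1.le hy).2 h2, h1⟩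
      rw [this]; simp [hy]
  have hm2 : MeasurableSet {z : Ω × ℝ | ENNReal.ofReal z.2 < Y z.1} := measurableSet_lt (by fun_prop) (by fun_prop)
  calc ∫⁻ ω, Y ω ∂μ = ∫⁻ ω, (∫⁻ l in Set.Ioi (0:ℝ), ({z : Ω × ℝ | ENNReal.ofReal z.2 < Y z.1}.indicator 1 (ω, l))) ∂μ := by
        refine lintegral_congr fun ω => ?_
        exact h1 (Y ω)
    _ = ∫⁻ l in Set.Ioi (0:ℝ), (∫⁻ ω, ({z : Ω × ℝ | ENNReal.ofReal z.2 < Y z.1}.indicator 1 (ω, l)) ∂μ) :=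
        lintegral_lintegral_swap ((measurable_one.indicator hm2).aemeasurable)
    _ = _ := by
        refine lintegral_congr fun l => ?_
        have hm : MeasurableSet {ω | ENNReal.ofReal l < Y ω} := measurableSet_lt (by fun_prop) hY
        rw [← lintegral_indicator_one hm]
        rfl

def wF (r : ℝ) (d : ℕ → ℂ) (a b : ℕ) : ℝ≥0∞ := ‖dF d a b‖ₑ ^ r
def wP (t : ℝ) (d e : ℕ → ℂ) (a b : ℕ) : ℝ≥0∞ := ‖dP d e a b‖ₑ ^ t

/-- combined increments at height `l` -/
def Wl (α β γ r1 s1 t : ℝ) (l : ℝ≥0∞) (d e : ℕ → ℂ) (a b : ℕ) : ℝ≥0∞ :=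
  l ^ (-α) * wF r1 d a b + l ^ (-β) * wF s1 e a b + l ^ (-γ) * wP t d e a b

lemma V_Wl_scale {α β γ r1 s1 t c : ℝ} (hα : c ≤ α) (hβ : c ≤ β) (hγ : c ≤ γ)
    (K l : ℝ≥0∞) (hK : 1 ≤ K) (hK' : K ≠ ∞) (hl : l ≠ 0) (hl' : l ≠ ∞) (d e : ℕ → ℂ) (D : ℕ) :
    V (Wl α β γ r1 s1 t (K * l) d e) 0 D ≤ K ^ (-c) * V (Wl α β γ r1 s1 t l d e) 0 D := by
  refine le_trans (V_mono _ (fun a b => K ^ (-c) * Wl α β γ r1 s1 t l d e a b) _ _ ?_)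
    (V_const_mul _ _ _ _)
  intro a b _ _ _
  have h : ∀ a, c ≤ a → (K * l) ^ (-a) ≤ K ^ (-c) * l ^ (-a) := by
    intro a ha
    rw [ENNReal.mul_rpow_of_ne_zero (by positivity) hl]
    gcongr
  unfold Wl
  calc _ ≤ (K ^ (-c) * l ^ (-α)) * wF r1 d a b + (K ^ (-c) * l ^ (-β)) * wF s1 e a b
        + (K ^ (-c) * l ^ (-γ)) * wP t d e a b := by
        gcongr
        exacts [h _ hα, h _ hβ, h _ hγ]
    _ = _ := by ring

theorem mart_main {r s r1 s1 t : ℝ} (hx : Exps r s r1 s1 t) (p q : ℝ) (hp : 0 < p) (hq : 0 < q) :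
    ∃ C : ℝ≥0,
    ∀ {Ω : Type} [MeasurableSpace Ω] (μ : Measure Ω) [SigmaFinite μ] (θ : ℕ → Ω → Ω)
    (_ : ∀ n, MeasurePreserving (θ n) μ μ) (d e : ℕ → Ω → ℂ)
    (_ : ∀ i, Measurable (d i)) (_ : ∀ i, Measurable (e i))
    (_ : Mart θ d) (_ : Mart θ e) (D : ℕ),
    ∫⁻ ω, ((V (wF r1 (fun i => d i ω)) 0 D) ^ (p/r1) + (V (wF s1 (fun i => e i ω)) 0 D) ^ (q/s1) +
      (V (wP t (fun i => d i ω) (fun i => e i ω)) 0 D) ^ (t * (1/p+1/q))⁻¹) ∂μ ≤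
      C * (∫⁻ ω, (∑ i ∈ Finset.range D, ‖d i ω‖ₑ ^ r) ^ (p/r) ∂μ +
        ∫⁻ ω, (∑ i ∈ Finset.range D, ‖e i ω‖ₑ ^ s) ^ (q/s) ∂μ) := by
  obtain ⟨K0, hK0⟩ := good_lambda hx
  obtain ⟨C0, hC01, hC0⟩ := W_quasi r1 s1 t hx.r10 hx.s10 hx.t0 hx.tt
  have hC01' : (1:ℝ≥0∞) ≤ C0 := by exact_mod_cast hC01
  have hr1 := hx.r10
  have hs1 := hx.s10
  have ht := hx.t0
  have hr := hx.r0
  have hs := hx.s0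
  set α := r1/p with hα
  set β := s1/q with hβ
  set γ := t * (1/p+1/q) with hγ
  have hα0 : 0 < α := by positivity
  have hβ0 : 0 < β := by positivity
  have hγ0 : 0 < γ := by positivity
  have hαi : p/r1 = α⁻¹ := by rw [hα, inv_div]
  have hβi : q/s1 = β⁻¹ := by rw [hβ, inv_div]
  set c := min α (min β γ) with hc
  have hc0 : 0 < c := lt_min hα0 (lt_min hβ0 hγ0)
  set K : ℝ≥0 := (K0 + 1) ^ (1/c) with hK
  have hK1 : 1 ≤ K := NNReal.one_le_rpow le_add_self (by positivity)
  have hKc : (K : ℝ≥0∞) ^ c = K0 + 1 := by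
    rw [← ENNReal.coe_rpow_of_nonneg _ hc0.le, hK, ← NNReal.rpow_mul, one_div,
      inv_mul_cancel₀ hc0.ne', NNReal.rpow_one]
    push_cast; rfl
  have hKpos : 0 < K := lt_of_lt_of_le one_pos hK1
  obtain ⟨δ, hδ, hgood⟩ := hK0 ((2 * K)⁻¹) (by positivity)
  have hδe : (δ:ℝ≥0∞) ≠ 0 := by exact_mod_cast hδ.ne'
  set Cδ : ℝ≥0 := 2 * K * ((δ⁻¹) ^ (p/r) + (δ⁻¹) ^ (q/s)) with hCδ
  refine ⟨3 * Cδ, ?_⟩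
  intro Ω _ μ _ θ hθ d e hd he hmd hme D
  set SA : Ω → ℝ≥0∞ := fun ω => ∑ i ∈ Finset.range D, ‖d i ω‖ₑ ^ r with hSA
  set SB : Ω → ℝ≥0∞ := fun ω => ∑ i ∈ Finset.range D, ‖e i ω‖ₑ ^ s with hSB
  have hSAm : Measurable SA := Finset.measurable_sum _ fun j _ => (hd j).enorm.pow_const r
  have hSBm : Measurable SB := Finset.measurable_sum _ fun j _ => (he j).enorm.pow_const s
  set RA := ∫⁻ ω, (SA ω) ^ (p/r) ∂μ with hRA
  set RB := ∫⁻ ω, (SB ω) ^ (q/s) ∂μ with hRB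
  have hFm : ∀ d : ℕ → Ω → ℂ, (∀ i, Measurable (d i)) → ∀ a b, Measurable fun ω => dF (fun i => d i ω) a b :=
    fun d hd a b => Finset.measurable_sum _ fun i _ => hd i
  have hPm : ∀ a b, Measurable fun ω => dP (fun i => d i ω) (fun i => e i ω) a b := fun a b =>
    Finset.measurable_sum _ fun i _ => (hFm d hd _ _).mul (he i)
  have hVFm : ∀ (d : ℕ → Ω → ℂ) (x : ℝ), (∀ i, Measurable (d i)) →
      Measurable fun ω => V (wF x (fun i => d i ω)) 0 D := fun d x hd =>
    V_measurable _ (fun i j => (hFm d hd i j).enorm.pow_const x) 0 D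
  have hVPm : Measurable fun ω => V (wP t (fun i => d i ω) (fun i => e i ω)) 0 D :=
    V_measurable _ (fun i j => (hPm i j).enorm.pow_const t) 0 D
  set vl : ℝ → Ω → ℝ≥0∞ := fun l ω =>
    V (Wl α β γ r1 s1 t (ENNReal.ofReal l) (fun i => d i ω) (fun i => e i ω)) 0 D with hvl
  -- relation with W
  have hsc : ∀ l : ℝ, 0 < l → ∀ u v : ℕ → ℂ, W r1 s1 t (fun i => ((l ^ (-(1/p)) : ℝ) : ℂ) * u i)
      (fun i => ((l ^ (-(1/q)) : ℝ) : ℂ) * v i) = Wl α β γ r1 s1 t (ENNReal.ofReal l) u v := by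
    intro l hl u v
    funext a b
    have hn : ∀ z : ℝ, ‖l ^ z‖ₑ = (ENNReal.ofReal l) ^ z := fun z => by
      rw [Real.enorm_of_nonneg (by positivity), ENNReal.ofReal_rpow_of_pos hl]
    rw [W_scale r1 s1 t hr1.le hs1.le ht.le, hn, hn,
      ← ENNReal.rpow_add _ _ (by simpa using hl) (by simp), ← ENNReal.rpow_mul, ← ENNReal.rpow_mul,
      ← ENNReal.rpow_mul]
    unfold Wl wF wP
    congr 3
    · congr 2; rw [hα]; ring
    · congr 2; rw [hβ]; ring
    · congr 1; rw [hγ]; ring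
  have hl0 : ∀ l : ℝ, 0 < l → ENNReal.ofReal l ≠ 0 := fun l hl => by simpa using hl
  -- the good lambda inequality in l
  have hG : ∀ l : ℝ, 0 < l → μ {ω | 1 < vl (K * l) ω} ≤
      ((2 * K)⁻¹ : ℝ≥0) * μ {ω | 1 < vl l ω} + μ {ω | ENNReal.ofReal l < (SA ω / δ) ^ (p/r)}
      + μ {ω | ENNReal.ofReal l < (SB ω / δ) ^ (q/s)} := by
    intro l hl
    have h1 := hgood μ θ hθ _ _ (fun i => (hd i).const_mul ((l ^ (-(1/p)) : ℝ) : ℂ))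
      (fun i => (he i).const_mul ((l ^ (-(1/q)) : ℝ) : ℂ)) (hmd.smul _) (hme.smul _) D
    simp only [hsc l hl] at h1
    have hS : ∀ (u : ℕ → ℂ) (a b : ℝ), 0 < a → 0 < b → (δ:ℝ≥0∞) < ∑ i ∈ Finset.range D,
        ‖((l ^ (-(1/a)) : ℝ) : ℂ) * u i‖ₑ ^ b →
        ENNReal.ofReal l < ((∑ i ∈ Finset.range D, ‖u i‖ₑ ^ b) / δ) ^ (a/b) := by
      intro u a b ha hb h
      have hn : ‖((l ^ (-(1/a)) : ℝ) : ℂ)‖ₑ = (ENNReal.ofReal l) ^ (-(1/a)) := by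
        rw [show ‖((l ^ (-(1/a)) : ℝ) : ℂ)‖ₑ = ‖l ^ (-(1/a))‖ₑ by simp [enorm, nnnorm],
          Real.enorm_of_nonneg (by positivity), ENNReal.ofReal_rpow_of_pos hl]
      simp only [enorm_mul, hn, ENNReal.mul_rpow_of_nonneg _ _ hb.le, ← ENNReal.rpow_mul,
        ← Finset.mul_sum] at h
      rw [show a/b = (b/a)⁻¹ by rw [inv_div], ← one_lt_iff _ (hl0 l hl) (by simp) _ (by positivity)]
      rw [show -(1/a) * b = -(b/a) by ring] at h
      rw [← mul_div_assoc, ENNReal.lt_div_iff_mul_lt (by simp) (by simp), one_mul]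
      exact h
    refine le_trans (measure_mono ?_) (h1.trans (add_le_add (add_le_add le_rfl (measure_mono ?_))
      (measure_mono ?_)))
    · intro ω hω
      have hω' : 1 < V (Wl α β γ r1 s1 t (ENNReal.ofReal (K * l)) (fun i => d i ω) (fun i => e i ω)) 0 D := hω
      rw [ENNReal.ofReal_mul (by positivity), ENNReal.ofReal_coe_nnreal] at hω'
      have h2 := lt_of_lt_of_le hω' (V_Wl_scale (min_le_left _ _ : c ≤ α) ((min_le_right _ _).trans (min_le_left _ _) : c ≤ β)
        ((min_le_right _ _).trans (min_le_right _ _) : c ≤ γ) K (ENNReal.ofReal l) (by exact_mod_cast hK1) (by simp)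
        (hl0 l hl) (by simp) _ _ D)
      have h3 := (one_lt_iff (K:ℝ≥0∞) (by exact_mod_cast hKpos.ne') (by simp) c hc0 _).1 h2
      rw [ENNReal.lt_rpow_inv_iff hc0, hKc] at h3
      exact lt_of_le_of_lt le_self_add h3
    · intro ω hω
      exact hS _ p r hp hr hω
    · intro ω hω
      exact hS _ q s hq hs hω
  by_cases hfin : RA + RB = ∞
  · rw [hfin]
    have : (3 * Cδ : ℝ≥0) ≠ 0 := by positivity
    rw [ENNReal.mul_top (by exact_mod_cast this)]
    exact le_top
  set I := ∫⁻ l in Set.Ioi (0:ℝ), μ {ω | 1 < vl l ω} with hI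
  have hIfin : I ≠ ∞ := by
    set M : ℝ≥0∞ := (C0:ℝ≥0∞) ^ D * D * 2 with hM
    have hMt : M ≠ ∞ := by
      rw [hM]; exact ENNReal.mul_ne_top (ENNReal.mul_ne_top (by simp) (by simp)) (by simp)
    have hle : I ≤ M ^ (p/r1) * RA + M ^ (q/s1) * RB := by
      calc I ≤ ∫⁻ l in Set.Ioi (0:ℝ), (μ {ω | ENNReal.ofReal l < M ^ (p/r1) * (SA ω) ^ (p/r)} +
            μ {ω | ENNReal.ofReal l < M ^ (q/s1) * (SB ω) ^ (q/s)}) := by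
            refine setLIntegral_mono' measurableSet_Ioi fun l hl => ?_
            refine le_trans (measure_mono ?_) (measure_union_le _ _)
            intro ω hω
            have hω' : 1 < vl l ω := hω
            have h1 : vl l ω ≤ (C0:ℝ≥0∞) ^ D * ∑ i ∈ Finset.range D,
                (‖((l ^ (-(1/p)) : ℝ) : ℂ) * d i ω‖ₑ ^ r1 + ‖((l ^ (-(1/q)) : ℝ) : ℂ) * e i ω‖ₑ ^ s1) := by
              have := V_W_crude r1 s1 t C0 hC01' _ _ (hC0 (fun i => ((l ^ (-(1/p)) : ℝ) : ℂ) * d i ω)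
                (fun i => ((l ^ (-(1/q)) : ℝ) : ℂ) * e i ω)) ht D
              rw [hsc l hl] at this
              exact this
            have hS : ∀ (u : ℕ → ℂ) (a b b1 : ℝ), 0 < a → 0 < b → 0 < b1 → ∑ i ∈ Finset.range D,
                ‖((l ^ (-(1/a)) : ℝ) : ℂ) * u i‖ₑ ^ b1 ≤
                (ENNReal.ofReal l) ^ (-(b1/a)) * (D * (∑ i ∈ Finset.range D, ‖u i‖ₑ ^ b) ^ (b1/b)) := by
              intro u a b b1 ha hb hb1
              have hn : ‖((l ^ (-(1/a)) : ℝ) : ℂ)‖ₑ = (ENNReal.ofReal l) ^ (-(1/a)) := by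
                rw [show ‖((l ^ (-(1/a)) : ℝ) : ℂ)‖ₑ = ‖l ^ (-(1/a))‖ₑ by simp [enorm, nnnorm],
                  Real.enorm_of_nonneg (Real.rpow_nonneg (le_of_lt hl) _), ENNReal.ofReal_rpow_of_pos hl]
              simp only [enorm_mul, hn, ENNReal.mul_rpow_of_nonneg _ _ hb1.le, ← ENNReal.rpow_mul,
                ← Finset.mul_sum]
              rw [show -(1/a) * b1 = -(b1/a) by ring]
              gcongr
              refine (Finset.sum_le_card_nsmul _ _ ((∑ i ∈ Finset.range D, ‖u i‖ₑ ^ b) ^ (b1/b)) ?_).trans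
                (le_of_eq ?_)
              · intro i hi
                calc ‖u i‖ₑ ^ b1 = (‖u i‖ₑ ^ b) ^ (b1/b) := by
                      rw [← ENNReal.rpow_mul]; congr 1; field_simp
                  _ ≤ _ := by
                      gcongr
                      exact Finset.single_le_sum (f := fun i => ‖u i‖ₑ ^ b) (fun _ _ => zero_le) hi
              · simp
            rw [Finset.sum_add_distrib] at h1
            have h2 := h1.trans (mul_le_mul_right (add_le_add (hS (fun i => d i ω) p r r1 hp hr hr1)
              (hS (fun i => e i ω) q s s1 hq hs hs1)) _)
            have key : ∀ a x : ℝ, ∀ S : ℝ≥0∞, 0 < a →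
                1 < (ENNReal.ofReal l) ^ (-a) * (M * S) → ENNReal.ofReal l < M ^ a⁻¹ * S ^ a⁻¹ := by
              intro a x S ha h
              rw [one_lt_iff _ (hl0 l hl) (by simp) _ ha, ENNReal.mul_rpow_of_nonneg _ _ (by positivity)] at h
              exact h
            by_contra hcon
            simp only [Set.mem_union, not_or] at hcon
            obtain ⟨n1, n2⟩ := hcon
            have m1 : (ENNReal.ofReal l) ^ (-α) * (M * (SA ω) ^ (r1/r)) ≤ 1 := by
              by_contra hh
              push Not at hh
              have := key α 0 _ hα0 hh
              rw [← hαi, ← ENNReal.rpow_mul, show r1/r*(p/r1) = p/r by field_simp] at this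
              exact n1 this
            have m2 : (ENNReal.ofReal l) ^ (-β) * (M * (SB ω) ^ (s1/s)) ≤ 1 := by
              by_contra hh
              push Not at hh
              have := key β 0 _ hβ0 hh
              rw [← hβi, ← ENNReal.rpow_mul, show s1/s*(q/s1) = q/s by field_simp] at this
              exact n2 this
            have h3 : 2 * vl l ω ≤ 2 * 1 := by
              calc 2 * vl l ω ≤ 2 * _ := mul_le_mul_right h2 _
                _ = (ENNReal.ofReal l) ^ (-α) * (M * (SA ω) ^ (r1/r)) +
                    (ENNReal.ofReal l) ^ (-β) * (M * (SB ω) ^ (s1/s)) := by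
                    rw [hM, hα, hβ, hSA, hSB]; ring
                _ ≤ 1 + 1 := add_le_add m1 m2
                _ = 2 * 1 := by norm_num
            rw [ENNReal.mul_le_mul_iff_right (by simp) (by simp)] at h3
            exact absurd hω' (not_lt.2 h3)
        _ = _ := by
            have anti : ∀ Y : Ω → ℝ≥0∞, Measurable fun l : ℝ => μ {ω | ENNReal.ofReal l < Y ω} := by
              intro Y
              refine Antitone.measurable fun a b hab => measure_mono fun ω hω => ?_
              exact lt_of_le_of_lt (ENNReal.ofReal_le_ofReal hab) hω
            rw [lintegral_add_left (anti _), ← layer_cake μ _ ((hSAm.pow_const _).const_mul _),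
              ← layer_cake μ _ ((hSBm.pow_const _).const_mul _), lintegral_const_mul' _ _ ?_,
              lintegral_const_mul' _ _ ?_]
            · exact ENNReal.rpow_ne_top_of_nonneg (by positivity) hMt
            · exact ENNReal.rpow_ne_top_of_nonneg (by positivity) hMt
    have hne : RA ≠ ∞ ∧ RB ≠ ∞ := by
      rw [← not_or, ← ENNReal.add_eq_top]; exact hfin
    refine ne_top_of_le_ne_top ?_ hle
    refine ENNReal.add_ne_top.2 ⟨ENNReal.mul_ne_top ?_ hne.1, ENNReal.mul_ne_top ?_ hne.2⟩
    · exact ENNReal.rpow_ne_top_of_nonneg (by positivity) hMt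
    · exact ENNReal.rpow_ne_top_of_nonneg (by positivity) hMt
  have hmain : I ≤ Cδ * (RA + RB) := by
    have h1 : ENNReal.ofReal ((K:ℝ)⁻¹) * I ≤ ((2 * K)⁻¹ : ℝ≥0) * I +
        (∫⁻ ω, (SA ω / δ) ^ (p/r) ∂μ + ∫⁻ ω, (SB ω / δ) ^ (q/s) ∂μ) := by
      rw [hI, ← lint_scale K (by exact_mod_cast hKpos) (fun l => μ {ω | 1 < vl l ω})]
      have anti : ∀ Y : Ω → ℝ≥0∞, Measurable fun l : ℝ => μ {ω | ENNReal.ofReal l < Y ω} := by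
        intro Y
        refine Antitone.measurable fun a b hab => measure_mono fun ω hω => ?_
        exact lt_of_le_of_lt (ENNReal.ofReal_le_ofReal hab) hω
      refine (setLIntegral_mono' measurableSet_Ioi hG).trans (le_of_eq ?_)
      rw [lintegral_add_right _ (anti _), lintegral_add_right _ (anti _),
        lintegral_const_mul' _ _ ENNReal.coe_ne_top, ← layer_cake μ _ ((hSAm.div_const _).pow_const _),
        ← layer_cake μ _ ((hSBm.div_const _).pow_const _), add_assoc]
    have h2 : ∫⁻ ω, (SA ω / δ) ^ (p/r) ∂μ + ∫⁻ ω, (SB ω / δ) ^ (q/s) ∂μ ≤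
        (((δ⁻¹) ^ (p/r) + (δ⁻¹) ^ (q/s) : ℝ≥0) : ℝ≥0∞) * (RA + RB) := by
      have e1 : ∀ (S : ℝ≥0∞) (x : ℝ), 0 ≤ x → (S / δ) ^ x = (((δ⁻¹) ^ x : ℝ≥0) : ℝ≥0∞) * S ^ x := by
        intro S x hx'
        rw [ENNReal.div_eq_inv_mul, ENNReal.mul_rpow_of_nonneg _ _ hx', ENNReal.coe_rpow_of_nonneg _ hx',
          ENNReal.coe_inv hδ.ne']
      simp only [e1 _ _ (by positivity : 0 ≤ p/r), e1 _ _ (by positivity : 0 ≤ q/s)]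
      rw [lintegral_const_mul' _ _ ENNReal.coe_ne_top, lintegral_const_mul' _ _ ENNReal.coe_ne_top]
      push_cast
      rw [add_mul, mul_add, mul_add]
      exact add_le_add le_self_add le_add_self
    have hKi : ENNReal.ofReal ((K:ℝ)⁻¹) = (((2*K)⁻¹ : ℝ≥0) : ℝ≥0∞) + (((2*K)⁻¹ : ℝ≥0) : ℝ≥0∞) := by
      rw [← NNReal.coe_inv, ENNReal.ofReal_coe_nnreal]
      norm_cast
      field_simp
      norm_num
    rw [hKi, add_mul] at h1
    have h3 : (((2*K)⁻¹ : ℝ≥0) : ℝ≥0∞) * I ≤ _ :=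
      (ENNReal.add_le_add_iff_left (ENNReal.mul_ne_top ENNReal.coe_ne_top hIfin)).1 h1
    calc I = ((2 * K : ℝ≥0) : ℝ≥0∞) * ((((2*K)⁻¹ : ℝ≥0) : ℝ≥0∞) * I) := by
          rw [← mul_assoc, ← ENNReal.coe_mul, mul_inv_cancel₀ (by positivity)]; simp
      _ ≤ ((2 * K : ℝ≥0) : ℝ≥0∞) * _ := mul_le_mul_right (h3.trans h2) _
      _ = _ := by rw [← mul_assoc, ← ENNReal.coe_mul]
  have hout : ∀ (Y : Ω → ℝ≥0∞) (a : ℝ), Measurable Y → 0 < a →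
      (∀ l : ℝ, 0 < l → ∀ ω, (ENNReal.ofReal l) ^ (-a) * Y ω ≤ vl l ω) →
      ∫⁻ ω, (Y ω) ^ a⁻¹ ∂μ ≤ I := by
    intro Y a hY ha h
    rw [layer_cake μ _ (hY.pow_const _)]
    refine setLIntegral_mono' measurableSet_Ioi fun l hl => measure_mono fun ω hω => ?_
    exact lt_of_lt_of_le ((one_lt_iff _ (hl0 l hl) (by simp) _ ha _).2 hω) (h l hl ω)
  have hcoef : ∀ (w w' : ℕ → ℕ → ℝ≥0∞) (x : ℝ≥0∞), x ≠ 0 → x ≠ ∞ → (∀ a b, x * w a b ≤ w' a b) →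
      x * V w 0 D ≤ V w' 0 D := by
    intro w w' x hx0 hxt h
    have h1 : V w 0 D ≤ x⁻¹ * V w' 0 D := by
      refine le_trans (V_mono _ (fun a b => x⁻¹ * w' a b) _ _ fun a b _ _ _ => ?_) (V_const_mul _ _ _ _)
      calc w a b = x⁻¹ * (x * w a b) := by rw [← mul_assoc, ENNReal.inv_mul_cancel hx0 hxt, one_mul]
        _ ≤ _ := mul_le_mul_right (h a b) _
    calc x * V w 0 D ≤ x * (x⁻¹ * V w' 0 D) := mul_le_mul_right h1 _
      _ = _ := by rw [← mul_assoc, ENNReal.mul_inv_cancel hx0 hxt, one_mul]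
  have hlp : ∀ l : ℝ, 0 < l → ∀ a : ℝ, (ENNReal.ofReal l) ^ a ≠ 0 ∧ (ENNReal.ofReal l) ^ a ≠ ∞ := by
    intro l hl a
    rw [ENNReal.ofReal_rpow_of_pos hl]
    exact ⟨by simpa using Real.rpow_pos_of_pos hl a, by simp⟩
  have o1 := hout _ α (hVFm d r1 hd) hα0 (fun l hl ω => hcoef _ _ _ (hlp l hl _).1 (hlp l hl _).2
    fun a b => by unfold Wl; rw [add_assoc]; exact le_self_add)
  have o2 := hout _ β (hVFm e s1 he) hβ0 (fun l hl ω => hcoef _ _ _ (hlp l hl _).1 (hlp l hl _).2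
    fun a b => by unfold Wl; rw [add_right_comm]; exact le_add_self)
  have o3 := hout _ γ hVPm hγ0 (fun l hl ω => hcoef _ _ _ (hlp l hl _).1 (hlp l hl _).2
    fun a b => by unfold Wl; exact le_add_self)
  rw [hαi, hβi]
  rw [lintegral_add_right _ (hVPm.pow_const _), lintegral_add_right _ ((hVFm e s1 he).pow_const _)]
  calc _ ≤ I + I + I := add_le_add (add_le_add o1 o2) o3
    _ = 3 * I := by ring
    _ ≤ 3 * (Cδ * (RA + RB)) := by gcongr
    _ = _ := by push_cast; ring

end BVP

namespace BVP

/-! ### Maximal function -/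

/-- average over a centred interval -/
def av (w : ℝ → ℝ≥0∞) (x R : ℝ) : ℝ≥0∞ :=
  (ENNReal.ofReal (2 * R))⁻¹ * ∫⁻ y in Metric.closedBall x R, w y

/-- dyadic-radius maximal function -/
def Mx (w : ℝ → ℝ≥0∞) (x : ℝ) : ℝ≥0∞ := ⨆ j : ℤ, av w x ((2:ℝ) ^ j)

lemma av_meas {w : ℝ → ℝ≥0∞} (hw : Measurable w) (R : ℝ) : Measurable fun x => av w x R := by
  unfold av
  refine Measurable.const_mul ?_ _
  have : ∀ x, ∫⁻ y in Metric.closedBall x R, w y =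
      ∫⁻ y, ({z : ℝ × ℝ | dist z.2 z.1 ≤ R}.indicator (fun z => w z.2)) (x, y) := by
    intro x
    rw [← lintegral_indicator measurableSet_closedBall]
    rfl
  simp_rw [this]
  refine Measurable.lintegral_prod_right' (Measurable.indicator (hw.comp measurable_snd) ?_)
  exact measurableSet_le (measurable_snd.dist measurable_fst) measurable_const

lemma Mx_meas {w : ℝ → ℝ≥0∞} (hw : Measurable w) : Measurable (Mx w) :=
  Measurable.iSup fun _ => av_meas hw _

lemma weak (w : ℝ → ℝ≥0∞) (l : ℝ≥0∞) (hl : l ≠ 0) (hl' : l ≠ ∞) :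
    volume {x | l < Mx w x} ≤ 5 * l⁻¹ * ∫⁻ y, w y := by
  by_cases hfin : ∫⁻ y, w y = ∞
  · rw [hfin, ENNReal.mul_top]; exact le_top
    simp [hl']
  have hS : ∀ x : {x | l < Mx w x}, ∃ j : ℤ, l < av w x ((2:ℝ) ^ j) := by
    rintro ⟨x, hx⟩
    exact lt_iSup_iff.1 hx
  set ι := {x | l < Mx w x}
  choose J hJ using hS
  have hJ' : ∀ x : ι, l * ENNReal.ofReal (2 * (2:ℝ) ^ (J x)) ≤
      ∫⁻ y in Metric.closedBall (x:ℝ) ((2:ℝ) ^ (J x)), w y := by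
    intro x
    have := (hJ x).le
    unfold av at this
    rw [← ENNReal.div_eq_inv_mul, ENNReal.le_div_iff_mul_le] at this
    · exact this
    · left; simp; positivity
    · left; exact ENNReal.ofReal_ne_top
  have hR : ∀ x ∈ (Set.univ : Set ι), (2:ℝ) ^ (J x) ≤ (l⁻¹ * ∫⁻ y, w y).toReal := by
    intro x _
    rw [← ENNReal.ofReal_le_iff_le_toReal (ENNReal.mul_ne_top (by simpa using hl) hfin)]
    rw [← ENNReal.div_eq_inv_mul, ENNReal.le_div_iff_mul_le (by simp [hl]) (by simp [hl'])]
    refine le_trans ?_ ((hJ' x).trans (setLIntegral_le_lintegral _ _))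
    rw [mul_comm]
    gcongr
    have : (0:ℝ) < 2 ^ J x := by positivity
    linarith
  obtain ⟨u, hu, hdis, hcov⟩ := Vitali.exists_disjoint_subfamily_covering_enlargement_closedBall
    (Set.univ : Set ι) (fun x => (x:ℝ)) (fun x => (2:ℝ) ^ (J x)) _ hR 5 (by norm_num)
  have hcount : u.Countable := by
    refine hdis.countable_of_nonempty_interior fun x _ => ?_
    refine ⟨(x:ℝ), ?_⟩
    exact Metric.ball_subset_interior_closedBall (Metric.mem_ball_self (by positivity))
  have : Countable u := hcount.to_subtype
  calc volume {x | l < Mx w x} ≤ volume (⋃ x : u, Metric.closedBall ((x:ι):ℝ) (5 * (2:ℝ) ^ (J x))) := by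
        refine measure_mono fun x hx => ?_
        obtain ⟨b, hb, hsub⟩ := hcov ⟨x, hx⟩ trivial
        rw [Set.mem_iUnion]
        exact ⟨⟨b, hb⟩, hsub (Metric.mem_closedBall_self (by positivity))⟩
    _ ≤ ∑' x : u, volume (Metric.closedBall ((x:ι):ℝ) (5 * (2:ℝ) ^ (J x))) := measure_iUnion_le _
    _ ≤ ∑' x : u, 5 * l⁻¹ * ∫⁻ y in Metric.closedBall ((x:ι):ℝ) ((2:ℝ) ^ (J x)), w y := by
        refine ENNReal.tsum_le_tsum fun x => ?_
        rw [Real.volume_closedBall]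
        calc ENNReal.ofReal (2 * (5 * (2:ℝ) ^ (J x))) = 5 * l⁻¹ * (l * ENNReal.ofReal (2 * (2:ℝ) ^ (J x))) := by
              rw [mul_assoc, ← mul_assoc l⁻¹, ENNReal.inv_mul_cancel hl hl', one_mul,
                show 2 * (5 * (2:ℝ) ^ (J x)) = 5 * (2 * (2:ℝ) ^ (J x)) by ring,
                ENNReal.ofReal_mul (by norm_num)]
              simp
          _ ≤ _ := by gcongr; exact hJ' x
    _ = 5 * l⁻¹ * ∫⁻ y in ⋃ x : u, Metric.closedBall ((x:ι):ℝ) ((2:ℝ) ^ (J x)), w y := by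
        rw [ENNReal.tsum_mul_left, lintegral_iUnion (fun _ => measurableSet_closedBall)]
        intro a b hab
        exact hdis a.2 b.2 (fun h => hab (Subtype.ext h))
    _ ≤ _ := by gcongr; exact Measure.restrict_le_self

lemma weak2 {w : ℝ → ℝ≥0∞} (hw : Measurable w) (l : ℝ≥0∞) (hl : l ≠ 0) (hl' : l ≠ ∞) :
    volume {x | l < Mx w x} ≤ 10 * l⁻¹ * ∫⁻ y, {y | l < 2 * w y}.indicator w y := by
  have hsub : {x | l < Mx w x} ⊆ {x | l / 2 < Mx ({y | l < 2 * w y}.indicator w) x} := by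
    intro x hx
    obtain ⟨j, hj⟩ := lt_iSup_iff.1 (show l < ⨆ j : ℤ, av w x ((2:ℝ) ^ j) from hx)
    show l / 2 < ⨆ j : ℤ, av ({y | l < 2 * w y}.indicator w) x ((2:ℝ) ^ j)
    refine lt_iSup_iff.2 ⟨j, ?_⟩
    have h1 : av w x ((2:ℝ)^j) ≤ av ({y | l < 2 * w y}.indicator w) x ((2:ℝ)^j) + l / 2 := by
      unfold av
      calc _ ≤ (ENNReal.ofReal (2 * (2:ℝ)^j))⁻¹ * ∫⁻ y in Metric.closedBall x ((2:ℝ)^j),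
            ({y | l < 2 * w y}.indicator w y + l / 2) := by
            gcongr with y
            by_cases hy : l < 2 * w y
            · rw [Set.indicator_of_mem (by exact hy)]; exact le_self_add
            · rw [Set.indicator_of_notMem (by exact hy), zero_add]
              rw [ENNReal.le_div_iff_mul_le (by simp) (by simp), mul_comm]
              exact not_lt.1 hy
        _ = _ := by
            rw [lintegral_add_right _ measurable_const, mul_add]
            congr 1
            rw [setLIntegral_const, Real.volume_closedBall, mul_comm (l/2), ← mul_assoc,
              ENNReal.inv_mul_cancel (by simp; positivity) ENNReal.ofReal_ne_top, one_mul]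
    have h2 : l / 2 + l / 2 < av ({y | l < 2 * w y}.indicator w) x ((2:ℝ)^j) + l / 2 := by
      rw [ENNReal.add_halves]; exact hj.trans_le h1
    exact lt_of_add_lt_add_right h2
  refine (measure_mono hsub).trans ((weak _ (l/2) (by simp [hl]) ?_).trans (le_of_eq ?_))
  · exact (ENNReal.div_lt_top hl' (by simp)).ne
  · rw [ENNReal.inv_div (by simp) (by simp), ENNReal.div_eq_inv_mul]
    ring

lemma inner_int (a : ℝ) (h0 : 0 < a) (h1 : a < 1) (A : ℝ≥0∞) :
    ∫⁻ l in Set.Ioi (0:ℝ), {l : ℝ | ENNReal.ofReal l < A}.indicator (fun l => (ENNReal.ofReal l) ^ (-a)) l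
      ≤ ENNReal.ofReal ((1 - a)⁻¹) * A ^ (1 - a) := by
  have h1a : 0 < 1 - a := by linarith
  by_cases hA : A = ∞
  · rw [hA, ENNReal.top_rpow_of_pos h1a, ENNReal.mul_top]
    · exact le_top
    · simp; linarith
  lift A to ℝ≥0 using hA
  calc _ ≤ ∫⁻ l in Set.Ioi (0:ℝ), (Set.Ioc (0:ℝ) A).indicator (fun l => ENNReal.ofReal (l ^ (-a))) l := by
        refine setLIntegral_mono' measurableSet_Ioi fun l hl => ?_
        by_cases h : ENNReal.ofReal l < A
        · rw [Set.indicator_of_mem (by exact h), Set.indicator_of_mem, ENNReal.ofReal_rpow_of_pos hl]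
          refine ⟨hl, ?_⟩
          have := ENNReal.toReal_mono (by simp) h.le
          rwa [ENNReal.toReal_ofReal hl.le] at this
        · rw [Set.indicator_of_notMem (by exact h)]; exact zero_le
    _ ≤ ∫⁻ l in Set.Ioc (0:ℝ) A, ENNReal.ofReal (l ^ (-a)) := by
        rw [← lintegral_indicator measurableSet_Ioc]
        exact setLIntegral_le_lintegral _ _
    _ = ENNReal.ofReal (∫ l in Set.Ioc (0:ℝ) A, l ^ (-a)) := by
        rw [ofReal_integral_eq_lintegral_ofReal]
        · exact (intervalIntegrable_iff_integrableOn_Ioc_of_le A.2).1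
            (intervalIntegral.intervalIntegrable_rpow' (by linarith))
        · refine (ae_restrict_iff' measurableSet_Ioc).2 (Filter.Eventually.of_forall fun l hl => ?_)
          exact Real.rpow_nonneg hl.1.le _
    _ = _ := by
        rw [← intervalIntegral.integral_of_le (NNReal.coe_nonneg A), integral_rpow (Or.inl (by linarith)),
          Real.zero_rpow (by linarith), sub_zero, div_eq_inv_mul, ENNReal.ofReal_mul (by
            rw [inv_nonneg]; linarith), neg_add_eq_sub, ← ENNReal.ofReal_rpow_of_nonneg (NNReal.coe_nonneg A) h1a.le]
        simp

lemma strong (v : ℝ) (hv : 1 < v) : ∃ C : ℝ≥0, ∀ w : ℝ → ℝ≥0∞, Measurable w →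
    ∫⁻ x, (Mx w x) ^ v ≤ C * ∫⁻ x, (w x) ^ v := by
  refine ⟨10 * (Real.toNNReal (1 - v⁻¹)⁻¹ * 2 ^ (v - 1)), fun w hw => ?_⟩
  have hv0 : 0 < v := by linarith
  have hv1 : v⁻¹ < 1 := inv_lt_one_of_one_lt₀ hv
  rw [layer_cake volume _ ((Mx_meas hw).pow_const v)]
  have h1 : ∀ l ∈ Set.Ioi (0:ℝ), volume {x | ENNReal.ofReal l < Mx w x ^ v} ≤
      10 * ∫⁻ y, w y * {l : ℝ | ENNReal.ofReal l < (2 * w y) ^ v}.indicator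
        (fun l => (ENNReal.ofReal l) ^ (-v⁻¹)) l := by
    intro l hl
    have hl : 0 < l := hl
    simp_rw [← ENNReal.rpow_inv_lt_iff hv0]
    refine (weak2 hw _ ?_ ?_).trans ?_
    · rw [Ne, ENNReal.rpow_eq_zero_iff]
      simp [hl, hv0.le]
    · exact ENNReal.rpow_ne_top_of_nonneg (by positivity) (by simp)
    · rw [mul_assoc, ← ENNReal.rpow_neg, ← lintegral_const_mul _ (hw.indicator (measurableSet_lt measurable_const (hw.const_mul _)))]
      refine mul_le_mul_right (lintegral_mono fun y => ?_) _
      by_cases h : ENNReal.ofReal l ^ v⁻¹ < 2 * w y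
      · rw [Set.indicator_of_mem (by exact h), Set.indicator_of_mem (by exact h), mul_comm]
      · rw [Set.indicator_of_notMem (by exact h)]; simp
  refine (setLIntegral_mono' measurableSet_Ioi h1).trans ?_
  rw [lintegral_const_mul' _ _ (by simp), lintegral_lintegral_swap]
  · rw [ENNReal.coe_mul, mul_assoc]
    refine mul_le_mul' (by simp) ?_
    rw [← lintegral_const_mul _ (hw.pow_const _)]
    refine lintegral_mono fun y => ?_
    have hm : Measurable fun l : ℝ => {l : ℝ | ENNReal.ofReal l < (2 * w y) ^ v}.indicator
        (fun l => (ENNReal.ofReal l) ^ (-v⁻¹)) l :=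
      Measurable.indicator (by fun_prop) (measurableSet_lt (by fun_prop) measurable_const)
    rw [lintegral_const_mul _ hm]
    refine (mul_le_mul_right (inner_int _ (by positivity) hv1 _) _).trans (le_of_eq ?_)
    rw [← ENNReal.rpow_mul, show v * (1 - v⁻¹) = v - 1 by field_simp,
      ENNReal.mul_rpow_of_nonneg _ _ (by linarith)]
    have : w y ^ v = w y * w y ^ (v - 1) := by
      conv_rhs => rw [← ENNReal.rpow_one (w y), ← ENNReal.rpow_mul]
      rw [← ENNReal.rpow_add_of_nonneg _ _ (by norm_num) (by linarith)]
      congr 1; ring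
    rw [this, ENNReal.coe_mul, ENNReal.coe_rpow_of_nonneg _ (by linarith), ENNReal.ofReal]
    push_cast
    ring
  · refine Measurable.aemeasurable ?_
    refine Measurable.mul (hw.comp measurable_snd) ?_
    have : (Function.uncurry fun (l y : ℝ) => {l : ℝ | ENNReal.ofReal l < (2 * w y) ^ v}.indicator
        (fun l => (ENNReal.ofReal l) ^ (-v⁻¹)) l) = {z : ℝ × ℝ | ENNReal.ofReal z.1 < (2 * w z.2) ^ v}.indicator
          (fun z => (ENNReal.ofReal z.1) ^ (-v⁻¹)) := by
      rfl
    refine (show Measurable (Function.uncurry fun (l y : ℝ) => {l : ℝ | ENNReal.ofReal l < (2 * w y) ^ v}.indicator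
        (fun l => (ENNReal.ofReal l) ^ (-v⁻¹)) l) from ?_)
    rw [this]
    refine Measurable.indicator (by fun_prop) (measurableSet_lt (by fun_prop) ?_)
    exact ((hw.comp measurable_snd).const_mul _).pow_const _

end BVP

namespace BVP

/-! ### Kernels -/

/-- polynomially decaying kernel at scale `2^{-i}` -/
def Kr (κ : ℝ) (i : ℤ) (z : ℝ) : ℝ≥0∞ :=
  ENNReal.ofReal ((2:ℝ) ^ i * (1 + (2:ℝ) ^ i * |z|) ^ (-κ))

/-- convolution with `Kr` -/
def cv (κ : ℝ) (i : ℤ) (w : ℝ → ℝ≥0∞) (x : ℝ) : ℝ≥0∞ := ∫⁻ y, Kr κ i (x - y) * w y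

lemma Kr_meas (κ : ℝ) (i : ℤ) : Measurable (Kr κ i) := by
  unfold Kr
  fun_prop

lemma cv_meas (κ : ℝ) (i : ℤ) {w : ℝ → ℝ≥0∞} (hw : Measurable w) : Measurable (cv κ i w) := by
  unfold cv
  refine Measurable.lintegral_prod_right' (f := fun z : ℝ × ℝ => Kr κ i (z.1 - z.2) * w z.2) ?_
  exact ((Kr_meas κ i).comp (measurable_fst.sub measurable_snd)).mul (hw.comp measurable_snd)

lemma Kr_le (κ : ℝ) (hκ : 1 < κ) (i : ℤ) (x y : ℝ) :
    Kr κ i (x - y) ≤ ∑' m : ℕ, (Metric.closedBall x ((2:ℝ) ^ ((m:ℤ) - i))).indicator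
      (fun _ => ENNReal.ofReal ((2:ℝ) ^ i * 2 ^ κ * ((2:ℝ) ^ (-κ)) ^ m)) y := by
  have h2 : (0:ℝ) < 2 ^ i := by positivity
  have hex : ∃ m : ℕ, (2:ℝ) ^ i * |x - y| ≤ 2 ^ m := by
    obtain ⟨m, hm⟩ := pow_unbounded_of_one_lt ((2:ℝ) ^ i * |x - y|) (by norm_num : (1:ℝ) < 2)
    exact ⟨m, hm.le⟩
  classical
  set m := Nat.find hex with hm
  have hm1 : (2:ℝ) ^ i * |x - y| ≤ 2 ^ m := Nat.find_spec hex
  refine le_trans ?_ (ENNReal.le_tsum m)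
  have hmem : y ∈ Metric.closedBall x ((2:ℝ) ^ ((m:ℤ) - i)) := by
    rw [Metric.mem_closedBall, Real.dist_eq, abs_sub_comm, zpow_sub₀ (by norm_num), le_div_iff₀ h2, mul_comm]
    exact_mod_cast hm1
  rw [Set.indicator_of_mem hmem]
  unfold Kr
  refine ENNReal.ofReal_le_ofReal ?_
  rw [mul_assoc]
  refine mul_le_mul_of_nonneg_left ?_ h2.le
  have hlow : (2:ℝ) ^ ((m:ℝ) - 1) ≤ 1 + (2:ℝ) ^ i * |x - y| := by
    rcases Nat.eq_zero_or_pos m with h0 | h0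
    · rw [h0]
      have : (2:ℝ) ^ (((0:ℕ):ℝ) - 1) ≤ 1 := Real.rpow_le_one_of_one_le_of_nonpos (by norm_num) (by norm_num)
      have h3 : 0 ≤ (2:ℝ) ^ i * |x - y| := by positivity
      linarith
    · have := Nat.find_min hex (m := m - 1) (by omega)
      rw [not_le] at this
      have h4 : (2:ℝ) ^ ((m:ℝ) - 1) = 2 ^ (m - 1) := by
        rw [← Real.rpow_natCast, Nat.cast_sub h0]; simp
      rw [h4]; linarith
  calc (1 + (2:ℝ) ^ i * |x - y|) ^ (-κ) ≤ ((2:ℝ) ^ ((m:ℝ) - 1)) ^ (-κ) :=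
        Real.rpow_le_rpow_of_nonpos (by positivity) hlow (by linarith)
    _ = _ := by
        rw [← Real.rpow_natCast, ← Real.rpow_mul (by norm_num), ← Real.rpow_mul (by norm_num),
          ← Real.rpow_add (by norm_num)]
        congr 1; ring

lemma cv_le (κ : ℝ) (hκ : 1 < κ) : ∃ C : ℝ≥0, 1 ≤ C ∧ ∀ (i : ℤ) (w : ℝ → ℝ≥0∞), Measurable w → ∀ x : ℝ,
    cv κ i w x ≤ C * Mx w x := by
  have hq : (2:ℝ≥0) ^ (1 - κ) < 1 := by
    exact NNReal.rpow_lt_one_of_one_lt_of_neg (by norm_num) (by linarith)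
  refine ⟨1 + 2 ^ (1 + κ) * (1 - (2:ℝ≥0) ^ (1 - κ))⁻¹, le_self_add, fun i w hw x => ?_⟩
  have h2 : (0:ℝ) < 2 ^ i := by positivity
  calc cv κ i w x ≤ ∫⁻ y, ∑' m : ℕ, (Metric.closedBall x ((2:ℝ) ^ ((m:ℤ) - i))).indicator
              (fun y => ENNReal.ofReal ((2:ℝ) ^ i * 2 ^ κ * ((2:ℝ) ^ (-κ)) ^ m) * w y) y := by
        refine lintegral_mono fun y => ?_
        refine (mul_le_mul_left (Kr_le κ hκ i x y) _).trans (le_of_eq ?_)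
        rw [← ENNReal.tsum_mul_right]
        refine tsum_congr fun m => ?_
        by_cases h : y ∈ Metric.closedBall x ((2:ℝ) ^ ((m:ℤ) - i))
        · simp only [Set.indicator_of_mem h]
        · simp only [Set.indicator_of_notMem h, zero_mul]
    _ = ∑' m : ℕ, ENNReal.ofReal ((2:ℝ) ^ i * 2 ^ κ * ((2:ℝ) ^ (-κ)) ^ m) *
          ∫⁻ y in Metric.closedBall x ((2:ℝ) ^ ((m:ℤ) - i)), w y := by
        rw [lintegral_tsum]
        · refine tsum_congr fun m => ?_
          rw [lintegral_indicator measurableSet_closedBall, lintegral_const_mul _ hw]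
        · intro m
          exact ((hw.const_mul _).indicator measurableSet_closedBall).aemeasurable
    _ ≤ ∑' m : ℕ, (((2 ^ (1 + κ) * ((2:ℝ≥0) ^ (1 - κ)) ^ m : ℝ≥0)) : ℝ≥0∞) * Mx w x := by
        refine ENNReal.tsum_le_tsum fun m => ?_
        have hav : av w x ((2:ℝ) ^ ((m:ℤ) - i)) ≤ Mx w x := le_iSup (fun j : ℤ => av w x ((2:ℝ) ^ j)) _
        refine le_trans (le_of_eq ?_) (mul_le_mul_right hav _)
        unfold av
        rw [← mul_assoc]
        congr 1
        have e : ENNReal.ofReal ((2:ℝ) ^ i * 2 ^ κ * ((2:ℝ) ^ (-κ)) ^ m) =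
          (((2 ^ (1 + κ) * ((2:ℝ≥0) ^ (1 - κ)) ^ m : ℝ≥0)) : ℝ≥0∞) * (ENNReal.ofReal (2 * 2 ^ ((m:ℤ) - i)))⁻¹ := by
          rw [← ENNReal.ofReal_inv_of_pos (by positivity), ← ENNReal.ofReal_coe_nnreal,
            ← ENNReal.ofReal_mul (by positivity)]
          congr 1
          push_cast
          rw [zpow_sub₀ (by norm_num), Real.rpow_add (by norm_num), Real.rpow_sub (by norm_num), Real.rpow_neg (by norm_num)]
          simp only [Real.rpow_one, zpow_natCast]
          rw [div_pow, inv_pow]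
          field_simp
        exact e
    _ = (((2 ^ (1 + κ) * (1 - (2:ℝ≥0) ^ (1 - κ))⁻¹ : ℝ≥0)) : ℝ≥0∞) * Mx w x := by
        rw [ENNReal.tsum_mul_right]
        congr 1
        rw [← ENNReal.coe_tsum]
        · rw [NNReal.tsum_mul_left, NNReal.tsum_geometric hq]
        · exact (NNReal.summable_geometric hq).mul_left _
    _ ≤ _ := by
        gcongr; exact le_add_self

lemma Mx_one (x : ℝ) : Mx (fun _ => 1) x ≤ 1 := by
  refine iSup_le fun j => ?_
  unfold av
  rw [setLIntegral_const, Real.volume_closedBall, one_mul,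
    ENNReal.inv_mul_cancel (by simp; positivity) ENNReal.ofReal_ne_top]

lemma Kr_symm (κ : ℝ) (i : ℤ) (x y : ℝ) : Kr κ i (x - y) = Kr κ i (y - x) := by
  unfold Kr; rw [abs_sub_comm]

lemma cv_symm (κ : ℝ) (i : ℤ) {b h : ℝ → ℝ≥0∞} (hb : Measurable b) (hh : Measurable h) :
    ∫⁻ x, cv κ i b x * h x = ∫⁻ x, b x * cv κ i h x := by
  unfold cv
  have hK : Measurable fun z : ℝ × ℝ => Kr κ i (z.1 - z.2) := (Kr_meas κ i).comp (measurable_fst.sub measurable_snd)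
  calc _ = ∫⁻ x, ∫⁻ y, Kr κ i (x - y) * b y * h x := by
        refine lintegral_congr fun x => ?_
        rw [lintegral_mul_const]
        exact ((Kr_meas κ i).comp (measurable_const.sub measurable_id)).mul hb
    _ = ∫⁻ y, ∫⁻ x, Kr κ i (x - y) * b y * h x := by
        refine lintegral_lintegral_swap (Measurable.aemeasurable ?_)
        exact (hK.mul (hb.comp measurable_snd)).mul (hh.comp measurable_fst)
    _ = _ := by
        refine lintegral_congr fun y => ?_
        rw [← lintegral_const_mul]
        · refine lintegral_congr fun x => ?_
          rw [Kr_symm κ i x y]; ring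
        · exact ((Kr_meas κ i).comp (measurable_const.sub measurable_id)).mul hh

lemma wHolder {ρ : ℝ} (hρ : 1 < ρ) {k g h : ℝ → ℝ≥0∞} (hk : Measurable k) (hg : Measurable g)
    (hh : Measurable h) :
    (∫⁻ y, k y * (g y * h y)) ^ ρ ≤ (∫⁻ y, k y * g y ^ ρ) * (∫⁻ y, k y * h y ^ (ρ / (ρ - 1))) ^ (ρ - 1) := by
  have hc : Real.HolderConjugate ρ (ρ / (ρ - 1)) := Real.HolderConjugate.conjExponent hρ
  have h0 : 0 < ρ := by linarith
  have h1 : 0 < ρ - 1 := by linarith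
  have key := ENNReal.lintegral_mul_le_Lp_mul_Lq volume hc
    (f := fun y => k y ^ (1/ρ) * g y) (g := fun y => k y ^ ((ρ-1)/ρ) * h y)
    ((hk.pow_const _).mul hg).aemeasurable ((hk.pow_const _).mul hh).aemeasurable
  have e1 : ∀ y, ((fun y => k y ^ (1/ρ) * g y) * (fun y => k y ^ ((ρ-1)/ρ) * h y)) y = k y * (g y * h y) := by
    intro y
    simp only [Pi.mul_apply]
    have : k y = k y ^ (1/ρ) * k y ^ ((ρ-1)/ρ) := by
      rw [← ENNReal.rpow_add_of_nonneg _ _ (by positivity) (by positivity), ← add_div]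
      rw [show (1 + (ρ - 1)) / ρ = 1 by field_simp; ring, ENNReal.rpow_one]
    conv_rhs => rw [this]
    ring
  simp_rw [e1] at key
  simp only [ENNReal.mul_rpow_of_nonneg _ _ h0.le, ENNReal.mul_rpow_of_nonneg _ _ (by positivity : 0 ≤ ρ/(ρ-1)),
    ← ENNReal.rpow_mul] at key
  rw [show 1/ρ*ρ = 1 by field_simp, show (ρ-1)/ρ*(ρ/(ρ-1)) = 1 by field_simp] at key
  simp only [ENNReal.rpow_one] at key
  refine (ENNReal.rpow_le_rpow key h0.le).trans (le_of_eq ?_)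
  rw [ENNReal.mul_rpow_of_nonneg _ _ h0.le, ← ENNReal.rpow_mul, ← ENNReal.rpow_mul,
    show 1/ρ*ρ = 1 by field_simp, ENNReal.rpow_one]
  congr 2
  field_simp

end BVP

namespace BVP

lemma Kr_shift_meas (κ : ℝ) (i : ℤ) (x : ℝ) : Measurable fun y => Kr κ i (x - y) :=
  (Kr_meas κ i).comp (measurable_const.sub measurable_id)

lemma Kr_int (κ : ℝ) (hκ : 1 < κ) : ∃ C : ℝ≥0, 1 ≤ C ∧ ∀ (i : ℤ) (x : ℝ), ∫⁻ y, Kr κ i (x - y) ≤ C := by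
  obtain ⟨C, h1, hC⟩ := cv_le κ hκ
  refine ⟨C, h1, fun i x => ?_⟩
  have := (hC i (fun _ => 1) measurable_const x).trans (mul_le_mul_right (Mx_one x) _)
  simpa [cv] using this

lemma cv_jensen (κ : ℝ) (hκ : 1 < κ) (v : ℝ) (hv : 1 ≤ v) : ∃ C : ℝ≥0, 1 ≤ C ∧ ∀ (i : ℤ) (b : ℝ → ℝ≥0∞),
    Measurable b → ∀ x, (cv κ i b x) ^ v ≤ C * cv κ i (fun y => b y ^ v) x := by
  obtain ⟨C, h1, hC⟩ := Kr_int κ hκ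
  refine ⟨C ^ (v - 1), NNReal.one_le_rpow h1 (by linarith), fun i b hb x => ?_⟩
  rcases hv.eq_or_lt with rfl | hv
  · simp
  have := wHolder hv (Kr_shift_meas κ i x) hb (measurable_const (a := (1:ℝ≥0∞)))
  simp only [mul_one, ENNReal.one_rpow] at this
  refine this.trans ?_
  rw [mul_comm, ENNReal.coe_rpow_of_nonneg _ (by linarith)]
  unfold cv
  have hv1 : 0 ≤ v - 1 := by linarith
  gcongr
  exact hC i x

lemma cv_L1 (κ : ℝ) (hκ : 1 < κ) : ∃ C : ℝ≥0, 1 ≤ C ∧ ∀ (i : ℤ) (b : ℝ → ℝ≥0∞),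
    Measurable b → ∫⁻ x, cv κ i b x ≤ C * ∫⁻ x, b x := by
  obtain ⟨C, h1, hC⟩ := Kr_int κ hκ
  refine ⟨C, h1, fun i b hb => ?_⟩
  have := cv_symm κ i hb (measurable_const (a := (1:ℝ≥0∞)))
  simp only [mul_one] at this
  rw [this, ← lintegral_const_mul _ hb]
  refine lintegral_mono fun x => ?_
  rw [mul_comm]
  refine mul_le_mul_left ?_ _
  simpa [cv] using hC i x

lemma M2 (κ : ℝ) (hκ : 1 < κ) (v : ℝ) (hv : 1 ≤ v) : ∃ C : ℝ≥0, 1 ≤ C ∧ ∀ (I : Finset ℤ) (b : ℤ → ℝ → ℝ≥0∞),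
    (∀ i, Measurable (b i)) → ∫⁻ x, (∑ i ∈ I, cv κ i (b i) x) ^ v ≤ C * ∫⁻ x, (∑ i ∈ I, b i x) ^ v := by
  obtain ⟨C1, h1, hC1⟩ := cv_L1 κ hκ
  rcases hv.eq_or_lt with rfl | hv
  · refine ⟨C1, h1, fun I b hb => ?_⟩
    simp only [ENNReal.rpow_one]
    rw [lintegral_finsetSum _ fun i _ => cv_meas κ i (hb i), lintegral_finsetSum _ fun i _ => hb i,
      Finset.mul_sum]
    exact Finset.sum_le_sum fun i _ => hC1 i _ (hb i)
  obtain ⟨CJ, hJ1, hCJ⟩ := cv_jensen κ hκ v hv.le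
  obtain ⟨CK, hK1, hCK⟩ := cv_le κ hκ
  have hc : Real.HolderConjugate v (v / (v - 1)) := Real.HolderConjugate.conjExponent hv
  have hv0 : 0 < v := by linarith
  have hv1 : 0 < v - 1 := by linarith
  have hv' : 1 < v / (v - 1) := by rw [lt_div_iff₀ hv1]; linarith
  obtain ⟨CM, hCM⟩ := strong (v / (v - 1)) hv'
  refine ⟨1 + CK ^ v * CM ^ (v - 1), le_self_add, fun I b hb => ?_⟩
  set R := ∫⁻ x, (∑ i ∈ I, b i x) ^ v with hR
  set X := fun x => ∑ i ∈ I, cv κ i (b i) x with hX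
  have hXm : Measurable X := Finset.measurable_fun_sum _ fun i _ => cv_meas κ i (hb i)
  set Y := ∫⁻ x, X x ^ v with hY
  by_cases hRt : R = ∞
  · rw [hRt, ENNReal.mul_top (by positivity)]; exact le_top
  have hbi : ∀ i ∈ I, ∫⁻ x, b i x ^ v < ∞ := by
    intro i hi
    refine lt_of_le_of_lt (lintegral_mono fun x => ?_) (lt_top_iff_ne_top.2 hRt)
    refine ENNReal.rpow_le_rpow ?_ hv0.le
    exact Finset.single_le_sum (f := fun i => b i x) (fun _ _ => zero_le) hi
  have hYt : Y ≠ ∞ := by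
    refine ne_of_lt ?_
    calc Y ≤ ∫⁻ x, (I.card : ℝ≥0∞) ^ (v - 1) * ∑ i ∈ I, CJ * cv κ i (fun y => b i y ^ v) x := by
          refine lintegral_mono fun x => ?_
          refine (ENNReal.rpow_sum_le_const_mul_sum_rpow I _ hv.le).trans ?_
          refine mul_le_mul_right (Finset.sum_le_sum fun i _ => hCJ i _ (hb i) x) _
      _ = (I.card : ℝ≥0∞) ^ (v - 1) * ∑ i ∈ I, CJ * ∫⁻ x, cv κ i (fun y => b i y ^ v) x := by
          have hm : ∀ i, Measurable fun x => cv κ i (fun y => b i y ^ v) x :=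
            fun i => cv_meas κ i ((hb i).pow_const v)
          rw [lintegral_const_mul _ (Finset.measurable_fun_sum _ fun i _ => (hm i).const_mul _),
            lintegral_finsetSum _ fun i _ => (hm i).const_mul _]
          congr 1
          refine Finset.sum_congr rfl fun i _ => ?_
          rw [lintegral_const_mul _ (hm i)]
      _ < ∞ := by
          refine ENNReal.mul_lt_top (ENNReal.rpow_lt_top_of_nonneg hv1.le (by simp)) ?_
          refine ENNReal.sum_lt_top.2 fun i hi => ENNReal.mul_lt_top (by simp) ?_
          refine lt_of_le_of_lt (hC1 i _ ((hb i).pow_const v)) (ENNReal.mul_lt_top (by simp) (hbi i hi))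
  by_cases hY0 : Y = 0
  · rw [hY0]; exact zero_le
  have hXp : ∀ x, X x ^ v = X x * X x ^ (v - 1) := by
    intro x
    conv_rhs => rw [← ENNReal.rpow_one (X x), ← ENNReal.rpow_mul]
    rw [← ENNReal.rpow_add_of_nonneg _ _ (by norm_num) (by linarith)]
    congr 1; ring
  have hXm' : Measurable fun x => X x ^ (v - 1) := hXm.pow_const _
  have hmain : Y ≤ CK * (R ^ (1/v) * ((CM : ℝ≥0∞) * Y) ^ (1/(v/(v-1)))) := by
    calc Y = ∑ i ∈ I, ∫⁻ x, cv κ i (b i) x * X x ^ (v - 1) := by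
          rw [hY, ← lintegral_finsetSum (f := fun i x => cv κ i (b i) x * X x ^ (v - 1)) _ fun i _ => (cv_meas κ i (hb i)).mul hXm']
          refine lintegral_congr fun x => ?_
          rw [hXp x, hX, Finset.sum_mul]
      _ = ∑ i ∈ I, ∫⁻ x, b i x * cv κ i (fun x => X x ^ (v - 1)) x :=
          Finset.sum_congr rfl fun i _ => cv_symm κ i (hb i) hXm'
      _ = ∫⁻ x, ∑ i ∈ I, b i x * cv κ i (fun x => X x ^ (v - 1)) x := by
          rw [lintegral_finsetSum (f := fun i x => b i x * cv κ i (fun x => X x ^ (v - 1)) x) _ fun i _ => (hb i).mul (cv_meas κ i hXm')]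
      _ ≤ ∫⁻ x, CK * ((∑ i ∈ I, b i x) * Mx (fun x => X x ^ (v - 1)) x) := by
          refine lintegral_mono fun x => ?_
          rw [Finset.sum_mul, Finset.mul_sum]
          refine Finset.sum_le_sum fun i _ => ?_
          calc _ ≤ b i x * (CK * Mx (fun x => X x ^ (v - 1)) x) := mul_le_mul_right (hCK i _ hXm' x) _
            _ = _ := by ring
      _ = CK * ∫⁻ x, ((∑ i ∈ I, b i x) * Mx (fun x => X x ^ (v - 1)) x) :=
          lintegral_const_mul' _ _ ENNReal.coe_ne_top
      _ ≤ CK * (R ^ (1/v) * (∫⁻ x, Mx (fun x => X x ^ (v - 1)) x ^ (v/(v-1))) ^ (1/(v/(v-1)))) := by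
          refine mul_le_mul_right ?_ _
          exact ENNReal.lintegral_mul_le_Lp_mul_Lq volume hc
            (Finset.measurable_fun_sum _ fun i _ => hb i).aemeasurable (Mx_meas hXm').aemeasurable
      _ ≤ _ := by
          gcongr
          refine (hCM _ hXm').trans (le_of_eq ?_)
          congr 1
          refine lintegral_congr fun x => ?_
          rw [← ENNReal.rpow_mul]
          congr 1; field_simp
  have h3 : Y ^ v ≤ (CK ^ v * CM ^ (v - 1) * R) * Y ^ (v - 1) := by
    refine (ENNReal.rpow_le_rpow hmain hv0.le).trans (le_of_eq ?_)
    rw [ENNReal.mul_rpow_of_nonneg _ _ hv0.le, ENNReal.mul_rpow_of_nonneg _ _ hv0.le, ← ENNReal.rpow_mul,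
      ← ENNReal.rpow_mul, show 1/v*v = 1 by field_simp, ENNReal.rpow_one,
      show 1/(v/(v-1))*v = v - 1 by field_simp, ENNReal.mul_rpow_of_nonneg _ _ hv1.le]
    ring
  have h4 : Y ^ v = Y * Y ^ (v - 1) := by
    conv_rhs => rw [← ENNReal.rpow_one Y, ← ENNReal.rpow_mul]
    rw [← ENNReal.rpow_add_of_nonneg _ _ (by norm_num) (by linarith)]
    congr 1; ring
  rw [h4, ENNReal.mul_le_mul_iff_left] at h3
  · refine h3.trans ?_
    push_cast
    rw [ENNReal.coe_rpow_of_nonneg _ hv0.le, ENNReal.coe_rpow_of_nonneg _ hv1.le]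
    gcongr
    exact le_add_self
  · rw [Ne, ENNReal.rpow_eq_zero_iff]; simp [hY0, hYt]
  · exact ENNReal.rpow_ne_top_of_nonneg hv1.le hYt


lemma FS (κ : ℝ) (hκ : 1 < κ) (ρ π : ℝ) (hρ : 1 < ρ) (hπ : 1 < π) : ∃ C : ℝ≥0, 1 ≤ C ∧
    ∀ (I : Finset ℤ) (a : ℤ → ℝ → ℝ≥0∞), (∀ i, Measurable (a i)) → (∀ i x, a i x ≠ ∞) →
      ∫⁻ x, (∑ i ∈ I, cv κ i (a i) x ^ ρ) ^ (π / ρ) ≤ C * ∫⁻ x, (∑ i ∈ I, a i x ^ ρ) ^ (π / ρ) := by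
  have hρ0 : 0 < ρ := by linarith
  have hπ0 : 0 < π := by linarith
  have hρ1 : 0 < ρ - 1 := by linarith
  set σ := π / ρ with hσ
  have hσ0 : 0 < σ := by positivity
  by_cases hcase : ρ ≤ π
  · have hv : 1 ≤ σ := by rwa [hσ, one_le_div hρ0]
    obtain ⟨CJ, hJ1, hCJ⟩ := cv_jensen κ hκ ρ hρ.le
    obtain ⟨C2, h21, hC2⟩ := M2 κ hκ σ hv
    refine ⟨CJ ^ σ * C2, one_le_mul (NNReal.one_le_rpow hJ1 hσ0.le) h21, fun I a ha _ => ?_⟩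
    calc _ ≤ ∫⁻ x, (CJ * ∑ i ∈ I, cv κ i (fun y => a i y ^ ρ) x) ^ σ := by
          refine lintegral_mono fun x => ENNReal.rpow_le_rpow ?_ hσ0.le
          rw [Finset.mul_sum]
          exact Finset.sum_le_sum fun i _ => hCJ i _ (ha i) x
      _ = (CJ : ℝ≥0∞) ^ σ * ∫⁻ x, (∑ i ∈ I, cv κ i (fun y => a i y ^ ρ) x) ^ σ := by
          simp_rw [ENNReal.mul_rpow_of_nonneg _ _ hσ0.le]
          rw [lintegral_const_mul' _ _ (ENNReal.rpow_ne_top_of_nonneg hσ0.le (by simp))]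
      _ ≤ (CJ : ℝ≥0∞) ^ σ * (C2 * ∫⁻ x, (∑ i ∈ I, a i x ^ ρ) ^ σ) :=
          mul_le_mul_right (hC2 I (fun i y => a i y ^ ρ) fun i => (ha i).pow_const _) _
      _ = _ := by
          rw [ENNReal.coe_mul, ENNReal.coe_rpow_of_nonneg _ hσ0.le, mul_assoc]
  · push Not at hcase
    have hσ1 : σ < 1 := by rwa [hσ, div_lt_one hρ0]
    set θ := 1 - σ with hθ
    have hθ0 : 0 < θ := by linarith
    set v := (ρ - 1) * σ / θ with hv
    have hv1 : 1 < v := by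
      rw [hv, lt_div_iff₀ hθ0, hθ]
      have : ρ * σ = π := by rw [hσ]; field_simp
      nlinarith
    obtain ⟨C1, h11, hC1⟩ := cv_L1 κ hκ
    obtain ⟨CK, hK1, hCK⟩ := cv_le κ hκ
    obtain ⟨CM, hCM⟩ := strong v hv1
    have hv0 : 0 < v := by linarith
    refine ⟨1 + C1 ^ σ * (CK ^ v * CM) ^ θ, le_self_add, fun I a ha hat => ?_⟩
    set S := fun x => ∑ i ∈ I, a i x ^ ρ with hS
    have hSm : Measurable S := Finset.measurable_fun_sum _ fun i _ => (ha i).pow_const _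
    have hSt : ∀ x, S x ≠ ∞ := by
      intro x
      exact (ENNReal.sum_lt_top.2 fun i _ => ENNReal.rpow_lt_top_of_nonneg hρ0.le (hat i x)).ne
    have hbm : ∀ i, Measurable fun y => a i y ^ ρ * S y ^ (-θ) := fun i =>
      ((ha i).pow_const _).mul (hSm.pow_const _)
    set Z := fun x => ∑ i ∈ I, cv κ i (fun y => a i y ^ ρ * S y ^ (-θ)) x with hZ
    have hZm : Measurable Z := Finset.measurable_fun_sum _ fun i _ => cv_meas κ i (hbm i)
    set w := fun y => S y ^ (θ / (ρ - 1)) with hw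
    have hwm : Measurable w := hSm.pow_const _
    have hpt : ∀ x, ∑ i ∈ I, cv κ i (a i) x ^ ρ ≤ Z x * (CK * Mx w x) ^ (ρ - 1) := by
      intro x
      rw [hZ, Finset.sum_mul]
      refine Finset.sum_le_sum fun i hi => ?_
      have h1 := wHolder hρ (Kr_shift_meas κ i x) ((ha i).mul (hSm.pow_const (-(θ/ρ)))) (hSm.pow_const (θ/ρ))
      refine le_trans (ENNReal.rpow_le_rpow ?_ hρ0.le) (h1.trans ?_)
      · refine lintegral_mono fun y => mul_le_mul_right ?_ _
        by_cases h0 : S y = 0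
        · have : a i y = 0 := by
            have := (Finset.sum_eq_zero_iff.1 h0) i hi
            rw [ENNReal.rpow_eq_zero_iff] at this
            rcases this with h | h
            · exact h.1
            · linarith [h.2]
          rw [this]; exact zero_le
        · show a i y ≤ a i y * S y ^ (-(θ/ρ)) * S y ^ (θ/ρ)
          rw [mul_assoc, ← ENNReal.rpow_add _ _ h0 (hSt y)]
          simp
      · refine mul_le_mul' (le_of_eq ?_) (ENNReal.rpow_le_rpow ?_ hρ1.le)
        · refine lintegral_congr fun y => ?_
          simp only [Pi.mul_apply]
          rw [ENNReal.mul_rpow_of_nonneg _ _ hρ0.le, ← ENNReal.rpow_mul]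
          congr 3; field_simp
        · refine le_trans (le_of_eq ?_) (hCK i w hwm x)
          refine lintegral_congr fun y => ?_
          rw [← ENNReal.rpow_mul, hw]
          congr 2; field_simp
    set R := ∫⁻ x, S x ^ σ with hR
    have hZint : ∫⁻ x, Z x ≤ C1 * R := by
      rw [hZ, lintegral_finsetSum _ fun i _ => cv_meas κ i (hbm i)]
      refine (Finset.sum_le_sum fun i _ => hC1 i _ (hbm i)).trans ?_
      rw [← Finset.mul_sum, ← lintegral_finsetSum _ fun i _ => hbm i]
      refine mul_le_mul_right (lintegral_mono fun x => ?_) _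
      rw [← Finset.sum_mul]
      show S x * S x ^ (-θ) ≤ S x ^ σ
      by_cases h0 : S x = 0
      · rw [h0, zero_mul]; exact zero_le
      · conv_lhs => rw [← ENNReal.rpow_one (S x), ← ENNReal.rpow_mul]
        rw [← ENNReal.rpow_add _ _ h0 (hSt x)]
        refine le_of_eq (congrArg _ ?_)
        rw [hθ]; ring
    have hc : Real.HolderConjugate (1/σ) (1/θ) := by
      rw [Real.holderConjugate_iff]
      refine ⟨by rw [lt_div_iff₀ hσ0]; linarith, ?_⟩
      rw [one_div, one_div, inv_inv, inv_inv, hθ]; ring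
    calc _ ≤ ∫⁻ x, Z x ^ σ * (CK * Mx w x) ^ ((ρ - 1) * σ) := by
          refine lintegral_mono fun x => ?_
          refine (ENNReal.rpow_le_rpow (hpt x) hσ0.le).trans (le_of_eq ?_)
          rw [ENNReal.mul_rpow_of_nonneg _ _ hσ0.le, ← ENNReal.rpow_mul]
      _ ≤ (∫⁻ x, (Z x ^ σ) ^ (1/σ)) ^ (1/(1/σ)) *
            (∫⁻ x, ((CK * Mx w x) ^ ((ρ - 1) * σ)) ^ (1/θ)) ^ (1/(1/θ)) :=
          ENNReal.lintegral_mul_le_Lp_mul_Lq volume hc (hZm.pow_const _).aemeasurable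
            (((Mx_meas hwm).const_mul _).pow_const _).aemeasurable
      _ = (∫⁻ x, Z x) ^ σ * (∫⁻ x, (CK:ℝ≥0∞) ^ v * Mx w x ^ v) ^ θ := by
          simp_rw [← ENNReal.rpow_mul]
          rw [show σ * (1/σ) = 1 by field_simp, show 1/(1/σ) = σ by field_simp, show 1/(1/θ) = θ by field_simp,
            show (ρ - 1) * σ * (1/θ) = v by rw [hv]; ring]
          simp_rw [ENNReal.rpow_one, ENNReal.mul_rpow_of_nonneg _ _ hv0.le]
      _ ≤ (C1 * R) ^ σ * ((CK:ℝ≥0∞) ^ v * (CM * R)) ^ θ := by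
          rw [lintegral_const_mul _ ((Mx_meas hwm).pow_const _)]
          gcongr
          refine (hCM w hwm).trans (le_of_eq ?_)
          rw [hR]
          congr 1
          refine lintegral_congr fun x => ?_
          rw [hw, ← ENNReal.rpow_mul]
          congr 1
          rw [hv]; field_simp
      _ = ((C1 ^ σ * (CK ^ v * CM) ^ θ : ℝ≥0) : ℝ≥0∞) * R := by
          rw [ENNReal.mul_rpow_of_nonneg _ _ hσ0.le, ← mul_assoc _ (CM:ℝ≥0∞) R, ENNReal.mul_rpow_of_nonneg _ _ hθ0.le]
          rw [ENNReal.coe_mul, ENNReal.coe_rpow_of_nonneg _ hσ0.le, ENNReal.coe_rpow_of_nonneg _ hθ0.le,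
            ENNReal.coe_mul, ENNReal.coe_rpow_of_nonneg _ hv0.le]
          have : R ^ σ * R ^ θ = R := by
            rw [← ENNReal.rpow_add_of_nonneg _ _ hσ0.le hθ0.le, hθ, add_sub_cancel, ENNReal.rpow_one]
          conv_rhs => rw [← this]
          ring
      _ ≤ _ := by
          gcongr
          exact le_add_self

end BVP

namespace BVP

/-! ### Fourier multipliers -/

/-- Fourier multiplier `m(ξ/l)` applied to `f` -/
def Tm (m : SchwartzMap ℝ ℂ) (l : ℝ) (f : SchwartzMap ℝ ℂ) (a : ℝ) : ℂ :=
  𝓕⁻ (fun ξ : ℝ => 𝓕 (⇑f) ξ * m (ξ / l)) a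

lemma Tm_eq (m f : SchwartzMap ℝ ℂ) (l : ℝ) (hl : 0 < l) (a : ℝ) :
    Tm m l f a = ∫ y, f y * ((l : ℂ) * 𝓕⁻ (⇑m) (l * (a - y))) := by
  have hm : Integrable fun ξ : ℝ => m (ξ / l) := m.integrable.comp_div hl.ne'
  set G : ℝ → ℂ := fun ξ => Real.fourierChar (ξ * a) • m (ξ / l) with hG
  have hGi : Integrable G := by
    rw [← integrable_norm_iff]
    · simpa [hG] using hm.norm
    · refine AEStronglyMeasurable.smul ?_ hm.1
      have hc : Continuous fun ξ : ℝ => Real.fourierChar (ξ * a) :=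
        Continuous.comp (g := fun z : ℝ => Real.fourierChar z) (f := fun z : ℝ => z * a)
          Real.continuous_fourierChar (by fun_prop)
      exact (Continuous.comp (g := fun z : Circle => (z : ℂ)) continuous_induced_dom hc).aestronglyMeasurable
  have h1 : Tm m l f a = ∫ ξ, 𝓕 (⇑f) ξ * G ξ := by
    unfold Tm
    rw [Real.fourierInv_eq]
    refine integral_congr_ae (Filter.Eventually.of_forall fun ξ => ?_)
    simp only [hG, Circle.smul_def, smul_eq_mul, RCLike.inner_apply, conj_trivial]
    rw [mul_comm ξ a]; ring
  have h2 : ∫ ξ, 𝓕 (⇑f) ξ * G ξ = ∫ y, f y * 𝓕 G y := by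
    simpa using! VectorFourier.integral_bilin_fourierIntegral_eq_flip (.mul ℂ ℂ) (L := innerₗ ℝ)
      Real.continuous_fourierChar continuous_inner f.integrable hGi
  rw [h1, h2]
  refine integral_congr_ae (Filter.Eventually.of_forall fun y => ?_)
  simp only
  congr 1
  rw [Real.fourier_eq, Real.fourierInv_eq]
  have h3 : ∀ ξ : ℝ, Real.fourierChar (-inner ℝ ξ y) • G ξ =
      (fun ζ : ℝ => Real.fourierChar (inner ℝ ζ (l * (a - y))) • m ζ) (ξ / l) := by
    intro ξ
    simp only [hG, Circle.smul_def, smul_eq_mul, RCLike.inner_apply, conj_trivial]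
    rw [← mul_assoc, ← Circle.coe_mul, ← AddChar.map_add_eq_mul]
    congr 3
    field_simp
    ring
  refine (integral_congr_ae (Filter.Eventually.of_forall h3)).trans
    ((Measure.integral_comp_div (fun ζ : ℝ => Real.fourierChar (inner ℝ ζ (l * (a - y))) • m ζ) l).trans ?_)
  rw [abs_of_pos hl]
  simp

lemma schwartz_decay (g : SchwartzMap ℝ ℂ) : ∃ C : ℝ≥0, ∀ z : ℝ, ‖g z‖ ≤ C * (1 + |z|) ^ (-2:ℝ) := by
  obtain ⟨C0, h0⟩ := g.decay 0 0
  obtain ⟨C2, h2⟩ := g.decay 2 0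
  refine ⟨Real.toNNReal (2 * C0 + 2 * C2), fun z => ?_⟩
  have a0 := h0.2 z
  have a2 := h2.2 z
  simp only [pow_zero, one_mul, norm_iteratedFDeriv_zero, Real.norm_eq_abs] at a0 a2
  rw [Real.coe_toNNReal _ (by linarith [h0.1, h2.1]), Real.rpow_neg (by positivity), ← div_eq_mul_inv,
    le_div_iff₀ (by positivity), Real.rpow_two]
  nlinarith [sq_nonneg (1 - |z|), norm_nonneg (g z), abs_nonneg z]

lemma cv_shift (κ : ℝ) (hκ : 0 < κ) (i : ℤ) (w : ℝ → ℝ≥0∞) (a x : ℝ) :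
    cv κ i w a ≤ ENNReal.ofReal ((1 + (2:ℝ) ^ i * |x - a|) ^ κ) * cv κ i w x := by
  unfold cv
  rw [← lintegral_const_mul' _ _ ENNReal.ofReal_ne_top]
  refine lintegral_mono fun y => ?_
  rw [← mul_assoc]
  refine mul_le_mul_left ?_ _
  unfold Kr
  rw [← ENNReal.ofReal_mul (by positivity)]
  refine ENNReal.ofReal_le_ofReal ?_
  rw [mul_left_comm]
  refine mul_le_mul_of_nonneg_left ?_ (by positivity)
  have h2 : (0:ℝ) < 2 ^ i := by positivity
  rw [Real.rpow_neg (by positivity), Real.rpow_neg (by positivity), ← div_eq_mul_inv,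
    ← Real.div_rpow (by positivity) (by positivity), ← Real.inv_rpow (by positivity)]
  refine Real.rpow_le_rpow (by positivity) ?_ hκ.le
  rw [inv_eq_one_div, div_le_div_iff₀ (by positivity) (by positivity), one_mul]
  have h3 : |x - y| ≤ |x - a| + |a - y| := abs_sub_le x a y
  have h4 : 0 ≤ ((2:ℝ) ^ i * |x - a|) * ((2:ℝ) ^ i * |a - y|) := by positivity
  nlinarith

lemma Tm_bound (m : SchwartzMap ℝ ℂ) (κ u : ℝ) (hκ : 1 < κ) (hκ2 : κ ≤ 2) (hu : 1 ≤ u) :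
    ∃ C : ℝ≥0, ∀ (f : SchwartzMap ℝ ℂ) (i : ℤ) (a x : ℝ), ‖Tm m ((2:ℝ) ^ i) f a‖ₑ ≤
      C * ENNReal.ofReal ((1 + (2:ℝ) ^ i * |x - a|) ^ (κ / u)) * (cv κ i (fun y => ‖f y‖ₑ ^ u) x) ^ (1 / u) := by
  obtain ⟨Cm, hCm⟩ := schwartz_decay (𝓕⁻ m)
  obtain ⟨CJ, hJ1, hCJ⟩ := cv_jensen κ hκ u hu
  have hu0 : 0 < u := by linarith
  refine ⟨Cm * CJ ^ (1/u), fun f i a x => ?_⟩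
  have hfm : Measurable fun y => ‖f y‖ₑ := f.continuous.enorm.measurable
  have h2 : (0:ℝ) < 2 ^ i := by positivity
  have h1 : ‖Tm m ((2:ℝ) ^ i) f a‖ₑ ≤ Cm * cv κ i (fun y => ‖f y‖ₑ) a := by
    rw [Tm_eq m f _ h2 a]
    refine (enorm_integral_le_lintegral_enorm _).trans ?_
    unfold cv
    rw [← lintegral_const_mul' _ _ ENNReal.coe_ne_top]
    refine lintegral_mono fun y => ?_
    rw [enorm_mul, mul_comm ‖f y‖ₑ, ← mul_assoc]
    refine mul_le_mul_left ?_ _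
    rw [← ofReal_norm, Kr, ← ENNReal.ofReal_coe_nnreal, ← ENNReal.ofReal_mul (by positivity)]
    refine ENNReal.ofReal_le_ofReal ?_
    rw [norm_mul, mul_left_comm]
    have e : ‖(((2:ℝ) ^ i : ℝ) : ℂ)‖ = (2:ℝ) ^ i := by
      rw [Complex.norm_real, Real.norm_of_nonneg h2.le]
    rw [e]
    refine mul_le_mul_of_nonneg_left ?_ h2.le
    have := hCm ((2:ℝ) ^ i * (a - y))
    rw [SchwartzMap.fourierInv_coe] at this
    refine this.trans ?_
    rw [abs_mul, abs_of_pos h2]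
    gcongr
    exact le_add_of_nonneg_right (by positivity)
  refine h1.trans ?_
  have h3 : cv κ i (fun y => ‖f y‖ₑ) a ≤ ((CJ : ℝ≥0∞) * (ENNReal.ofReal ((1 + (2:ℝ) ^ i * |x - a|) ^ κ) *
      cv κ i (fun y => ‖f y‖ₑ ^ u) x)) ^ (1/u) := by
    rw [one_div, ENNReal.le_rpow_inv_iff hu0]
    refine (hCJ i _ hfm a).trans (mul_le_mul_right ?_ _)
    exact cv_shift κ (by linarith) i _ a x
  refine (mul_le_mul_right h3 _).trans (le_of_eq ?_)
  rw [ENNReal.mul_rpow_of_nonneg _ _ (by positivity), ENNReal.mul_rpow_of_nonneg _ _ (by positivity),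
    ENNReal.ofReal_rpow_of_nonneg (by positivity) (by positivity), ← Real.rpow_mul (by positivity),
    mul_one_div, ENNReal.coe_mul, ENNReal.coe_rpow_of_nonneg _ (by positivity)]
  ring

lemma Tm_integrable (m f : SchwartzMap ℝ ℂ) (l : ℝ) :
    Integrable fun ξ : ℝ => 𝓕 (⇑f) ξ * m (ξ / l) := by
  have h : Integrable (fun ξ : ℝ => 𝓕 (⇑f) ξ) := by
    have := (𝓕 f).integrable (μ := volume)
    rwa [SchwartzMap.fourier_coe] at this
  obtain ⟨C, hC⟩ := m.decay 0 0
  refine h.mul_bdd (c := C) ?_ ?_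
  · exact (m.continuous.comp (by fun_prop)).aestronglyMeasurable
  · refine Filter.Eventually.of_forall fun ξ => ?_
    simpa using hC.2 (ξ / l)

lemma Tm_deriv (m m' f : SchwartzMap ℝ ℂ) (hmm : ∀ ζ : ℝ, m' ζ = 2 * Real.pi * Complex.I * ζ * m ζ)
    (l : ℝ) (hl : 0 < l) (a : ℝ) : HasDerivAt (Tm m l f) (l * Tm m' l f a) a := by
  set h : ℝ → ℂ := fun ξ => 𝓕 (⇑f) ξ * m (ξ / l) with hh
  have hpi : (2 * (Real.pi:ℂ) * Complex.I) ≠ 0 := by simp [Real.pi_ne_zero]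
  have hl' : (l:ℂ) ≠ 0 := by exact_mod_cast hl.ne'
  have e : ∀ ξ : ℝ, 2 * Real.pi * Complex.I * ξ * h ξ = l * (𝓕 (⇑f) ξ * m' (ξ / l)) := by
    intro ξ
    rw [hmm, hh]
    push_cast
    field_simp
  have hi : Integrable h := Tm_integrable m f l
  have hi' : Integrable fun x : ℝ => x • h x := by
    have := ((Tm_integrable m' f l).const_mul (l:ℂ)).const_mul (2 * (Real.pi:ℂ) * Complex.I)⁻¹
    refine this.congr (Filter.Eventually.of_forall fun ξ => ?_)
    simp only
    rw [← e ξ, Complex.real_smul]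
    field_simp
  have h1 := Real.hasDerivAt_fourier hi hi' (-a)
  have h2 : HasDerivAt (fun x => 𝓕 h (-x)) _ a := h1.scomp a (hasDerivAt_neg a)
  have h3 : Tm m l f = fun x => 𝓕 h (-x) := by
    funext x
    unfold Tm
    rw [Real.fourierInv_eq_fourier_neg]
  rw [h3]
  convert h2 using 1
  unfold Tm
  rw [Real.fourierInv_eq_fourier_neg, Real.fourier_eq, Real.fourier_eq, neg_smul, one_smul, ← integral_neg, ← integral_const_mul]
  refine integral_congr_ae (Filter.Eventually.of_forall fun ξ => ?_)
  simp only [Circle.smul_def, smul_eq_mul]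
  have := e ξ
  linear_combination (-1) * ((Real.fourierChar (-inner ℝ ξ (-a)) : Circle) : ℂ) * this

end BVP

namespace BVP

/-! ### Cutoff multipliers and pointwise estimates for band-limited functions -/

lemma exists_mult (Nb : ℝ) : ∃ χ χ1 ω : SchwartzMap ℝ ℂ,
    (∀ ξ : ℝ, (2:ℝ) ^ (-Nb) ≤ |ξ| → |ξ| ≤ (2:ℝ) ^ Nb → χ ξ = 1) ∧
    (∀ ζ : ℝ, χ ζ = 2 * Real.pi * Complex.I * ζ * ω ζ) ∧
    (∀ ζ : ℝ, χ1 ζ = 2 * Real.pi * Complex.I * ζ * χ ζ) := by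
  have hP : (0:ℝ) < 2 ^ Nb := by positivity
  have hM : (0:ℝ) < 2 ^ (-Nb) := by positivity
  let B1 : ContDiffBump (0:ℝ) := ⟨2 ^ Nb, 2 ^ Nb + 1, hP, by linarith⟩
  let B2 : ContDiffBump (0:ℝ) := ⟨2 ^ (-Nb) / 4, 2 ^ (-Nb) / 2, by linarith, by linarith⟩
  let η : ℝ → ℝ := fun ξ => B1 ξ * (1 - B2 ξ)
  have hη : ContDiff ℝ (⊤:ℕ∞) η := B1.contDiff.mul (contDiff_const.sub B2.contDiff)
  have hηc : HasCompactSupport η := B1.hasCompactSupport.mul_right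
  have hη0 : ∀ ξ, |ξ| < 2 ^ (-Nb) / 4 → η ξ = 0 := by
    intro ξ h
    have : B2 ξ = 1 := B2.one_of_mem_closedBall (by simpa [B2] using h.le)
    simp [η, this]
  have hη1 : ∀ ξ : ℝ, (2:ℝ) ^ (-Nb) ≤ |ξ| → |ξ| ≤ (2:ℝ) ^ Nb → η ξ = 1 := by
    intro ξ h1 h2
    have e1 : B1 ξ = 1 := B1.one_of_mem_closedBall (by simpa [B1] using h2)
    have e2 : B2 ξ = 0 := B2.zero_of_le_dist (by simp [B2]; linarith)
    simp [η, e1, e2]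
  have hηC : ContDiff ℝ (⊤:ℕ∞) (fun ξ => (η ξ : ℂ)) := Complex.ofRealCLM.contDiff.comp hη
  have hηCc : HasCompactSupport (fun ξ => (η ξ : ℂ)) := hηc.comp_left (g := fun z : ℝ => (z:ℂ)) (by simp)
  have hid : ContDiff ℝ (⊤:ℕ∞) (fun ξ : ℝ => 2 * (Real.pi : ℂ) * Complex.I * (ξ : ℂ)) :=
    contDiff_const.mul Complex.ofRealCLM.contDiff
  have hpi : (2 * (Real.pi:ℂ) * Complex.I) ≠ 0 := by simp [Real.pi_ne_zero]
  let w : ℝ → ℂ := fun ξ => (2 * (Real.pi : ℂ) * Complex.I * (ξ : ℂ))⁻¹ * (η ξ : ℂ)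
  have hw : ContDiff ℝ (⊤:ℕ∞) w := by
    rw [contDiff_iff_contDiffAt]
    intro ξ
    by_cases hξ : ξ = 0
    · have : w =ᶠ[nhds ξ] fun _ => 0 := by
        filter_upwards [Metric.ball_mem_nhds ξ (show (0:ℝ) < 2 ^ (-Nb) / 4 by linarith)] with z hz
        subst hξ
        simp [w, hη0 z (by simpa using hz)]
      exact contDiffAt_const.congr_of_eventuallyEq this
    · refine ContDiffAt.mul (ContDiffAt.inv hid.contDiffAt ?_) hηC.contDiffAt
      exact mul_ne_zero hpi (by exact_mod_cast hξ)
  have hwc : HasCompactSupport w := hηCc.mul_left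
  have hv : ContDiff ℝ (⊤:ℕ∞) (fun ξ : ℝ => 2 * (Real.pi : ℂ) * Complex.I * (ξ : ℂ) * (η ξ : ℂ)) := hid.mul hηC
  have hvc : HasCompactSupport (fun ξ : ℝ => 2 * (Real.pi : ℂ) * Complex.I * (ξ : ℂ) * (η ξ : ℂ)) := hηCc.mul_left
  refine ⟨hηCc.toSchwartzMap hηC, hvc.toSchwartzMap hv, hwc.toSchwartzMap hw, ?_, ?_, ?_⟩
  · intro ξ h1 h2
    simp [hη1 ξ h1 h2]
  · intro ζ
    simp only [HasCompactSupport.toSchwartzMap_toFun, w]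
    by_cases hζ : ζ = 0
    · subst hζ
      simp [hη0 0 (by simp; exact hM)]
    · have : (ζ:ℂ) ≠ 0 := by exact_mod_cast hζ
      field_simp
  · intro ζ
    simp

/-- frequency support of `f` in the band of index `i` -/
def Band (Nb : ℝ) (i : ℤ) (f : SchwartzMap ℝ ℂ) : Prop :=
  ∀ ξ : ℝ, 𝓕 (⇑f) ξ ≠ 0 → (2 : ℝ) ^ ((i : ℝ) - Nb) < |ξ| ∧ |ξ| < (2 : ℝ) ^ ((i : ℝ) + Nb)

lemma Tm_id (Nb : ℝ) (χ : SchwartzMap ℝ ℂ)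
    (hχ : ∀ ξ : ℝ, (2:ℝ) ^ (-Nb) ≤ |ξ| → |ξ| ≤ (2:ℝ) ^ Nb → χ ξ = 1) (i : ℤ) (f : SchwartzMap ℝ ℂ)
    (hf : Band Nb i f) : Tm χ ((2:ℝ) ^ i) f = f := by
  have e : (fun ξ : ℝ => 𝓕 (⇑f) ξ * χ (ξ / (2:ℝ) ^ i)) = 𝓕 (⇑f) := by
    funext ξ
    by_cases h : 𝓕 (⇑f) ξ = 0
    · simp [h]
    · obtain ⟨h1, h2⟩ := hf ξ h
      have h2i : (0:ℝ) < 2 ^ i := by positivity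
      rw [hχ, mul_one]
      · rw [abs_div, abs_of_pos h2i, le_div_iff₀ h2i, ← Real.rpow_intCast, ← Real.rpow_add (by norm_num)]
        refine le_of_eq_of_le ?_ h1.le
        congr 1; ring
      · rw [abs_div, abs_of_pos h2i, div_le_iff₀ h2i, ← Real.rpow_intCast, ← Real.rpow_add (by norm_num)]
        refine h2.le.trans (le_of_eq ?_)
        congr 1; ring
  funext a
  unfold Tm
  rw [e]
  rw [← SchwartzMap.fourier_coe, ← SchwartzMap.fourierInv_coe, FourierTransform.fourierInv_fourier_eq]

end BVP

namespace BVP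

/-! ### Dyadic averages -/

/-- average over the dyadic interval `[c 2^{-n}, (c+1) 2^{-n})` -/
def Ea (n : ℤ) (F : ℝ → ℂ) (c : ℤ) : ℂ :=
  ((2:ℝ) ^ n : ℝ) * ∫ y in ((c:ℝ) * 2 ^ (-n))..(((c:ℝ) + 1) * 2 ^ (-n)), F y

/-- dyadic conditional expectation -/
def En (n : ℤ) (F : ℝ → ℂ) (x : ℝ) : ℂ := Ea n F ⌊(2:ℝ) ^ n * x⌋

lemma En_meas (n : ℤ) (F : ℝ → ℂ) : Measurable (En n F) := by
  unfold En
  exact (measurable_from_top (f := Ea n F)).comp (Int.measurable_floor.comp (measurable_const_mul _))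

lemma Ea_split (n : ℤ) (F : ℝ → ℂ) (hF : Continuous F) (c : ℤ) :
    Ea (n + 1) F (2 * c) + Ea (n + 1) F (2 * c + 1) = 2 * Ea n F c := by
  unfold Ea
  have h2 : (2:ℝ) ^ (-(n+1)) = 2 ^ (-n) / 2 := by
    rw [neg_add, zpow_add₀ (by norm_num)]; norm_num; ring
  have e1 : (((2 * c : ℤ) : ℝ)) * 2 ^ (-(n+1)) = (c:ℝ) * 2 ^ (-n) := by
    rw [h2]; push_cast; ring
  have e2 : (((2 * c : ℤ) : ℝ) + 1) * 2 ^ (-(n+1)) = ((2 * c + 1 : ℤ) : ℝ) * 2 ^ (-(n+1)) := by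
    push_cast; ring
  have e3 : (((2 * c + 1 : ℤ) : ℝ) + 1) * 2 ^ (-(n+1)) = ((c:ℝ) + 1) * 2 ^ (-n) := by
    rw [h2]; push_cast; ring
  rw [e1, e2, e3, ← mul_add, intervalIntegral.integral_add_adjacent_intervals
    (hF.intervalIntegrable _ _) (hF.intervalIntegrable _ _), zpow_add_one₀ (by norm_num)]
  push_cast
  ring

lemma floor_double (n : ℤ) (x : ℝ) : ⌊(2:ℝ) ^ (n+1) * x⌋ = 2 * ⌊(2:ℝ) ^ n * x⌋ ∨
    ⌊(2:ℝ) ^ (n+1) * x⌋ = 2 * ⌊(2:ℝ) ^ n * x⌋ + 1 := by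
  have e : (2:ℝ) ^ (n+1) * x = 2 * (2 ^ n * x) := by rw [zpow_add_one₀ (by norm_num)]; ring
  rw [e]
  set y := (2:ℝ) ^ n * x
  have h1 := Int.floor_le y
  have h2 := Int.lt_floor_add_one y
  have h3 : 2 * ⌊y⌋ ≤ ⌊2 * y⌋ := by
    rw [Int.le_floor]; push_cast; linarith
  have h4 : ⌊2 * y⌋ < 2 * ⌊y⌋ + 2 := by
    rw [Int.floor_lt]; push_cast; linarith
  omega

lemma floor_coarse (m : ℤ) (k : ℕ) (x y : ℝ) (h : ⌊(2:ℝ) ^ m * x⌋ = ⌊(2:ℝ) ^ m * y⌋) :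
    ⌊(2:ℝ) ^ (m - k) * x⌋ = ⌊(2:ℝ) ^ (m - k) * y⌋ := by
  induction k with
  | zero => simpa using h
  | succ k ih =>
    have e : m - (k:ℤ) = (m - ((k + 1 : ℕ):ℤ)) + 1 := by push_cast; ring
    rw [e] at ih
    have h1 := floor_double (m - ((k + 1 : ℕ):ℤ)) x
    have h2 := floor_double (m - ((k + 1 : ℕ):ℤ)) y
    omega

/-- swap the two halves of each dyadic interval of generation `n` -/
def sw (n : ℤ) (x : ℝ) : ℝ :=
  if Even ⌊(2:ℝ) ^ (n+1) * x⌋ then x + 2 ^ (-(n+1)) else x - 2 ^ (-(n+1))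

lemma floor_sw (n : ℤ) (x : ℝ) : ⌊(2:ℝ) ^ (n+1) * sw n x⌋ =
    if Even ⌊(2:ℝ) ^ (n+1) * x⌋ then ⌊(2:ℝ) ^ (n+1) * x⌋ + 1 else ⌊(2:ℝ) ^ (n+1) * x⌋ - 1 := by
  have e : (2:ℝ) ^ (n+1) * 2 ^ (-(n+1)) = 1 := by
    rw [← zpow_add₀ (by norm_num)]; simp
  unfold sw
  split_ifs
  · rw [mul_add, e, Int.floor_add_one]
  · rw [mul_sub, e, Int.floor_sub_one]

lemma floor_sw_coarse (n : ℤ) (x : ℝ) : ⌊(2:ℝ) ^ n * sw n x⌋ = ⌊(2:ℝ) ^ n * x⌋ := by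
  have h := floor_sw n x
  have h1 := floor_double n x
  have h2 := floor_double n (sw n x)
  by_cases he : Even ⌊(2:ℝ) ^ (n+1) * x⌋
  · rw [if_pos he] at h
    obtain ⟨z, hz⟩ := he
    omega
  · rw [if_neg he] at h
    rw [Int.not_even_iff_odd] at he
    obtain ⟨z, hz⟩ := he
    omega

lemma sw_meas (n : ℤ) : Measurable (sw n) := by
  unfold sw
  refine Measurable.ite ?_ (by fun_prop) (by fun_prop)
  have : Measurable fun x : ℝ => ⌊(2:ℝ) ^ (n+1) * x⌋ := Int.measurable_floor.comp (measurable_const_mul _)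
  exact this (MeasurableSet.of_discrete (s := {z : ℤ | Even z}))

lemma sw_mp (n : ℤ) : MeasurePreserving (sw n) (volume : Measure ℝ) volume := by
  refine ⟨sw_meas n, ?_⟩
  ext S hS
  rw [Measure.map_apply (sw_meas n) hS]
  set A : Set ℝ := {x | Even ⌊(2:ℝ) ^ (n+1) * x⌋} with hA
  have hAm : MeasurableSet A := by
    have : Measurable fun x : ℝ => ⌊(2:ℝ) ^ (n+1) * x⌋ := Int.measurable_floor.comp (measurable_const_mul _)
    exact this (MeasurableSet.of_discrete (s := {z : ℤ | Even z}))
  have e : (2:ℝ) ^ (n+1) * 2 ^ (-(n+1)) = 1 := by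
    rw [← zpow_add₀ (by norm_num)]; simp
  have k1 : ∀ x : ℝ, x + 2 ^ (-(n+1)) ∈ A ↔ x ∉ A := by
    intro x
    simp only [hA, Set.mem_setOf_eq]
    rw [mul_add, e, Int.floor_add_one, Int.even_add_one]
  have k2 : ∀ x : ℝ, x + -2 ^ (-(n+1)) ∈ A ↔ x ∉ A := by
    intro x
    simp only [hA, Set.mem_setOf_eq]
    rw [mul_add, mul_neg, e, ← sub_eq_add_neg, Int.floor_sub_one, Int.even_sub_one]
  rw [← measure_inter_add_diff (sw n ⁻¹' S) hAm, ← measure_inter_add_diff S hAm]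
  have f1 : sw n ⁻¹' S ∩ A = (fun x => x + 2 ^ (-(n+1))) ⁻¹' (S \ A) := by
    ext x
    simp only [Set.mem_inter_iff, Set.mem_preimage, Set.mem_diff, k1]
    by_cases hx : x ∈ A
    · have : sw n x = x + 2 ^ (-(n+1)) := if_pos hx
      simp [this, hx]
    · simp [hx]
  have f2 : sw n ⁻¹' S \ A = (fun x => x + -2 ^ (-(n+1))) ⁻¹' (S ∩ A) := by
    ext x
    simp only [Set.mem_inter_iff, Set.mem_preimage, Set.mem_diff, k2]
    by_cases hx : x ∈ A
    · simp [hx]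
    · have : sw n x = x + - 2 ^ (-(n+1)) := (if_neg hx).trans (sub_eq_add_neg _ _)
      simp [this, hx]
  rw [f1, f2, measure_preimage_add_right, measure_preimage_add_right, add_comm]

lemma En_sw_coarse (n : ℤ) (k : ℕ) (F : ℝ → ℂ) (x : ℝ) : En (n - k) F (sw n x) = En (n - k) F x := by
  unfold En
  rw [floor_coarse n k _ _ (floor_sw_coarse n x)]

lemma En_sw (n : ℤ) (F : ℝ → ℂ) (hF : Continuous F) (x : ℝ) :
    En (n+1) F (sw n x) + En (n+1) F x = 2 * En n F x := by
  rw [En, En, En, ← Ea_split n F hF, floor_sw]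
  rcases floor_double n x with h | h
  · rw [h, if_pos (by simp), add_comm]
  · rw [h, if_neg (by simp [Int.even_add_one])]
    simp

lemma En_add (n : ℤ) (F G : ℝ → ℂ) (hF : Continuous F) (hG : Continuous G) (x : ℝ) :
    En n (fun y => F y + G y) x = En n F x + En n G x := by
  unfold En Ea
  rw [intervalIntegral.integral_add (hF.intervalIntegrable _ _) (hG.intervalIntegrable _ _), mul_add]

lemma En_sum (n : ℤ) {ι : Type} (I : Finset ι) (F : ι → ℝ → ℂ) (hF : ∀ i, Continuous (F i)) (x : ℝ) :
    En n (fun y => ∑ i ∈ I, F i y) x = ∑ i ∈ I, En n (F i) x := by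
  unfold En Ea
  rw [intervalIntegral.integral_finset_sum fun i _ => (hF i).intervalIntegrable _ _, Finset.mul_sum]

end BVP

namespace BVP

lemma floor_mem (n : ℤ) (x : ℝ) : ((⌊(2:ℝ) ^ n * x⌋ : ℤ) : ℝ) * 2 ^ (-n) ≤ x ∧
    x < ((⌊(2:ℝ) ^ n * x⌋ : ℤ) + 1 : ℝ) * 2 ^ (-n) := by
  have h : (0:ℝ) < 2 ^ n := by positivity
  rw [zpow_neg, ← div_eq_mul_inv, ← div_eq_mul_inv, div_le_iff₀ h, lt_div_iff₀ h, mul_comm x]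
  exact ⟨Int.floor_le _, Int.lt_floor_add_one _⟩

lemma lp_real (f : ℝ → ℂ) (hf : Continuous f) (f' g : ℝ → ℂ) (hf' : ∀ a, HasDerivAt f (f' a) a)
    (hg : ∀ a, HasDerivAt g (f a) a) (i : ℤ) (x : ℝ) (α M : ℝ) (hα : 0 ≤ α) (hα1 : α ≤ 1) (hM : 0 ≤ M)
    (hf'b : ∀ a, ‖f' a‖ ≤ 2 ^ i * (M * (1 + (2:ℝ) ^ i * |x - a|) ^ α))
    (hgb : ∀ a, ‖g a‖ ≤ 2 ^ (-i) * (M * (1 + (2:ℝ) ^ i * |x - a|) ^ α)) (n : ℤ) :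
    (i ≤ n → ‖f x - En n f x‖ ≤ 2 * M * ((2:ℝ) ^ (-(1 - α))) ^ (n - i).natAbs) ∧
    (n ≤ i → ‖En n f x‖ ≤ 4 * M * ((2:ℝ) ^ (-(1 - α))) ^ (n - i).natAbs) := by
  obtain ⟨k1, k2⟩ := floor_mem n x
  set c := ⌊(2:ℝ) ^ n * x⌋ with hc
  set l := (c:ℝ) * 2 ^ (-n) with hl
  set h := ((c:ℝ) + 1) * 2 ^ (-n) with hh
  have hn : (0:ℝ) < 2 ^ n := by positivity
  have hnn : (0:ℝ) < 2 ^ (-n) := by positivity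
  have hnm : (2:ℝ) ^ n * 2 ^ (-n) = 1 := by rw [← zpow_add₀ (by norm_num)]; simp
  have hlh : h - l = 2 ^ (-n) := by rw [hl, hh]; ring
  have hdist : ∀ a, l ≤ a → a ≤ h → |x - a| ≤ 2 ^ (-n) := by
    intro a h1 h2
    rw [abs_le]; constructor <;> linarith
  have hEn : En n f x = ((2:ℝ) ^ n : ℝ) * ∫ y in l..h, f y := rfl
  have hpow : ∀ {y : ℝ}, 1 ≤ y → y ^ α ≤ y := by
    intro y hy
    calc y ^ α ≤ y ^ (1:ℝ) := Real.rpow_le_rpow_of_exponent_le hy hα1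
      _ = y := Real.rpow_one y
  constructor
  · intro hin
    obtain ⟨k, hk⟩ := Int.le.dest hin
    have hnat : (n - i).natAbs = k := by omega
    rw [hnat]
    have hi2 : (2:ℝ) ^ i * 2 ^ (-n) = (2⁻¹:ℝ) ^ k := by
      rw [← zpow_add₀ (by norm_num)]
      rw [show i + -n = -(k:ℤ) by omega, zpow_neg, zpow_natCast, inv_pow]
    have hb : ∀ a, l ≤ a → a ≤ h → ‖f' a‖ ≤ 2 ^ i * (2 * M) := by
      intro a h1 h2
      refine (hf'b a).trans (mul_le_mul_of_nonneg_left ?_ (by positivity))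
      rw [mul_comm 2 M]
      refine mul_le_mul_of_nonneg_left ?_ hM
      refine (hpow (le_add_of_nonneg_right (by positivity))).trans ?_
      have : (2:ℝ) ^ i * |x - a| ≤ 1 := by
        calc (2:ℝ) ^ i * |x - a| ≤ 2 ^ i * 2 ^ (-n) := mul_le_mul_of_nonneg_left (hdist a h1 h2) (by positivity)
          _ = (2⁻¹:ℝ) ^ k := hi2
          _ ≤ 1 := pow_le_one₀ (by norm_num) (by norm_num)
      linarith
    have hd : ∀ y, l ≤ y → y ≤ h → ‖f x - f y‖ ≤ 2 ^ i * (2 * M) * 2 ^ (-n) := by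
      intro y h1 h2
      have := Convex.norm_image_sub_le_of_norm_hasDerivWithin_le (f := f) (f' := f') (s := Set.Icc l h)
        (C := 2 ^ i * (2 * M)) (fun z _ => (hf' z).hasDerivWithinAt) (fun z hz => hb z hz.1 hz.2)
        (convex_Icc _ _) (Set.mem_Icc.2 ⟨h1, h2⟩) (Set.mem_Icc.2 ⟨k1, k2.le⟩)
      refine this.trans (mul_le_mul_of_nonneg_left ?_ (by positivity))
      exact hdist y h1 h2
    have e : f x - En n f x = ((2:ℝ) ^ n : ℝ) * ∫ y in l..h, (f x - f y) := by
      rw [intervalIntegral.integral_sub (by simp) (hf.intervalIntegrable _ _), hEn,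
        intervalIntegral.integral_const, hlh, mul_sub, Complex.real_smul, ← mul_assoc, ← Complex.ofReal_mul, hnm]
      simp
    have hI : ‖∫ y in l..h, (f x - f y)‖ ≤ 2 ^ i * (2 * M) * 2 ^ (-n) * |h - l| := by
      refine intervalIntegral.norm_integral_le_of_norm_le_const fun y hy => ?_
      rw [Set.uIoc_of_le (by linarith)] at hy
      exact hd y hy.1.le hy.2
    rw [e, norm_mul, Complex.norm_real, Real.norm_of_nonneg hn.le]
    calc 2 ^ n * ‖∫ y in l..h, (f x - f y)‖ ≤ 2 ^ n * (2 ^ i * (2 * M) * 2 ^ (-n) * |h - l|) :=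
          mul_le_mul_of_nonneg_left hI hn.le
      _ = 2 * M * (2 ^ i * 2 ^ (-n)) * (2 ^ n * 2 ^ (-n)) := by rw [hlh, abs_of_pos hnn]; ring
      _ = 2 * M * (2⁻¹:ℝ) ^ k := by rw [hi2, hnm, mul_one]
      _ ≤ _ := by
          refine mul_le_mul_of_nonneg_left (pow_le_pow_left₀ (by norm_num) ?_ _) (by positivity)
          rw [← Real.rpow_neg_one]
          exact Real.rpow_le_rpow_of_exponent_le (by norm_num) (by linarith)
  · intro hni
    obtain ⟨k, hk⟩ := Int.le.dest hni
    have hnat : (n - i).natAbs = k := by omega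
    rw [hnat]
    have hi2 : (2:ℝ) ^ i * 2 ^ (-n) = (2:ℝ) ^ k := by
      rw [← zpow_add₀ (by norm_num)]
      rw [show i + -n = (k:ℤ) by omega, zpow_natCast]
    have hni2 : (2:ℝ) ^ n * 2 ^ (-i) = ((2:ℝ) ^ k)⁻¹ := by
      rw [← zpow_add₀ (by norm_num)]
      rw [show n + -i = -(k:ℤ) by omega, zpow_neg, zpow_natCast]
    have hI : ∫ y in l..h, f y = g h - g l :=
      intervalIntegral.integral_eq_sub_of_hasDerivAt (fun z _ => hg z) (hf.intervalIntegrable _ _)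
    have hb : ∀ a, l ≤ a → a ≤ h → ‖g a‖ ≤ 2 ^ (-i) * (M * (2 * ((2:ℝ) ^ k) ^ α)) := by
      intro a h1 h2
      refine (hgb a).trans (mul_le_mul_of_nonneg_left (mul_le_mul_of_nonneg_left ?_ hM) (by positivity))
      have h3 : (2:ℝ) ^ i * |x - a| ≤ 2 ^ k := by
        rw [← hi2]
        exact mul_le_mul_of_nonneg_left (hdist a h1 h2) (by positivity)
      have h4 : (1:ℝ) ≤ 2 ^ k := one_le_pow₀ (by norm_num)
      calc (1 + (2:ℝ) ^ i * |x - a|) ^ α ≤ (2 * 2 ^ k) ^ α :=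
            Real.rpow_le_rpow (by positivity) (by linarith) hα
        _ = 2 ^ α * (2 ^ k) ^ α := Real.mul_rpow (by norm_num) (by positivity)
        _ ≤ _ := mul_le_mul_of_nonneg_right (hpow (by norm_num)) (by positivity)
    have e5 : ((2:ℝ) ^ k)⁻¹ * ((2:ℝ) ^ k) ^ α = ((2:ℝ) ^ (-(1 - α))) ^ k := by
      rw [← Real.rpow_natCast 2 k, ← Real.rpow_mul (by norm_num), ← Real.rpow_neg (by norm_num),
        ← Real.rpow_add (by norm_num), ← Real.rpow_natCast, ← Real.rpow_mul (by norm_num)]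
      congr 1; ring
    rw [hEn, hI, norm_mul, Complex.norm_real, Real.norm_of_nonneg hn.le]
    calc 2 ^ n * ‖g h - g l‖ ≤ 2 ^ n * (2 ^ (-i) * (M * (2 * ((2:ℝ) ^ k) ^ α)) + 2 ^ (-i) * (M * (2 * ((2:ℝ) ^ k) ^ α))) := by
          refine mul_le_mul_of_nonneg_left ((norm_sub_le _ _).trans ?_) hn.le
          exact add_le_add (hb h (by linarith) le_rfl) (hb l le_rfl (by linarith))
      _ = 4 * M * ((2 ^ n * 2 ^ (-i)) * ((2:ℝ) ^ k) ^ α) := by ring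
      _ = _ := by rw [hni2, e5]

/-- the maximal majorant of a band-limited function -/
def bb (κ u : ℝ) (i : ℤ) (f : SchwartzMap ℝ ℂ) (x : ℝ) : ℝ≥0∞ :=
  (cv κ i (fun y => ‖f y‖ₑ ^ u) x) ^ (1 / u)

lemma bb_meas (κ u : ℝ) (i : ℤ) (f : SchwartzMap ℝ ℂ) : Measurable (bb κ u i f) := by
  unfold bb
  exact (cv_meas κ i (f.continuous.enorm.measurable.pow_const u)).pow_const _

lemma lp_est (Nb κ u : ℝ) (hκ : 1 < κ) (hκu : κ < u) (hκ2 : κ ≤ 2) :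
    ∃ C : ℝ≥0, 1 ≤ C ∧ ∀ (i : ℤ) (f : SchwartzMap ℝ ℂ), Band Nb i f → ∀ (x : ℝ),
      ‖f x‖ₑ ≤ C * bb κ u i f x ∧ ∀ n : ℤ,
      (i ≤ n → ‖f x - En n f x‖ₑ ≤ C * ENNReal.ofReal (((2:ℝ) ^ (-(1 - κ / u))) ^ (n - i).natAbs) * bb κ u i f x) ∧
      (n ≤ i → ‖En n f x‖ₑ ≤ C * ENNReal.ofReal (((2:ℝ) ^ (-(1 - κ / u))) ^ (n - i).natAbs) * bb κ u i f x) := by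
  obtain ⟨χ, χ1, ω, h1, h2, h3⟩ := exists_mult Nb
  have hu : 1 < u := by linarith
  have hu0 : 0 < u := by linarith
  obtain ⟨C0, hC0⟩ := Tm_bound χ κ u hκ hκ2 hu.le
  obtain ⟨C1, hC1⟩ := Tm_bound χ1 κ u hκ hκ2 hu.le
  obtain ⟨C2, hC2⟩ := Tm_bound ω κ u hκ hκ2 hu.le
  refine ⟨1 + C0 + 4 * (C1 + C2), ?_, fun i f hf x => ?_⟩
  · rw [add_assoc]; exact le_self_add
  have hid := Tm_id Nb χ h1 i f hf
  have hC : ((1 + C0 + 4 * (C1 + C2) : ℝ≥0) : ℝ≥0∞) ≠ 0 := by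
    have : (0:ℝ≥0) < 1 + C0 + 4 * (C1 + C2) := by positivity
    exact_mod_cast this.ne'
  refine ⟨?_, fun n => ?_⟩
  · have := hC0 f i x x
    rw [hid] at this
    simp only [sub_self, abs_zero, mul_zero, add_zero, Real.one_rpow, ENNReal.ofReal_one, mul_one] at this
    refine this.trans (mul_le_mul_left ?_ _)
    norm_cast
    rw [add_right_comm, add_comm]
    exact le_self_add
  by_cases hb : bb κ u i f x = ∞
  · have : ∀ k : ℕ, ((1 + C0 + 4 * (C1 + C2) : ℝ≥0) : ℝ≥0∞) *
        ENNReal.ofReal (((2:ℝ) ^ (-(1 - κ / u))) ^ k) * bb κ u i f x = ∞ := by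
      intro k
      rw [hb]
      refine ENNReal.mul_top (mul_ne_zero hC ?_)
      have : (0:ℝ) < ((2:ℝ) ^ (-(1 - κ / u))) ^ k := by positivity
      simpa using this
    rw [this]
    exact ⟨fun _ => le_top, fun _ => le_top⟩
  have h2i : (0:ℝ) < 2 ^ i := by positivity
  set b := (bb κ u i f x).toReal with hbdef
  have hbb : bb κ u i f x = ENNReal.ofReal b := (ENNReal.ofReal_toReal hb).symm
  have tr : ∀ (m : SchwartzMap ℝ ℂ) (C : ℝ≥0), C ≤ C1 + C2 → (∀ a, ‖Tm m ((2:ℝ) ^ i) f a‖ₑ ≤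
      C * ENNReal.ofReal ((1 + (2:ℝ) ^ i * |x - a|) ^ (κ / u)) * bb κ u i f x) →
      ∀ a, ‖Tm m ((2:ℝ) ^ i) f a‖ ≤ ((C1 + C2 : ℝ≥0) * b) * (1 + (2:ℝ) ^ i * |x - a|) ^ (κ / u) := by
    intro m C hCC h a
    have := h a
    rw [hbb, ← ofReal_norm, ← ENNReal.ofReal_coe_nnreal, ← ENNReal.ofReal_mul (by positivity),
      ← ENNReal.ofReal_mul (by positivity), ENNReal.ofReal_le_ofReal_iff (by positivity)] at this
    refine this.trans ?_
    rw [mul_right_comm]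
    have : (C:ℝ) ≤ (C1 + C2 : ℝ≥0) := by exact_mod_cast hCC
    gcongr
  have t1 := tr χ1 C1 le_self_add (fun a => hC1 f i a x)
  have t2 := tr ω C2 le_add_self (fun a => hC2 f i a x)
  have hf' : ∀ a, HasDerivAt (⇑f) (((2:ℝ) ^ i : ℝ) * Tm χ1 ((2:ℝ) ^ i) f a) a := by
    intro a
    have := Tm_deriv χ χ1 f h3 _ h2i a
    rwa [hid] at this
  have hg : ∀ a, HasDerivAt (fun a => (((2:ℝ) ^ (-i) : ℝ) : ℂ) * Tm ω ((2:ℝ) ^ i) f a) (f a) a := by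
    intro a
    have := (Tm_deriv ω χ f h2 _ h2i a).const_mul ((((2:ℝ) ^ (-i) : ℝ) : ℂ))
    rw [hid] at this
    have e : (((2:ℝ) ^ (-i) : ℝ) : ℂ) * ((((2:ℝ) ^ i : ℝ) : ℂ) * f a) = f a := by
      rw [← mul_assoc, ← Complex.ofReal_mul, ← zpow_add₀ (by norm_num)]
      simp
    exact this.congr_deriv e
  have hα : 0 ≤ κ / u := by positivity
  have hα1 : κ / u ≤ 1 := by rw [div_le_one hu0]; exact hκu.le
  have main := lp_real f f.continuous _ _ hf' hg i x (κ / u) ((C1 + C2 : ℝ≥0) * b) hα hα1 (by positivity)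
    (by
      intro a
      rw [norm_mul, Complex.norm_real, Real.norm_of_nonneg h2i.le]
      exact mul_le_mul_of_nonneg_left (t1 a) h2i.le)
    (by
      intro a
      rw [norm_mul, Complex.norm_real, Real.norm_of_nonneg (by positivity)]
      exact mul_le_mul_of_nonneg_left (t2 a) (by positivity)) n
  have fin : ∀ z : ℂ, ‖z‖ ≤ 4 * ((C1 + C2 : ℝ≥0) * b) * ((2:ℝ) ^ (-(1 - κ / u))) ^ (n - i).natAbs →
      ‖z‖ₑ ≤ ((1 + C0 + 4 * (C1 + C2) : ℝ≥0) : ℝ≥0∞) *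
        ENNReal.ofReal (((2:ℝ) ^ (-(1 - κ / u))) ^ (n - i).natAbs) * bb κ u i f x := by
    intro z hz
    rw [hbb, ← ofReal_norm, ← ENNReal.ofReal_coe_nnreal, ← ENNReal.ofReal_mul (by positivity),
      ← ENNReal.ofReal_mul (by positivity)]
    refine ENNReal.ofReal_le_ofReal (hz.trans ?_)
    rw [show 4 * (((C1 + C2 : ℝ≥0) : ℝ) * b) * ((2:ℝ) ^ (-(1 - κ / u))) ^ (n - i).natAbs =
      4 * ((C1 + C2 : ℝ≥0) : ℝ) * ((2:ℝ) ^ (-(1 - κ / u))) ^ (n - i).natAbs * b by ring]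
    have : 4 * ((C1 + C2 : ℝ≥0) : ℝ) ≤ ((1 + C0 + 4 * (C1 + C2) : ℝ≥0) : ℝ) := by
      push_cast
      linarith [C0.coe_nonneg]
    gcongr
  refine ⟨fun h => fin _ ((main.1 h).trans ?_), fun h => fin _ (main.2 h)⟩
  gcongr
  norm_num

end BVP

namespace BVP

/-! ### Transfer from martingales to the continuous setting: pointwise part -/

lemma dF_decomp {f d φ : ℕ → ℂ} (hf : ∀ j, f j = d j + (φ (j+1) - φ j)) {a b : ℕ} (h : a ≤ b) :
    dF f a b = dF d a b + φ b - φ a := by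
  induction b, h using Nat.le_induction with
  | base => simp
  | succ b hb ih => rw [dF_succ _ hb, dF_succ _ hb, ih, hf b]; ring

lemma dP_decomp {f d φ g e γ : ℕ → ℂ} (hf : ∀ j, f j = d j + (φ (j+1) - φ j))
    (hg : ∀ j, g j = e j + (γ (j+1) - γ j)) {a b : ℕ} (h : a ≤ b) :
    dP f g a b = dP d e a b + dF f a b * γ b - ∑ j ∈ Finset.Ico a b, f j * γ (j+1)
      + ∑ j ∈ Finset.Ico a b, φ j * e j - φ a * dF e a b := by
  induction b, h using Nat.le_induction with
  | base => simp
  | succ b hb ih =>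
    rw [dP_succ _ _ hb, dP_succ _ _ hb, dF_succ _ hb, dF_succ _ hb, Finset.sum_Ico_succ_top hb,
      Finset.sum_Ico_succ_top hb, ih, hg b, dF_decomp hf hb]
    ring

lemma rpow_le_of_le_one {x : ℝ≥0∞} (hx : x ≤ 1) {r r1 : ℝ} (h : r ≤ r1) : x ^ r1 ≤ x ^ r :=
  ENNReal.rpow_le_rpow_of_exponent_ge hx h

lemma le_one_of_rpow {x : ℝ≥0∞} {r : ℝ} (hr : 0 < r) (hx : x ^ r ≤ 1) : x ≤ 1 := by
  have := ENNReal.rpow_le_rpow hx (z := r⁻¹) (by positivity)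
  rwa [ENNReal.rpow_rpow_inv hr.ne', ENNReal.one_rpow] at this

lemma sum_rpow_le {ι : Type} (I : Finset ι) (x : ι → ℝ≥0∞) {t : ℝ} (ht0 : 0 < t) (ht : t ≤ 1) :
    (∑ i ∈ I, x i) ^ t ≤ ∑ i ∈ I, x i ^ t := by
  classical
  induction I using Finset.induction_on with
  | empty => simp [ht0]
  | insert i I hi ih =>
    rw [Finset.sum_insert hi, Finset.sum_insert hi]
    exact (ENNReal.rpow_add_le_add_rpow _ _ ht0.le ht).trans (by gcongr)

lemma mul_le_sq (x y : ℝ≥0∞) : x * y ≤ x ^ (2:ℝ) + y ^ (2:ℝ) := by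
  rw [ENNReal.rpow_two, ENNReal.rpow_two]
  rcases le_total x y with h | h
  · exact (mul_le_mul_left h y).trans (by rw [← sq]; exact le_add_self)
  · exact (mul_le_mul_right h x).trans (by rw [← sq]; exact le_self_add)

lemma diag {r s r1 s1 t : ℝ} (hx : Exps r s r1 s1 t) (I : Finset ℕ) (x y : ℕ → ℂ)
    (h1 : ∑ j ∈ I, ‖x j‖ₑ ^ r ≤ 1) (h2 : ∑ j ∈ I, ‖y j‖ₑ ^ s ≤ 1) :
    ‖∑ j ∈ I, x j * y j‖ₑ ^ t ≤ 2 ^ t * ∑ j ∈ I, (‖x j‖ₑ ^ r + ‖y j‖ₑ ^ s) := by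
  have hx1 : ∀ j ∈ I, ‖x j‖ₑ ≤ 1 := fun j hj =>
    le_one_of_rpow hx.r0 ((Finset.single_le_sum (f := fun j => ‖x j‖ₑ ^ r) (fun _ _ => zero_le) hj).trans h1)
  have hy1 : ∀ j ∈ I, ‖y j‖ₑ ≤ 1 := fun j hj =>
    le_one_of_rpow hx.s0 ((Finset.single_le_sum (f := fun j => ‖y j‖ₑ ^ s) (fun _ _ => zero_le) hj).trans h2)
  have e1 : ‖∑ j ∈ I, x j * y j‖ₑ ≤ ∑ j ∈ I, ‖x j‖ₑ * ‖y j‖ₑ := by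
    refine (enorm_sum_le _ _).trans (Finset.sum_le_sum fun j _ => ?_)
    rw [enorm_mul]
  have h2t : (1:ℝ≥0∞) ≤ 2 ^ t := ENNReal.one_le_rpow (by norm_num) hx.t0
  by_cases ht : t ≤ 1
  · calc ‖∑ j ∈ I, x j * y j‖ₑ ^ t ≤ (∑ j ∈ I, ‖x j‖ₑ * ‖y j‖ₑ) ^ t := ENNReal.rpow_le_rpow e1 hx.t0.le
      _ ≤ ∑ j ∈ I, (‖x j‖ₑ * ‖y j‖ₑ) ^ t := sum_rpow_le _ _ hx.t0 ht
      _ ≤ ∑ j ∈ I, (‖x j‖ₑ ^ r + ‖y j‖ₑ ^ s) := by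
          refine Finset.sum_le_sum fun j hj => (young r1 s1 t hx.r10 hx.s10 hx.t0 hx.tt _ _).trans ?_
          exact add_le_add (rpow_le_of_le_one (hx1 j hj) hx.rr) (rpow_le_of_le_one (hy1 j hj) hx.ss)
      _ ≤ _ := le_mul_of_one_le_left zero_le h2t
  · push Not at ht
    set S := ∑ j ∈ I, (‖x j‖ₑ ^ r + ‖y j‖ₑ ^ s) with hS
    have hS2 : S ≤ 2 := by
      rw [hS, Finset.sum_add_distrib, ← one_add_one_eq_two]
      exact add_le_add h1 h2
    have e2 : ∑ j ∈ I, ‖x j‖ₑ * ‖y j‖ₑ ≤ S := by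
      refine Finset.sum_le_sum fun j hj => (mul_le_sq _ _).trans ?_
      exact add_le_add (rpow_le_of_le_one (hx1 j hj) hx.r2) (rpow_le_of_le_one (hy1 j hj) hx.s2)
    calc ‖∑ j ∈ I, x j * y j‖ₑ ^ t ≤ S ^ t := ENNReal.rpow_le_rpow (e1.trans e2) hx.t0.le
      _ = S ^ (t - 1) * S := by
          have := ENNReal.rpow_add_of_nonneg (x := S) (t - 1) 1 (by linarith) (by norm_num)
          rw [sub_add_cancel, ENNReal.rpow_one] at this
          exact this
      _ ≤ 2 ^ t * S := by
          refine mul_le_mul_left ?_ _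
          calc S ^ (t-1) ≤ 2 ^ (t - 1) := ENNReal.rpow_le_rpow hS2 (by linarith)
            _ ≤ 2 ^ t := ENNReal.rpow_le_rpow_of_exponent_le (by norm_num) (by linarith)

lemma add3_rpow {r : ℝ} (hr : 0 < r) (x y z : ℝ≥0∞) :
    (x + y + z) ^ r ≤ 2 ^ r * 2 ^ r * (x ^ r + y ^ r + z ^ r) := by
  have h2t : (1:ℝ≥0∞) ≤ 2 ^ r := ENNReal.one_le_rpow (by norm_num) hr
  calc (x + y + z) ^ r ≤ 2 ^ r * ((x + y) ^ r + z ^ r) := add_rpow_le r hr.le _ _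
    _ ≤ 2 ^ r * (2 ^ r * (x ^ r + y ^ r) + 2 ^ r * z ^ r) := by
        refine mul_le_mul_right (add_le_add (add_rpow_le r hr.le _ _) (le_mul_of_one_le_left zero_le h2t)) _
    _ = _ := by ring

lemma add5_rpow {r : ℝ} (hr : 0 < r) (x y z u v : ℝ≥0∞) :
    (x + y + z + u + v) ^ r ≤ 2 ^ r * 2 ^ r * (2 ^ r * 2 ^ r) * (x ^ r + y ^ r + z ^ r + u ^ r + v ^ r) := by
  have h2t : (1:ℝ≥0∞) ≤ 2 ^ r := ENNReal.one_le_rpow (by norm_num) hr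
  have h2tt : (1:ℝ≥0∞) ≤ 2 ^ r * 2 ^ r := one_le_mul h2t h2t
  calc (x + y + z + u + v) ^ r ≤ 2 ^ r * 2 ^ r * ((x + y + z) ^ r + u ^ r + v ^ r) := add3_rpow hr _ _ _
    _ ≤ 2 ^ r * 2 ^ r * (2 ^ r * 2 ^ r * (x ^ r + y ^ r + z ^ r) + 2 ^ r * 2 ^ r * u ^ r + 2 ^ r * 2 ^ r * v ^ r) :=
        mul_le_mul_right (add_le_add (add_le_add (add3_rpow hr _ _ _) (le_mul_of_one_le_left zero_le h2tt))
          (le_mul_of_one_le_left zero_le h2tt)) _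
    _ = _ := by ring

/-- local error terms -/
def sg (r s : ℝ) (f φ e γ : ℕ → ℂ) (j : ℕ) : ℝ≥0∞ :=
  ‖f j‖ₑ ^ r + ‖φ j‖ₑ ^ r + ‖φ (j+1)‖ₑ ^ r + (‖e j‖ₑ ^ s + ‖γ j‖ₑ ^ s + ‖γ (j+1)‖ₑ ^ s)

lemma pw_core {r s r1 s1 t : ℝ} (hx : Exps r s r1 s1 t) : ∃ K : ℝ≥0, 1 ≤ K ∧
    ∀ (f d φ g e γ : ℕ → ℂ), (∀ j, f j = d j + (φ (j+1) - φ j)) → (∀ j, g j = e j + (γ (j+1) - γ j)) →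
    ∀ D : ℕ, ∑ j ∈ Finset.range D, ‖f j‖ₑ ^ r ≤ 1 → ∑ j ∈ Finset.range (D+1), ‖φ j‖ₑ ^ r ≤ 1 →
      ∑ j ∈ Finset.range D, ‖e j‖ₑ ^ s ≤ 1 → ∑ j ∈ Finset.range (D+1), ‖γ j‖ₑ ^ s ≤ 1 →
      V (wF r1 f) 0 D ≤ K * (V (W r1 s1 t d e) 0 D + 6) ∧
      V (wP t f g) 0 D ≤ K * (V (W r1 s1 t d e) 0 D + 6) := by
  set K1 : ℝ≥0∞ := 2 ^ r1 * 2 ^ r1 * 3 with hK1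
  set K2 : ℝ≥0∞ := 2 ^ t * 2 ^ t * (2 ^ t * 2 ^ t) * (1 + (K1 + 1) + 2 ^ t + 2 ^ t + 2) with hK2
  have t2 : ∀ y : ℝ, 0 < y → (2:ℝ≥0∞) ^ y ≠ ∞ := fun y hy => ENNReal.rpow_ne_top_of_nonneg hy.le (by norm_num)
  have hK1t : K1 ≠ ∞ := by
    exact ENNReal.mul_ne_top (ENNReal.mul_ne_top (t2 _ hx.r10) (t2 _ hx.r10)) (by norm_num)
  have hK2t : K2 ≠ ∞ := by
    have := t2 t hx.t0
    refine ENNReal.mul_ne_top (ENNReal.mul_ne_top (ENNReal.mul_ne_top this this) (ENNReal.mul_ne_top this this)) ?_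
    simp [this, hK1t]
  refine ⟨(K1 + K2).toNNReal + 1, le_add_self, ?_⟩
  intro f d φ g e γ hf hg D h1 h2 h3 h4
  have hKc : (((K1 + K2).toNNReal + 1 : ℝ≥0) : ℝ≥0∞) = K1 + K2 + 1 := by
    rw [ENNReal.coe_add, ENNReal.coe_toNNReal (by simp [hK1t, hK2t])]; simp
  rw [hKc]
  set Kk := K1 + K2 + 1 with hKk
  have hK1k : K1 ≤ Kk := by rw [hKk, add_assoc]; exact le_self_add
  have hK2k : K2 ≤ Kk := by rw [hKk, add_right_comm]; exact le_add_self
  set w := W r1 s1 t d e with hw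
  set σ := sg r s f φ e γ with hσ
  have sub : ∀ (z : ℕ → ℂ) (y : ℝ) (a b m : ℕ), b ≤ m → ∑ j ∈ Finset.range m, ‖z j‖ₑ ^ y ≤ 1 →
      ∑ j ∈ Finset.Ico a b, ‖z j‖ₑ ^ y ≤ 1 := by
    intro z y a b m hm h
    refine (Finset.sum_le_sum_of_subset ?_).trans h
    intro j hj
    simp only [Finset.mem_Ico, Finset.mem_range] at hj ⊢
    omega
  have sub1 : ∀ (z : ℕ → ℂ) (y : ℝ) (a b m : ℕ), b ≤ m → ∑ j ∈ Finset.range (m+1), ‖z j‖ₑ ^ y ≤ 1 →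
      ∑ j ∈ Finset.Ico a b, ‖z (j+1)‖ₑ ^ y ≤ 1 := by
    intro z y a b m hm h
    rw [Finset.sum_Ico_add' (fun j => ‖z j‖ₑ ^ y) a b 1]
    exact sub z y _ _ (m+1) (by omega) h
  have one : ∀ (z : ℕ → ℂ) (y : ℝ) (m : ℕ), 0 < y → ∑ j ∈ Finset.range m, ‖z j‖ₑ ^ y ≤ 1 → ∀ j < m, ‖z j‖ₑ ≤ 1 := by
    intro z y m hy h j hj
    exact le_one_of_rpow hy ((Finset.single_le_sum (f := fun j => ‖z j‖ₑ ^ y) (fun _ _ => zero_le)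
      (Finset.mem_range.2 hj)).trans h)
  -- local estimates
  have loc : ∀ a b, a < b → b ≤ D → wF r1 f a b ≤ Kk * (w a b + ∑ j ∈ Finset.Ico a b, σ j) ∧
      wP t f g a b ≤ Kk * (w a b + ∑ j ∈ Finset.Ico a b, σ j) := by
    intro a b hab hbD
    set U := w a b + ∑ j ∈ Finset.Ico a b, σ j with hU
    have hwU : w a b ≤ U := le_self_add
    have hsU : ∀ j, a ≤ j → j < b → σ j ≤ U := fun j h1 h2 =>
      (Finset.single_le_sum (f := σ) (fun _ _ => zero_le) (Finset.mem_Ico.2 ⟨h1, h2⟩)).trans le_add_self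
    have w1 : ‖dF d a b‖ₑ ^ r1 ≤ U := by
      refine le_trans ?_ hwU
      rw [hw, W, add_assoc]; exact le_self_add
    have w2 : ‖dF e a b‖ₑ ^ s1 ≤ U := by
      refine le_trans ?_ hwU
      rw [hw, W, add_right_comm]; exact le_add_self
    have w3 : ‖dP d e a b‖ₑ ^ t ≤ U := le_trans (by rw [hw, W]; exact le_add_self) hwU
    have pa : ‖φ a‖ₑ ^ r1 ≤ U := by
      refine (rpow_le_of_le_one (one φ r (D+1) hx.r0 h2 a (by omega)) hx.rr).trans ((?_ : _ ≤ σ a).trans (hsU a le_rfl hab))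
      simp only [hσ, sg]
      calc ‖φ a‖ₑ ^ r ≤ ‖f a‖ₑ ^ r + ‖φ a‖ₑ ^ r := le_add_self
        _ ≤ _ := le_self_add
        _ ≤ _ := le_self_add
    have hb1 : b - 1 + 1 = b := by omega
    have pb : ‖φ b‖ₑ ^ r1 ≤ U := by
      refine (rpow_le_of_le_one (one φ r (D+1) hx.r0 h2 b (by omega)) hx.rr).trans
        ((?_ : _ ≤ σ (b-1)).trans (hsU (b-1) (by omega) (by omega)))
      simp only [hσ, sg, hb1]
      calc ‖φ b‖ₑ ^ r ≤ ‖f (b-1)‖ₑ ^ r + ‖φ (b-1)‖ₑ ^ r + ‖φ b‖ₑ ^ r := le_add_self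
        _ ≤ _ := le_self_add
    have gb : ‖γ b‖ₑ ^ s1 ≤ U := by
      refine (rpow_le_of_le_one (one γ s (D+1) hx.s0 h4 b (by omega)) hx.ss).trans
        ((?_ : _ ≤ σ (b-1)).trans (hsU (b-1) (by omega) (by omega)))
      simp only [hσ, sg, hb1]
      calc ‖γ b‖ₑ ^ s ≤ ‖e (b-1)‖ₑ ^ s + ‖γ (b-1)‖ₑ ^ s + ‖γ b‖ₑ ^ s := le_add_self
        _ ≤ _ := le_add_self
    have hF : ‖dF f a b‖ₑ ^ r1 ≤ K1 * U := by
      rw [dF_decomp hf hab.le]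
      have : ‖dF d a b + φ b - φ a‖ₑ ≤ ‖dF d a b‖ₑ + ‖φ b‖ₑ + ‖φ a‖ₑ :=
        enorm_sub_le.trans (by gcongr; exact enorm_add_le _ _)
      calc _ ≤ (‖dF d a b‖ₑ + ‖φ b‖ₑ + ‖φ a‖ₑ) ^ r1 := ENNReal.rpow_le_rpow this hx.r10.le
        _ ≤ 2 ^ r1 * 2 ^ r1 * (‖dF d a b‖ₑ ^ r1 + ‖φ b‖ₑ ^ r1 + ‖φ a‖ₑ ^ r1) := add3_rpow hx.r10 _ _ _
        _ ≤ 2 ^ r1 * 2 ^ r1 * (U + U + U) := by gcongr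
        _ = K1 * U := by rw [hK1]; ring
    have D1 : ‖∑ j ∈ Finset.Ico a b, f j * γ (j+1)‖ₑ ^ t ≤ 2 ^ t * U := by
      refine (diag hx _ f (fun j => γ (j+1)) (sub f r a b D hbD h1) (sub1 γ s a b D hbD h4)).trans ?_
      refine mul_le_mul_right (le_trans (Finset.sum_le_sum fun j _ => ?_) le_add_self) _
      simp only [hσ, sg]
      refine add_le_add ?_ le_add_self
      rw [add_assoc]; exact le_self_add
    have D2 : ‖∑ j ∈ Finset.Ico a b, φ j * e j‖ₑ ^ t ≤ 2 ^ t * U := by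
      refine (diag hx _ φ e (sub φ r a b (D+1) (by omega) h2) (sub e s a b D hbD h3)).trans ?_
      refine mul_le_mul_right (le_trans (Finset.sum_le_sum fun j _ => ?_) le_add_self) _
      simp only [hσ, sg]
      refine add_le_add ?_ ?_
      · rw [add_right_comm]; exact le_add_self
      · rw [add_assoc]; exact le_self_add
    have hP : ‖dP f g a b‖ₑ ^ t ≤ K2 * U := by
      rw [dP_decomp hf hg hab.le]
      set x1 := dP d e a b
      set x2 := dF f a b * γ b
      set x3 := ∑ j ∈ Finset.Ico a b, f j * γ (j+1)
      set x4 := ∑ j ∈ Finset.Ico a b, φ j * e j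
      set x5 := φ a * dF e a b
      have hn : ‖x1 + x2 - x3 + x4 - x5‖ₑ ≤ ‖x1‖ₑ + ‖x2‖ₑ + ‖x3‖ₑ + ‖x4‖ₑ + ‖x5‖ₑ := by
        refine enorm_sub_le.trans (add_le_add_left ?_ _)
        refine (enorm_add_le _ _).trans (add_le_add_left ?_ _)
        refine enorm_sub_le.trans (add_le_add_left ?_ _)
        exact enorm_add_le _ _
      have y2 : ‖x2‖ₑ ^ t ≤ (K1 + 1) * U := by
        rw [enorm_mul, add_mul, one_mul]
        exact (young r1 s1 t hx.r10 hx.s10 hx.t0 hx.tt _ _).trans (add_le_add hF gb)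
      have y5 : ‖x5‖ₑ ^ t ≤ 2 * U := by
        rw [enorm_mul, two_mul]
        exact (young r1 s1 t hx.r10 hx.s10 hx.t0 hx.tt _ _).trans (add_le_add pa w2)
      calc _ ≤ (‖x1‖ₑ + ‖x2‖ₑ + ‖x3‖ₑ + ‖x4‖ₑ + ‖x5‖ₑ) ^ t := ENNReal.rpow_le_rpow hn hx.t0.le
        _ ≤ 2 ^ t * 2 ^ t * (2 ^ t * 2 ^ t) * (‖x1‖ₑ ^ t + ‖x2‖ₑ ^ t + ‖x3‖ₑ ^ t + ‖x4‖ₑ ^ t + ‖x5‖ₑ ^ t) :=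
            add5_rpow hx.t0 _ _ _ _ _
        _ ≤ 2 ^ t * 2 ^ t * (2 ^ t * 2 ^ t) * (U + (K1 + 1) * U + 2 ^ t * U + 2 ^ t * U + 2 * U) := by
            refine mul_le_mul_right (add_le_add (add_le_add (add_le_add (add_le_add w3 y2) D1) D2) y5) _
        _ = K2 * U := by rw [hK2]; ring
    exact ⟨hF.trans (mul_le_mul_left hK1k _), hP.trans (mul_le_mul_left hK2k _)⟩
  have hσ6 : ∑ j ∈ Finset.Ico 0 D, σ j ≤ 6 := by
    simp only [hσ, sg, Finset.sum_add_distrib]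
    have a1 := sub f r 0 D D le_rfl h1
    have a2 := sub φ r 0 D (D+1) (by omega) h2
    have a3 := sub1 φ r 0 D D le_rfl h2
    have a4 := sub e s 0 D D le_rfl h3
    have a5 := sub γ s 0 D (D+1) (by omega) h4
    have a6 := sub1 γ s 0 D D le_rfl h4
    calc _ ≤ (1:ℝ≥0∞) + 1 + 1 + (1 + 1 + 1) := by gcongr
      _ = 6 := by norm_num
  have glob : ∀ v : ℕ → ℕ → ℝ≥0∞, (∀ a b, a < b → b ≤ D → v a b ≤ Kk * (w a b + ∑ j ∈ Finset.Ico a b, σ j)) →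
      V v 0 D ≤ Kk * (V w 0 D + 6) := by
    intro v hv
    refine (V_le v 0 D (fun n => Kk * (V w 0 n + ∑ j ∈ Finset.Ico 0 n, σ j)) ?_ D le_rfl).trans ?_
    · intro j n _ hjn hn
      calc _ ≤ Kk * (V w 0 j + ∑ i ∈ Finset.Ico 0 j, σ i) + Kk * (w j n + ∑ i ∈ Finset.Ico j n, σ i) := by
            gcongr; exact hv j n hjn hn
        _ = Kk * ((V w 0 j + w j n) + (∑ i ∈ Finset.Ico 0 j, σ i + ∑ i ∈ Finset.Ico j n, σ i)) := by ring
        _ ≤ _ := by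
            rw [Finset.sum_Ico_consecutive _ (Nat.zero_le _) hjn.le]
            exact mul_le_mul_right (add_le_add_left (V_step w (Nat.zero_le _) hjn) _) _
    · gcongr
  exact ⟨glob _ fun a b h1 h2 => (loc a b h1 h2).1, glob _ fun a b h1 h2 => (loc a b h1 h2).2⟩

end BVP

namespace BVP

lemma V_add3 (w1 w2 w3 : ℕ → ℕ → ℝ≥0∞) (D : ℕ) :
    V (fun a b => w1 a b + w2 a b + w3 a b) 0 D ≤ V w1 0 D + V w2 0 D + V w3 0 D := by
  refine V_le _ 0 D (fun n => V w1 0 n + V w2 0 n + V w3 0 n) (fun j n h1 h2 _ => ?_) D le_rfl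
  calc _ = (V w1 0 j + w1 j n) + (V w2 0 j + w2 j n) + (V w3 0 j + w3 j n) := by ring
    _ ≤ _ := add_le_add (add_le_add (V_step w1 h1 h2) (V_step w2 h1 h2)) (V_step w3 h1 h2)

lemma dF_smul (c : ℂ) (d : ℕ → ℂ) (a b : ℕ) : dF (fun j => c * d j) a b = c * dF d a b := by
  simp [dF, Finset.mul_sum]

lemma dP_smul (c c' : ℂ) (d e : ℕ → ℂ) (a b : ℕ) :
    dP (fun j => c * d j) (fun j => c' * e j) a b = c * c' * dP d e a b := by
  simp only [dP, dF_smul, Finset.mul_sum]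
  refine Finset.sum_congr rfl fun j _ => ?_
  ring

lemma rpow_scale {L A : ℝ≥0∞} (h0 : L ≠ 0) (h1 : L ≠ ∞) {y : ℝ} (hy : 0 < y) (h : A ^ y⁻¹ ≤ L) :
    L ^ (-y) * A ≤ 1 := by
  have : A ≤ L ^ y := by
    have := ENNReal.rpow_le_rpow h hy.le
    rwa [ENNReal.rpow_inv_rpow hy.ne'] at this
  calc L ^ (-y) * A ≤ L ^ (-y) * L ^ y := mul_le_mul_right this _
    _ = 1 := by rw [← ENNReal.rpow_add _ _ h0 h1]; simp

lemma le_of_forall_NNReal {X T : ℝ≥0∞} {K : ℝ≥0} (hK : 1 ≤ K)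
    (h : ∀ Λ : ℝ≥0, 0 < Λ → T ≤ Λ → X ≤ K * Λ) : X ≤ K * T := by
  by_cases hT : T = ∞
  · rw [hT, ENNReal.mul_top]
    · exact le_top
    · have : K ≠ 0 := (lt_of_lt_of_le one_pos hK).ne'
      exact_mod_cast this
  lift T to ℝ≥0 using hT
  refine ENNReal.le_of_forall_pos_le_add fun ε hε _ => ?_
  have hK0 : K ≠ 0 := (lt_of_lt_of_le one_pos hK).ne'
  have := h (T + ε / K) (by positivity) (by exact_mod_cast le_self_add)
  refine this.trans (le_of_eq ?_)
  norm_cast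
  field_simp

lemma pw_final {r s r1 s1 t : ℝ} (hx : Exps r s r1 s1 t) (p q : ℝ) (hp : 0 < p) (hq : 0 < q) :
    ∃ K : ℝ≥0, 1 ≤ K ∧
    ∀ (f d φ g e γ : ℕ → ℂ), (∀ j, f j = d j + (φ (j+1) - φ j)) → (∀ j, g j = e j + (γ (j+1) - γ j)) →
    ∀ D : ℕ,
      (V (wF r1 f) 0 D) ^ (p/r1) + (V (wP t f g) 0 D) ^ (t * (1/p+1/q))⁻¹ ≤
      K * ((∑ j ∈ Finset.range D, ‖f j‖ₑ ^ r) ^ (p/r) + (∑ j ∈ Finset.range (D+1), ‖φ j‖ₑ ^ r) ^ (p/r) +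
        (∑ j ∈ Finset.range D, ‖e j‖ₑ ^ s) ^ (q/s) + (∑ j ∈ Finset.range (D+1), ‖γ j‖ₑ ^ s) ^ (q/s) +
        ((V (wF r1 d) 0 D) ^ (p/r1) + (V (wF s1 e) 0 D) ^ (q/s1) + (V (wP t d e) 0 D) ^ (t * (1/p+1/q))⁻¹)) := by
  obtain ⟨K, hK1, hK⟩ := pw_core hx
  have hr1 := hx.r10
  have hs1 := hx.s10
  have ht0 := hx.t0
  have hr := hx.r0
  have hs := hx.s0
  set ρ := t * (1/p+1/q) with hρ
  have hρ0 : 0 < ρ := by positivity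
  refine ⟨(K * 9) ^ (p/r1) + (K * 9) ^ ρ⁻¹, ?_, ?_⟩
  · refine le_trans ?_ le_self_add
    exact NNReal.one_le_rpow (le_trans hK1 (le_mul_of_one_le_right zero_le (by norm_num))) (by positivity)
  intro f d φ g e γ hf hg D
  refine le_of_forall_NNReal ?_ ?_
  · refine le_trans ?_ le_self_add
    exact NNReal.one_le_rpow (le_trans hK1 (le_mul_of_one_le_right zero_le (by norm_num))) (by positivity)
  intro Λ hΛ hT
  have hL0 : (Λ:ℝ≥0∞) ≠ 0 := by exact_mod_cast hΛ.ne'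
  have hLt : (Λ:ℝ≥0∞) ≠ ∞ := ENNReal.coe_ne_top
  set L : ℝ≥0∞ := (Λ : ℝ≥0∞) with hL
  set A1 := (∑ j ∈ Finset.range D, ‖f j‖ₑ ^ r) ^ (p/r)
  set A2 := (∑ j ∈ Finset.range (D+1), ‖φ j‖ₑ ^ r) ^ (p/r)
  set A3 := (∑ j ∈ Finset.range D, ‖e j‖ₑ ^ s) ^ (q/s)
  set A4 := (∑ j ∈ Finset.range (D+1), ‖γ j‖ₑ ^ s) ^ (q/s)
  set A5 := (V (wF r1 d) 0 D) ^ (p/r1)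
  set A6 := (V (wF s1 e) 0 D) ^ (q/s1)
  set A7 := (V (wP t d e) 0 D) ^ ρ⁻¹
  have b1 : A1 ≤ L := le_trans (le_self_add.trans (le_self_add.trans (le_self_add.trans le_self_add))) hT
  have b2 : A2 ≤ L := le_trans (le_add_self.trans (le_self_add.trans (le_self_add.trans le_self_add))) hT
  have b3 : A3 ≤ L := le_trans (le_add_self.trans (le_self_add.trans le_self_add)) hT
  have b4 : A4 ≤ L := le_trans (le_add_self.trans le_self_add) hT
  have b5 : A5 ≤ L := le_trans ((le_self_add.trans le_self_add).trans le_add_self) hT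
  have b6 : A6 ≤ L := le_trans ((le_add_self.trans le_self_add).trans le_add_self) hT
  have b7 : A7 ≤ L := le_trans (le_add_self.trans le_add_self) hT
  -- scaled sequences
  set x : ℂ := (((Λ ^ (-(1/p)) : ℝ≥0) : ℝ) : ℂ) with hxd
  set y : ℂ := (((Λ ^ (-(1/q)) : ℝ≥0) : ℝ) : ℂ) with hyd
  have nx : ‖x‖ₑ = L ^ (-(1/p)) := by
    rw [hL, ← ENNReal.coe_rpow_of_ne_zero hΛ.ne', hxd, ← ofReal_norm, Complex.norm_real, NNReal.norm_eq,
      ENNReal.ofReal_coe_nnreal]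
  have ny : ‖y‖ₑ = L ^ (-(1/q)) := by
    rw [hL, ← ENNReal.coe_rpow_of_ne_zero hΛ.ne', hyd, ← ofReal_norm, Complex.norm_real, NNReal.norm_eq,
      ENNReal.ofReal_coe_nnreal]
  have nxr : ∀ z : ℝ, ‖x‖ₑ ^ z = L ^ (-(z/p)) := by
    intro z; rw [nx, ← ENNReal.rpow_mul]; congr 1; ring
  have nyr : ∀ z : ℝ, ‖y‖ₑ ^ z = L ^ (-(z/q)) := by
    intro z; rw [ny, ← ENNReal.rpow_mul]; congr 1; ring
  have nxy : ‖x * y‖ₑ ^ t = L ^ (-ρ) := by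
    rw [enorm_mul, nx, ny, ← ENNReal.rpow_add _ _ hL0 hLt, ← ENNReal.rpow_mul]; congr 1; rw [hρ]; ring
  have S1 : ∀ (z : ℕ → ℂ) (m : ℕ), (∑ j ∈ Finset.range m, ‖z j‖ₑ ^ r) ^ (p/r) ≤ L →
      ∑ j ∈ Finset.range m, ‖x * z j‖ₑ ^ r ≤ 1 := by
    intro z m h
    simp only [enorm_mul, ENNReal.mul_rpow_of_nonneg _ _ hr.le, ← Finset.mul_sum]
    rw [nxr]
    exact rpow_scale hL0 hLt (by positivity) (by rwa [inv_div])
  have S2 : ∀ (z : ℕ → ℂ) (m : ℕ), (∑ j ∈ Finset.range m, ‖z j‖ₑ ^ s) ^ (q/s) ≤ L →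
      ∑ j ∈ Finset.range m, ‖y * z j‖ₑ ^ s ≤ 1 := by
    intro z m h
    simp only [enorm_mul, ENNReal.mul_rpow_of_nonneg _ _ hs.le, ← Finset.mul_sum]
    rw [nyr]
    exact rpow_scale hL0 hLt (by positivity) (by rwa [inv_div])
  obtain ⟨c1, c2⟩ := hK (fun j => x * f j) (fun j => x * d j) (fun j => x * φ j) (fun j => y * g j)
    (fun j => y * e j) (fun j => y * γ j) (fun j => by simp only [hf j]; ring) (fun j => by simp only [hg j]; ring)
    D (S1 f D b1) (S1 φ (D+1) b2) (S2 e D b3) (S2 γ (D+1) b4)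
  have hW : V (W r1 s1 t (fun j => x * d j) (fun j => y * e j)) 0 D ≤ 3 := by
    have e1 : W r1 s1 t (fun j => x * d j) (fun j => y * e j) = fun a b =>
        L ^ (-(r1/p)) * wF r1 d a b + L ^ (-(s1/q)) * wF s1 e a b + L ^ (-ρ) * wP t d e a b := by
      funext a b
      rw [W, dF_smul, dF_smul, dP_smul, enorm_mul, enorm_mul, enorm_mul _ (dP d e a b),
        ENNReal.mul_rpow_of_nonneg _ _ hr1.le, ENNReal.mul_rpow_of_nonneg _ _ hs1.le,
        ENNReal.mul_rpow_of_nonneg _ _ ht0.le, nxr, nyr, nxy]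
      rfl
    rw [e1]
    refine (V_add3 _ _ _ D).trans ?_
    have k1 : V (fun a b => L ^ (-(r1/p)) * wF r1 d a b) 0 D ≤ 1 :=
      (V_const_mul _ _ _ _).trans (rpow_scale hL0 hLt (by positivity) (by rwa [inv_div]))
    have k2 : V (fun a b => L ^ (-(s1/q)) * wF s1 e a b) 0 D ≤ 1 :=
      (V_const_mul _ _ _ _).trans (rpow_scale hL0 hLt (by positivity) (by rwa [inv_div]))
    have k3 : V (fun a b => L ^ (-ρ) * wP t d e a b) 0 D ≤ 1 :=
      (V_const_mul _ _ _ _).trans (rpow_scale hL0 hLt hρ0 b7)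
    refine (add_le_add (add_le_add k1 k2) k3).trans (le_of_eq (by norm_num))
  have hK9 : (K:ℝ≥0∞) * (V (W r1 s1 t (fun j => x * d j) (fun j => y * e j)) 0 D + 6) ≤ ((K * 9 : ℝ≥0) : ℝ≥0∞) := by
    rw [ENNReal.coe_mul]
    refine mul_le_mul_right ((add_le_add_left hW _).trans (le_of_eq (by norm_num))) _
  have undo : ∀ (w w' : ℕ → ℕ → ℝ≥0∞) (z : ℝ), 0 < z → (∀ a b, w' a b = L ^ (-z) * w a b) →
      V w' 0 D ≤ ((K * 9 : ℝ≥0) : ℝ≥0∞) → (V w 0 D) ^ z⁻¹ ≤ ((K * 9 : ℝ≥0) : ℝ≥0∞) ^ z⁻¹ * L := by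
    intro w w' z hz hw h
    have : V w 0 D ≤ L ^ z * V w' 0 D := by
      refine (V_mono w (fun a b => L ^ z * w' a b) 0 D fun a b _ _ _ => ?_).trans (V_const_mul _ _ _ _)
      rw [hw, ← mul_assoc, ← ENNReal.rpow_add _ _ hL0 hLt]
      simp
    calc (V w 0 D) ^ z⁻¹ ≤ (L ^ z * ((K * 9 : ℝ≥0) : ℝ≥0∞)) ^ z⁻¹ :=
          ENNReal.rpow_le_rpow (this.trans (mul_le_mul_right h _)) (by positivity)
      _ = _ := by
          rw [ENNReal.mul_rpow_of_nonneg _ _ (by positivity), ENNReal.rpow_rpow_inv hz.ne', mul_comm]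
  have u1 := undo (wF r1 f) _ (r1/p) (by positivity) (fun a b => by
    rw [wF, dF_smul, enorm_mul, ENNReal.mul_rpow_of_nonneg _ _ hr1.le, nxr]; rfl) (c1.trans hK9)
  have u2 := undo (wP t f g) _ ρ hρ0 (fun a b => by
    rw [wP, dP_smul, enorm_mul _ (dP f g a b), ENNReal.mul_rpow_of_nonneg _ _ ht0.le, nxy]; rfl) (c2.trans hK9)
  rw [inv_div] at u1
  refine (add_le_add u1 u2).trans (le_of_eq ?_)
  rw [ENNReal.coe_add, ENNReal.coe_rpow_of_nonneg _ (by positivity), ENNReal.coe_rpow_of_nonneg _ (by positivity), add_mul]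

end BVP

namespace BVP

lemma geo_sum (β : ℝ) (h0 : 0 ≤ β) (h1 : β < 1) : ∑' z : ℤ, ENNReal.ofReal (β ^ z.natAbs) ≠ ∞ := by
  have hs : Summable fun z : ℤ => β ^ z.natAbs := by
    refine Summable.of_nat_of_neg ?_ ?_
    · simpa using summable_geometric_of_lt_one h0 h1
    · simpa using summable_geometric_of_lt_one h0 h1
  rw [← ENNReal.ofReal_tsum_of_nonneg (fun z => by positivity) hs]
  exact ENNReal.ofReal_ne_top

lemma conv_bound (w : ℤ → ℝ≥0∞) (r : ℝ) (hr : 1 ≤ r) (I J : Finset ℤ) (b : ℤ → ℝ≥0∞) :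
    ∑ n ∈ J, (∑ i ∈ I, w (n - i) * b i) ^ r ≤ (∑' z, w z) ^ r * ∑ i ∈ I, b i ^ r := by
  set K := ∑' z, w z with hK
  have hr0 : 0 < r := by linarith
  have s1 : ∀ n, ∑ i ∈ I, w (n - i) ≤ K := fun n =>
    (ENNReal.sum_le_tsum I).trans (ENNReal.tsum_comp_le_tsum_of_injective (sub_right_injective (b := n)) w)
  have s2 : ∀ i, ∑ n ∈ J, w (n - i) ≤ K := fun i =>
    (ENNReal.sum_le_tsum (f := fun n => w (n - i)) J).trans
      (ENNReal.tsum_comp_le_tsum_of_injective (sub_left_injective (b := i)) w)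
  have h1 : ∀ n, (∑ i ∈ I, w (n - i) * b i) ^ r ≤ K ^ (r - 1) * ∑ i ∈ I, w (n - i) * b i ^ r := by
    intro n
    have := ENNReal.inner_le_weight_mul_Lp_of_nonneg I hr (fun i => w (n - i)) b
    calc _ ≤ ((∑ i ∈ I, w (n - i)) ^ (1 - r⁻¹) * (∑ i ∈ I, w (n - i) * b i ^ r) ^ r⁻¹) ^ r :=
          ENNReal.rpow_le_rpow this hr0.le
      _ = (∑ i ∈ I, w (n - i)) ^ (r - 1) * ∑ i ∈ I, w (n - i) * b i ^ r := by
          rw [ENNReal.mul_rpow_of_nonneg _ _ hr0.le, ENNReal.rpow_inv_rpow hr0.ne', ← ENNReal.rpow_mul]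
          congr 2
          field_simp
      _ ≤ _ := mul_le_mul_left (ENNReal.rpow_le_rpow (s1 n) (by linarith)) _
  calc _ ≤ ∑ n ∈ J, K ^ (r - 1) * ∑ i ∈ I, w (n - i) * b i ^ r := Finset.sum_le_sum fun n _ => h1 n
    _ = K ^ (r - 1) * ∑ i ∈ I, (∑ n ∈ J, w (n - i)) * b i ^ r := by
        rw [← Finset.mul_sum, Finset.sum_comm]
        simp only [Finset.sum_mul]
    _ ≤ K ^ (r - 1) * ∑ i ∈ I, K * b i ^ r :=
        mul_le_mul_right (Finset.sum_le_sum fun i _ => mul_le_mul_left (s2 i) _) _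
    _ = K ^ (r - 1) * K * ∑ i ∈ I, b i ^ r := by rw [← Finset.mul_sum, mul_assoc]
    _ = _ := by
        have := ENNReal.rpow_add_of_nonneg (x := K) (r - 1) 1 (by linarith) (by norm_num)
        rw [sub_add_cancel, ENNReal.rpow_one] at this
        rw [this]

/-- truncated family, reindexed by `ℕ` -/
def fc (f : ℤ → SchwartzMap ℝ ℂ) (n0 : ℤ) (x : ℝ) (j : ℕ) : ℂ := f (n0 + j + 1) x
/-- truncated sum -/
def Fs (f : ℤ → SchwartzMap ℝ ℂ) (n0 : ℤ) (D : ℕ) (x : ℝ) : ℂ := ∑ i ∈ Finset.range D, f (n0 + i + 1) x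
/-- martingale differences -/
def dd (f : ℤ → SchwartzMap ℝ ℂ) (n0 : ℤ) (D : ℕ) (j : ℕ) (x : ℝ) : ℂ :=
  En (n0 + j + 1) (Fs f n0 D) x - En (n0 + j) (Fs f n0 D) x
/-- errors -/
def ph (f : ℤ → SchwartzMap ℝ ℂ) (n0 : ℤ) (D : ℕ) (x : ℝ) (n : ℕ) : ℂ :=
  ∑ i ∈ Finset.range n, f (n0 + i + 1) x - En (n0 + n) (Fs f n0 D) x

lemma fc_eq (f : ℤ → SchwartzMap ℝ ℂ) (n0 : ℤ) (D : ℕ) (x : ℝ) (j : ℕ) :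
    fc f n0 x j = dd f n0 D j x + (ph f n0 D x (j+1) - ph f n0 D x j) := by
  unfold fc dd ph
  rw [Finset.sum_range_succ]
  push_cast
  rw [← add_assoc]
  ring

lemma Fs_cont (f : ℤ → SchwartzMap ℝ ℂ) (n0 : ℤ) (D : ℕ) : Continuous (Fs f n0 D) :=
  continuous_finset_sum _ fun _ _ => SchwartzMap.continuous _

lemma dd_meas (f : ℤ → SchwartzMap ℝ ℂ) (n0 : ℤ) (D j : ℕ) : Measurable (dd f n0 D j) :=
  (En_meas _ _).sub (En_meas _ _)

lemma dd_mart (f : ℤ → SchwartzMap ℝ ℂ) (n0 : ℤ) (D : ℕ) :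
    Mart (fun n : ℕ => sw (n0 + n)) (dd f n0 D) := by
  constructor
  · intro n x i hi
    unfold dd
    have e1 : n0 + (i:ℤ) + 1 = n0 + n - ((n - i - 1 : ℕ) : ℤ) := by omega
    have e2 : n0 + (i:ℤ) = n0 + n - ((n - i : ℕ) : ℤ) := by omega
    rw [e1, e2, En_sw_coarse, En_sw_coarse]
  · intro n x
    unfold dd
    have h1 := En_sw (n0 + n) (Fs f n0 D) (Fs_cont f n0 D) x
    have h2 := En_sw_coarse (n0 + n) 0 (Fs f n0 D) x
    simp only [Nat.cast_zero, sub_zero] at h2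
    rw [h2]
    linear_combination h1

lemma ph_bound (Nb κ u : ℝ) (hκ : 1 < κ) (hκu : κ < u) (hκ2 : κ ≤ 2) (r : ℝ) (hr : 1 ≤ r) :
    ∃ C : ℝ≥0, ∀ f : ℤ → SchwartzMap ℝ ℂ, (∀ i, Band Nb i (f i)) → ∀ (n0 : ℤ) (D : ℕ) (x : ℝ),
      ∑ j ∈ Finset.range D, ‖fc f n0 x j‖ₑ ^ r ≤
        C * ∑ j ∈ Finset.range D, bb κ u (n0 + j + 1) (f (n0 + j + 1)) x ^ r ∧
      ∑ j ∈ Finset.range (D+1), ‖ph f n0 D x j‖ₑ ^ r ≤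
        C * ∑ j ∈ Finset.range D, bb κ u (n0 + j + 1) (f (n0 + j + 1)) x ^ r ∧
      ∑ j ∈ Finset.range D, ‖dd f n0 D j x‖ₑ ^ r ≤
        C * ∑ j ∈ Finset.range D, bb κ u (n0 + j + 1) (f (n0 + j + 1)) x ^ r := by
  obtain ⟨C, hC1, hC⟩ := lp_est Nb κ u hκ hκu hκ2
  have hr0 : 0 < r := by linarith
  set β : ℝ := (2:ℝ) ^ (-(1 - κ / u)) with hβ
  have hβ0 : 0 ≤ β := by positivity
  have hβ1 : β < 1 := by
    refine Real.rpow_lt_one_of_one_lt_of_neg (by norm_num) ?_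
    have : κ / u < 1 := by rw [div_lt_one (by linarith)]; exact hκu
    linarith
  have hg := geo_sum β hβ0 hβ1
  set K := ∑' z : ℤ, ENNReal.ofReal (β ^ z.natAbs) with hK
  have hCr : (C:ℝ≥0∞) ^ r ≠ ∞ := ENNReal.rpow_ne_top_of_nonneg hr0.le ENNReal.coe_ne_top
  have hKr : K ^ r ≠ ∞ := ENNReal.rpow_ne_top_of_nonneg hr0.le hg
  have h2r : (2:ℝ≥0∞) ^ r ≠ ∞ := ENNReal.rpow_ne_top_of_nonneg hr0.le (by norm_num)
  set M1 : ℝ≥0∞ := (C:ℝ≥0∞) ^ r with hM1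
  set M2 : ℝ≥0∞ := (C:ℝ≥0∞) ^ r * K ^ r with hM2
  set M3 : ℝ≥0∞ := 2 ^ r * 2 ^ r * (M1 + M2 + M2) with hM3
  have hM2t : M2 ≠ ∞ := ENNReal.mul_ne_top hCr hKr
  have hM3t : M3 ≠ ∞ := ENNReal.mul_ne_top (ENNReal.mul_ne_top h2r h2r) (ENNReal.add_ne_top.2 ⟨ENNReal.add_ne_top.2 ⟨hCr, hM2t⟩, hM2t⟩)
  have hMt : M1 + M2 + M3 ≠ ∞ := ENNReal.add_ne_top.2 ⟨ENNReal.add_ne_top.2 ⟨hCr, hM2t⟩, hM3t⟩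
  refine ⟨(M1 + M2 + M3).toNNReal, fun f hf n0 D x => ?_⟩
  rw [ENNReal.coe_toNNReal hMt]
  set B := ∑ j ∈ Finset.range D, bb κ u (n0 + j + 1) (f (n0 + j + 1)) x ^ r with hB
  have q1 : ∑ j ∈ Finset.range D, ‖fc f n0 x j‖ₑ ^ r ≤ M1 * B := by
    rw [hB, Finset.mul_sum]
    refine Finset.sum_le_sum fun j _ => ?_
    rw [hM1, ← ENNReal.mul_rpow_of_nonneg _ _ hr0.le]
    exact ENNReal.rpow_le_rpow (hC _ _ (hf _) x).1 hr0.le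
  have q2 : ∑ j ∈ Finset.range (D+1), ‖ph f n0 D x j‖ₑ ^ r ≤ M2 * B := by
    set sh : ℕ ↪ ℤ := ⟨fun j => n0 + j + 1, fun a b h => by simpa using h⟩ with hsh
    set sh' : ℕ ↪ ℤ := ⟨fun j => n0 + j, fun a b h => by simpa using h⟩ with hsh'
    have cb := conv_bound (fun z => ENNReal.ofReal (β ^ z.natAbs)) r hr ((Finset.range D).map sh)
      ((Finset.range (D+1)).map sh') (fun i => bb κ u i (f i) x)
    simp only [Finset.sum_map] at cb
    change _ ≤ K ^ r * B at cb
    have each : ∀ j ∈ Finset.range (D+1), ‖ph f n0 D x j‖ₑ ^ r ≤ (C:ℝ≥0∞) ^ r *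
        (∑ i ∈ Finset.range D, ENNReal.ofReal (β ^ (sh' j - sh i).natAbs) * bb κ u (sh i) (f (sh i)) x) ^ r := by
      intro n hn
      have hnD : n ≤ D := by simpa [Nat.lt_succ_iff] using hn
      rw [← ENNReal.mul_rpow_of_nonneg _ _ hr0.le]
      refine ENNReal.rpow_le_rpow ?_ hr0.le
      have e : ph f n0 D x n = ∑ i ∈ Finset.range D, ((if i < n then f (n0 + i + 1) x else 0) -
          En (n0 + n) (f (n0 + i + 1)) x) := by
        unfold ph Fs
        rw [En_sum _ _ (fun i : ℕ => ⇑(f (n0 + i + 1))) (fun i => SchwartzMap.continuous _), Finset.sum_sub_distrib,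
          ← Finset.sum_filter]
        congr 2
        ext i
        simp only [Finset.mem_range, Finset.mem_filter]
        omega
      rw [e, Finset.mul_sum]
      refine (enorm_sum_le _ _).trans (Finset.sum_le_sum fun i _ => ?_)
      rw [← mul_assoc]
      have hh := (hC _ _ (hf (n0 + i + 1)) x).2 (n0 + n)
      split_ifs with hi
      · exact hh.1 (by omega)
      · rw [zero_sub, enorm_neg]
        exact hh.2 (by omega)
    calc _ ≤ _ := Finset.sum_le_sum each
      _ ≤ M2 * B := by
          rw [← Finset.mul_sum, hM2, mul_assoc]
          exact mul_le_mul_right cb _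
  have q3 : ∑ j ∈ Finset.range D, ‖dd f n0 D j x‖ₑ ^ r ≤ M3 * B := by
    have each : ∀ j, ‖dd f n0 D j x‖ₑ ^ r ≤ 2 ^ r * 2 ^ r *
        (‖fc f n0 x j‖ₑ ^ r + ‖ph f n0 D x (j+1)‖ₑ ^ r + ‖ph f n0 D x j‖ₑ ^ r) := by
      intro j
      have e : dd f n0 D j x = fc f n0 x j - ph f n0 D x (j+1) + ph f n0 D x j := by
        rw [fc_eq f n0 D]; ring
      refine le_trans (ENNReal.rpow_le_rpow ?_ hr0.le) (add3_rpow hr0 _ _ _)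
      rw [e]
      exact (enorm_add_le _ _).trans (add_le_add_left enorm_sub_le _)
    calc _ ≤ ∑ j ∈ Finset.range D, 2 ^ r * 2 ^ r *
        (‖fc f n0 x j‖ₑ ^ r + ‖ph f n0 D x (j+1)‖ₑ ^ r + ‖ph f n0 D x j‖ₑ ^ r) := Finset.sum_le_sum fun j _ => each j
      _ = 2 ^ r * 2 ^ r * (∑ j ∈ Finset.range D, ‖fc f n0 x j‖ₑ ^ r +
          ∑ j ∈ Finset.range D, ‖ph f n0 D x (j+1)‖ₑ ^ r + ∑ j ∈ Finset.range D, ‖ph f n0 D x j‖ₑ ^ r) := by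
          rw [← Finset.mul_sum, Finset.sum_add_distrib, Finset.sum_add_distrib]
      _ ≤ 2 ^ r * 2 ^ r * (M1 * B + M2 * B + M2 * B) := by
          refine mul_le_mul_right (add_le_add (add_le_add q1 ?_) ?_) _
          · refine le_trans ?_ q2
            rw [Finset.sum_range_succ']
            exact le_self_add
          · refine le_trans ?_ q2
            rw [Finset.sum_range_succ]
            exact le_self_add
      _ = M3 * B := by rw [hM3]; ring
  refine ⟨q1.trans (mul_le_mul_left ?_ _), q2.trans (mul_le_mul_left ?_ _), q3.trans (mul_le_mul_left ?_ _)⟩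
  · rw [add_assoc]; exact le_self_add
  · rw [add_right_comm]; exact le_add_self
  · exact le_add_self

end BVP

namespace BVP

lemma fc_meas (f : ℤ → SchwartzMap ℝ ℂ) (n0 : ℤ) (j : ℕ) : Measurable fun x => fc f n0 x j :=
  (f _).continuous.measurable

lemma Sfc_meas (f : ℤ → SchwartzMap ℝ ℂ) (n0 : ℤ) (D : ℕ) (r : ℝ) :
    Measurable fun x => ∑ j ∈ Finset.range D, ‖fc f n0 x j‖ₑ ^ r :=
  Finset.measurable_fun_sum _ fun j _ => (fc_meas f n0 j).enorm.pow_const _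

lemma ph_meas (f : ℤ → SchwartzMap ℝ ℂ) (n0 : ℤ) (D n : ℕ) : Measurable fun x => ph f n0 D x n :=
  (Finset.measurable_fun_sum _ fun _ _ => (SchwartzMap.continuous _).measurable).sub (En_meas _ _)

lemma bb_FS (p r κ u : ℝ) (hκ : 1 < κ) (hu : 1 < u) (hur : u < r) (hup : u < p) :
    ∃ C : ℝ≥0, ∀ (f : ℤ → SchwartzMap ℝ ℂ) (n0 : ℤ) (D : ℕ),
      ∫⁻ x, (∑ j ∈ Finset.range D, bb κ u (n0 + j + 1) (f (n0 + j + 1)) x ^ r) ^ (p/r) ≤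
        C * ∫⁻ x, (∑ j ∈ Finset.range D, ‖fc f n0 x j‖ₑ ^ r) ^ (p/r) := by
  have hu0 : 0 < u := by linarith
  have hr0 : 0 < r := by linarith
  obtain ⟨C, -, hC⟩ := FS κ hκ (r/u) (p/u) (by rwa [one_lt_div hu0]) (by rwa [one_lt_div hu0])
  refine ⟨C, fun f n0 D => ?_⟩
  have inj : Function.Injective (fun j : ℕ => n0 + (j:ℤ) + 1) := by
    intro a b h
    simp only at h
    omega
  have := hC ((Finset.range D).map ⟨_, inj⟩) (fun i x => ‖f i x‖ₑ ^ u)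
    (fun i => (f i).continuous.enorm.measurable.pow_const u)
    (fun i x => ENNReal.rpow_ne_top_of_nonneg hu0.le enorm_ne_top)
  have e1 : p / u / (r / u) = p / r := by field_simp
  simp only [Finset.sum_map, Function.Embedding.coeFn_mk, e1] at this
  have e2 : ∀ (i : ℤ) x, bb κ u i (f i) x ^ r = cv κ i (fun x => ‖f i x‖ₑ ^ u) x ^ (r / u) := by
    intro i x
    unfold bb
    rw [← ENNReal.rpow_mul]
    congr 1
    field_simp
  have e3 : ∀ x (j : ℕ), ‖fc f n0 x j‖ₑ ^ r = (‖f (n0 + j + 1) x‖ₑ ^ u) ^ (r / u) := by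
    intro x j
    unfold fc
    rw [← ENNReal.rpow_mul]
    congr 1
    field_simp
  simp only [e2, e3]
  exact this

lemma lint_le {h k : ℝ → ℝ≥0∞} {c : ℝ≥0} {z : ℝ} (hz : 0 ≤ z) (hh : ∀ x, h x ≤ c * k x) :
    ∫⁻ x, h x ^ z ≤ (c:ℝ≥0∞) ^ z * ∫⁻ x, k x ^ z := by
  rw [← lintegral_const_mul' _ _ (ENNReal.rpow_ne_top_of_nonneg hz ENNReal.coe_ne_top)]
  refine lintegral_mono fun x => ?_
  simp only
  rw [← ENNReal.mul_rpow_of_nonneg _ _ hz]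
  exact ENNReal.rpow_le_rpow (hh x) hz

lemma famC (p r Nb : ℝ) (hp : 1 < p) (hr : 1 < r) :
    ∃ C : ℝ≥0, ∀ f : ℤ → SchwartzMap ℝ ℂ, (∀ i, Band Nb i (f i)) → ∀ (n0 : ℤ) (D : ℕ),
      ∫⁻ x, (∑ j ∈ Finset.range (D+1), ‖ph f n0 D x j‖ₑ ^ r) ^ (p/r) ≤
        C * ∫⁻ x, (∑ j ∈ Finset.range D, ‖fc f n0 x j‖ₑ ^ r) ^ (p/r) ∧
      ∫⁻ x, (∑ j ∈ Finset.range D, ‖dd f n0 D j x‖ₑ ^ r) ^ (p/r) ≤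
        C * ∫⁻ x, (∑ j ∈ Finset.range D, ‖fc f n0 x j‖ₑ ^ r) ^ (p/r) := by
  obtain ⟨m, hm1, hmp, hmr, hm2⟩ : ∃ m : ℝ, 1 < m ∧ m ≤ p ∧ m ≤ r ∧ m ≤ 2 :=
    ⟨min 2 (min p r), by simp [hp, hr], by simp, by simp, by simp⟩
  obtain ⟨C1, h1⟩ := bb_FS p r ((3+m)/4) ((1+m)/2) (by linarith) (by linarith) (by linarith) (by linarith)
  obtain ⟨C2, h2⟩ := ph_bound Nb ((3+m)/4) ((1+m)/2) (by linarith) (by linarith) (by linarith) r hr.le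
  have hz : 0 ≤ p / r := by positivity
  refine ⟨C2 ^ (p/r) * C1, fun f hf n0 D => ?_⟩
  have e : ((C2 ^ (p/r) * C1 : ℝ≥0) : ℝ≥0∞) = (C2:ℝ≥0∞) ^ (p/r) * C1 := by
    rw [ENNReal.coe_mul, ENNReal.coe_rpow_of_nonneg _ hz]
  rw [e, mul_assoc]
  exact ⟨(lint_le hz fun x => (h2 f hf n0 D x).2.1).trans (mul_le_mul_right (h1 f n0 D) _),
    (lint_le hz fun x => (h2 f hf n0 D x).2.2).trans (mul_le_mul_right (h1 f n0 D) _)⟩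

lemma thmT {r s r1 s1 t : ℝ} (hx : Exps r s r1 s1 t) (hr : 1 < r) (hs : 1 < s) (p q Nb : ℝ)
    (hp : 1 < p) (hq : 1 < q) : ∃ C : ℝ≥0, ∀ f g : ℤ → SchwartzMap ℝ ℂ, (∀ i, Band Nb i (f i)) →
    (∀ i, Band Nb i (g i)) → ∀ (n0 : ℤ) (D : ℕ),
    ∫⁻ x, ((V (wF r1 (fc f n0 x)) 0 D) ^ (p/r1) +
      (V (wP t (fc f n0 x) (fc g n0 x)) 0 D) ^ (t * (1/p+1/q))⁻¹) ≤
    C * ((∫⁻ x, (∑ j ∈ Finset.range D, ‖fc f n0 x j‖ₑ ^ r) ^ (p/r)) +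
      ∫⁻ x, (∑ j ∈ Finset.range D, ‖fc g n0 x j‖ₑ ^ s) ^ (q/s)) := by
  have hp0 : 0 < p := by linarith
  have hq0 : 0 < q := by linarith
  obtain ⟨K, -, hK⟩ := pw_final hx p q hp0 hq0
  obtain ⟨Cm, hCm⟩ := mart_main hx p q hp0 hq0
  obtain ⟨Cf, hCf⟩ := famC p r Nb hp hr
  obtain ⟨Cg, hCg⟩ := famC q s Nb hq hs
  refine ⟨K * ((1 + Cf + Cg + Cg) + Cm * (Cf + Cg)), fun f g hf hg n0 D => ?_⟩
  obtain ⟨f1, f2⟩ := hCf f hf n0 D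
  obtain ⟨g1, g2⟩ := hCg g hg n0 D
  have hm := hCm (volume : Measure ℝ) (fun n : ℕ => sw (n0 + n)) (fun n => sw_mp _)
    (dd f n0 D) (dd g n0 D) (dd_meas f n0 D) (dd_meas g n0 D) (dd_mart f n0 D) (dd_mart g n0 D) D
  have hpw := fun x => hK (fc f n0 x) (fun j => dd f n0 D j x) (ph f n0 D x)
    (fc g n0 x) (fun j => dd g n0 D j x) (ph g n0 D x) (fun j => fc_eq f n0 D x j)
    (fun j => fc_eq g n0 D x j) D
  have m1 := (Sfc_meas f n0 D r).pow_const (p/r)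
  have m2 : Measurable fun x => (∑ j ∈ Finset.range (D+1), ‖ph f n0 D x j‖ₑ ^ r) ^ (p/r) :=
    (Finset.measurable_fun_sum _ fun j _ => (ph_meas f n0 D j).enorm.pow_const r).pow_const (p/r)
  have m3 : Measurable fun x => (∑ j ∈ Finset.range D, ‖dd g n0 D j x‖ₑ ^ s) ^ (q/s) :=
    (Finset.measurable_fun_sum _ fun j _ => (dd_meas g n0 D j).enorm.pow_const s).pow_const (q/s)
  have m4 : Measurable fun x => (∑ j ∈ Finset.range (D+1), ‖ph g n0 D x j‖ₑ ^ s) ^ (q/s) :=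
    (Finset.measurable_fun_sum _ fun j _ => (ph_meas g n0 D j).enorm.pow_const s).pow_const (q/s)
  refine (lintegral_mono hpw).trans ?_
  rw [lintegral_const_mul' _ _ ENNReal.coe_ne_top]
  rw [lintegral_add_left (((m1.fun_add m2).fun_add m3).fun_add m4), lintegral_add_left ((m1.fun_add m2).fun_add m3),
    lintegral_add_left (m1.fun_add m2), lintegral_add_left m1]
  set X := ∫⁻ x, (∑ j ∈ Finset.range D, ‖fc f n0 x j‖ₑ ^ r) ^ (p/r)
  set Y := ∫⁻ x, (∑ j ∈ Finset.range D, ‖fc g n0 x j‖ₑ ^ s) ^ (q/s)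
  push_cast
  rw [mul_assoc]
  refine mul_le_mul_right ?_ _
  calc _ ≤ X + Cf * X + Cg * Y + Cg * Y + Cm * (Cf * X + Cg * Y) := by
        refine add_le_add (add_le_add (add_le_add (add_le_add le_rfl f1) g2) g1) (hm.trans ?_)
        exact mul_le_mul_right (add_le_add f2 g2) _
    _ ≤ X + Cf * X + Cg * Y + Cg * Y + Cm * (Cf * X + Cg * Y) +
        (Y + Cf * Y + Cg * X + Cg * X + Cm * (Cg * X + Cf * Y)) := le_self_add
    _ = _ := by ring

lemma V_meas_F (f : ℤ → SchwartzMap ℝ ℂ) (n0 : ℤ) (D : ℕ) (r : ℝ) :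
    Measurable fun x => V (wF r (fc f n0 x)) 0 D := by
  refine V_measurable _ (fun i j => ?_) 0 D
  unfold wF dF
  exact (Finset.measurable_fun_sum _ fun j _ => fc_meas f n0 j).enorm.pow_const _

lemma V_meas_P (f g : ℤ → SchwartzMap ℝ ℂ) (n0 : ℤ) (D : ℕ) (t : ℝ) :
    Measurable fun x => V (wP t (fc f n0 x) (fc g n0 x)) 0 D := by
  refine V_measurable _ (fun i j => ?_) 0 D
  unfold wP dP dF
  exact (Finset.measurable_fun_sum _ fun j _ =>
    (Finset.measurable_fun_sum _ fun j _ => fc_meas f n0 j).mul (fc_meas g n0 j)).enorm.pow_const _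

/-- linear variational bound -/
lemma linV (ρ : ℝ) (h1 : 1 ≤ ρ) (h2 : ρ < 2) (p Nb : ℝ) (hp : 1 < p) :
    ∃ C : ℝ≥0, ∀ f : ℤ → SchwartzMap ℝ ℂ, (∀ i, Band Nb i (f i)) → ∀ (n0 : ℤ) (D : ℕ),
    ∫⁻ x, (V (wF ρ (fc f n0 x)) 0 D) ^ (p/ρ) ≤
    C * ∫⁻ x, (∑ j ∈ Finset.range D, ‖fc f n0 x j‖ₑ ^ ρ) ^ (p/ρ) := by
  rcases h1.eq_or_lt with rfl | h1
  · refine ⟨1, fun f hf n0 D => ?_⟩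
    rw [ENNReal.coe_one, one_mul]
    refine lintegral_mono fun x => ENNReal.rpow_le_rpow ?_ (by positivity)
    refine V_le _ 0 D (fun n => ∑ j ∈ Finset.range n, ‖fc f n0 x j‖ₑ ^ (1:ℝ)) (fun j n _ h _ => ?_) D le_rfl
    simp only [ENNReal.rpow_one, wF, dF]
    rw [← Finset.sum_range_add_sum_Ico _ h.le]
    exact add_le_add le_rfl (enorm_sum_le _ _)
  · have hx : Exps ρ ρ ρ ρ (ρ/2) := ⟨by linarith, h2.le, le_rfl, h2.ne, by linarith, h2.le, le_rfl, h2.ne,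
      by linarith, by field_simp; norm_num⟩
    obtain ⟨C, hC⟩ := thmT hx h1 h1 p p Nb hp hp
    refine ⟨C * 2, fun f hf n0 D => ?_⟩
    refine (lintegral_mono fun x => le_self_add).trans ((hC f f hf hf n0 D).trans (le_of_eq ?_))
    push_cast
    rw [← two_mul, mul_assoc]

end BVP

namespace BVP

lemma hold2 (α β : ℝ) (hα : 0 < α) (hβ : 0 < β) (h : α + β = 1) (x y z w : ℝ≥0∞) :
    x ^ α * y ^ β + z ^ α * w ^ β ≤ (x + z) ^ α * (y + w) ^ β := by
  have hc : (1/α).HolderConjugate (1/β) := by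
    rw [Real.holderConjugate_iff]
    refine ⟨by rw [lt_div_iff₀ hα]; linarith, by simpa using h⟩
  have := ENNReal.inner_le_Lp_mul_Lq Finset.univ ![x ^ α, z ^ α] ![y ^ β, w ^ β] hc
  simpa [Fin.sum_univ_two, ENNReal.rpow_rpow_inv hα.ne', ENNReal.rpow_rpow_inv hβ.ne'] using this

lemma V_hold (w A B : ℕ → ℕ → ℝ≥0∞) (α β : ℝ) (hα : 0 < α) (hβ : 0 < β) (h : α + β = 1)
    (hA : ∀ j n, j ≤ n → A 0 j + A j n ≤ A 0 n) (hB : ∀ j n, j ≤ n → B 0 j + B j n ≤ B 0 n)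
    (hw : ∀ j n, j ≤ n → w j n ≤ A j n ^ α * B j n ^ β) (D : ℕ) :
    V w 0 D ≤ A 0 D ^ α * B 0 D ^ β := by
  refine V_le w 0 D (fun n => A 0 n ^ α * B 0 n ^ β) (fun j n _ h2 _ => ?_) D le_rfl
  calc _ ≤ A 0 j ^ α * B 0 j ^ β + A j n ^ α * B j n ^ β := add_le_add le_rfl (hw j n h2.le)
    _ ≤ (A 0 j + A j n) ^ α * (B 0 j + B j n) ^ β := hold2 α β hα hβ h _ _ _ _
    _ ≤ _ := mul_le_mul' (ENNReal.rpow_le_rpow (hA j n h2.le) hα.le)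
      (ENNReal.rpow_le_rpow (hB j n h2.le) hβ.le)

lemma pw_spec (A B : ℕ → ℕ → ℝ≥0∞) (F G : ℕ → ℂ) (r s t p q : ℝ) (hr : 0 < r) (hs : 0 < s)
    (ht : 0 < t) (h : 1/t = 1/r + 1/s) (hp : 0 < p) (hq : 0 < q)
    (hA : ∀ j n, j ≤ n → A 0 j + A j n ≤ A 0 n) (hB : ∀ j n, j ≤ n → B 0 j + B j n ≤ B 0 n)
    (hw : ∀ j n, j ≤ n → ‖dP F G j n‖ₑ ≤ A j n ^ (1/r) * B j n ^ (1/s)) (D : ℕ) :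
    V (wP t F G) 0 D ^ (t * (1/p+1/q))⁻¹ ≤ A 0 D ^ (p/r) + B 0 D ^ (q/s) := by
  have hts : t / r + t / s = 1 := by
    have : t * (1/t) = t * (1/r+1/s) := by rw [h]
    rw [mul_one_div_cancel ht.ne'] at this
    rw [this]; ring
  have h1 := V_hold (wP t F G) A B (t/r) (t/s) (by positivity) (by positivity) hts hA hB
    (fun j n hj => by
      refine (ENNReal.rpow_le_rpow (hw j n hj) ht.le).trans (le_of_eq ?_)
      rw [ENNReal.mul_rpow_of_nonneg _ _ ht.le, ← ENNReal.rpow_mul, ← ENNReal.rpow_mul]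
      congr 2 <;> ring) D
  have hP : 0 < (1/p+1/q)⁻¹ := by positivity
  calc _ ≤ (A 0 D ^ (t/r) * B 0 D ^ (t/s)) ^ (t * (1/p+1/q))⁻¹ := ENNReal.rpow_le_rpow h1 (by positivity)
    _ = (A 0 D ^ (1/r) * B 0 D ^ (1/s)) ^ (1/p+1/q)⁻¹ := by
        rw [ENNReal.mul_rpow_of_nonneg _ _ (by positivity), ENNReal.mul_rpow_of_nonneg _ _ hP.le]
        simp only [← ENNReal.rpow_mul]
        congr 2 <;> field_simp
    _ ≤ (A 0 D ^ (1/r)) ^ p + (B 0 D ^ (1/s)) ^ q :=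
        young p q _ hp hq hP (by simp) _ _
    _ = _ := by
        simp only [← ENNReal.rpow_mul]
        congr 2 <;> field_simp

lemma dF_le_V (s : ℝ) (hs : 0 < s) (G : ℕ → ℂ) {a i b c : ℕ} (h1 : a ≤ i) (h2 : i ≤ b) (h3 : b ≤ c) :
    ‖dF G i b‖ₑ ≤ V (wF s G) a c ^ (1/s) := by
  rcases h2.eq_or_lt with rfl | h2
  · simp
  have : ‖dF G i b‖ₑ ^ s ≤ V (wF s G) a c := calc
    _ ≤ V (wF s G) i b := le_V (wF s G) h2
    _ ≤ V (wF s G) a b := le_trans le_add_self (V_chain _ h1 b h2.le)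
    _ ≤ _ := V_mono_right _ (h1.trans h2.le) h3
  rw [one_div, ENNReal.le_rpow_inv_iff hs]
  exact this

lemma dP_swap (F G : ℕ → ℂ) {a b : ℕ} (h : a ≤ b) :
    dP F G a b = ∑ i ∈ Finset.Ico a b, F i * dF G (i+1) b := by
  induction b, h using Nat.le_induction with
  | base => simp
  | succ b h ih =>
    rw [dP_succ F G h, Finset.sum_Ico_succ_top h, ih, dF_self, mul_zero, add_zero]
    have : ∀ i ∈ Finset.Ico a b, F i * dF G (i+1) (b+1) = F i * dF G (i+1) b + F i * G b := by
      intro i hi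
      rw [dF_succ G (Finset.mem_Ico.1 hi).2, mul_add]
    rw [Finset.sum_congr rfl this, Finset.sum_add_distrib, ← Finset.sum_mul]
    rfl

lemma dP_spec1 (s : ℝ) (hs : 0 < s) (F G : ℕ → ℂ) {a b : ℕ} (h : a ≤ b) :
    ‖dP F G a b‖ₑ ≤ (∑ i ∈ Finset.Ico a b, ‖F i‖ₑ) * V (wF s G) a b ^ (1/s) := by
  rw [dP_swap F G h, Finset.sum_mul]
  refine (enorm_sum_le _ _).trans (Finset.sum_le_sum fun i hi => ?_)
  rw [enorm_mul]
  have := Finset.mem_Ico.1 hi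
  exact mul_le_mul_right (dF_le_V s hs G (by omega) (by omega) le_rfl) _

lemma dP_spec2 (r : ℝ) (hr : 0 < r) (F G : ℕ → ℂ) {a b : ℕ} :
    ‖dP F G a b‖ₑ ≤ V (wF r F) a b ^ (1/r) * (∑ i ∈ Finset.Ico a b, ‖G i‖ₑ) := by
  unfold dP
  rw [Finset.mul_sum]
  refine (enorm_sum_le _ _).trans (Finset.sum_le_sum fun i hi => ?_)
  rw [enorm_mul]
  have := Finset.mem_Ico.1 hi
  exact mul_le_mul_left (dF_le_V r hr F le_rfl (by omega) (by omega)) _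

lemma Ico_super (F : ℕ → ℝ≥0∞) (j n : ℕ) (h : j ≤ n) :
    ∑ i ∈ Finset.Ico 0 j, F i + ∑ i ∈ Finset.Ico j n, F i ≤ ∑ i ∈ Finset.Ico 0 n, F i :=
  (Finset.sum_Ico_consecutive _ (Nat.zero_le _) h).le

lemma spec1 (s t p q Nb : ℝ) (hs1 : 1 ≤ s) (hs2 : s < 2) (ht : 0 < t) (h : 1/t = 1/1 + 1/s)
    (hp : 1 < p) (hq : 1 < q) : ∃ C : ℝ≥0, ∀ f g : ℤ → SchwartzMap ℝ ℂ, (∀ i, Band Nb i (f i)) →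
    (∀ i, Band Nb i (g i)) → ∀ (n0 : ℤ) (D : ℕ),
    ∫⁻ x, (V (wP t (fc f n0 x) (fc g n0 x)) 0 D) ^ (t * (1/p+1/q))⁻¹ ≤
    C * ((∫⁻ x, (∑ j ∈ Finset.range D, ‖fc f n0 x j‖ₑ ^ (1:ℝ)) ^ (p/1)) +
      ∫⁻ x, (∑ j ∈ Finset.range D, ‖fc g n0 x j‖ₑ ^ s) ^ (q/s)) := by
  obtain ⟨C, hC⟩ := linV s hs1 hs2 q Nb hq
  refine ⟨1 + C, fun f g hf hg n0 D => ?_⟩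
  have key := fun x => pw_spec (fun a b => ∑ i ∈ Finset.Ico a b, ‖fc f n0 x i‖ₑ)
    (V (wF s (fc g n0 x))) (fc f n0 x) (fc g n0 x) 1 s t p q one_pos (by linarith) ht h
    (by linarith) (by linarith) (Ico_super _) (fun j n hj => V_chain _ (Nat.zero_le _) n hj)
    (fun j n hj => by
      rw [div_one, ENNReal.rpow_one]
      exact dP_spec1 s (by linarith) _ _ hj) D
  refine (lintegral_mono key).trans ?_
  rw [lintegral_add_right _ ((V_meas_F g n0 D s).pow_const _)]
  simp only [ENNReal.rpow_one, Nat.Ico_zero_eq_range]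
  set X := ∫⁻ x, (∑ j ∈ Finset.range D, ‖fc f n0 x j‖ₑ) ^ (p/1)
  set Y := ∫⁻ x, (∑ j ∈ Finset.range D, ‖fc g n0 x j‖ₑ ^ s) ^ (q/s)
  calc _ ≤ X + C * Y := add_le_add le_rfl (hC g hg n0 D)
    _ ≤ X + C * Y + (Y + C * X) := le_self_add
    _ = _ := by push_cast; ring

lemma spec2 (r t p q Nb : ℝ) (hr1 : 1 ≤ r) (hr2 : r < 2) (ht : 0 < t) (h : 1/t = 1/r + 1/1)
    (hp : 1 < p) (hq : 1 < q) : ∃ C : ℝ≥0, ∀ f g : ℤ → SchwartzMap ℝ ℂ, (∀ i, Band Nb i (f i)) →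
    (∀ i, Band Nb i (g i)) → ∀ (n0 : ℤ) (D : ℕ),
    ∫⁻ x, (V (wP t (fc f n0 x) (fc g n0 x)) 0 D) ^ (t * (1/p+1/q))⁻¹ ≤
    C * ((∫⁻ x, (∑ j ∈ Finset.range D, ‖fc f n0 x j‖ₑ ^ r) ^ (p/r)) +
      ∫⁻ x, (∑ j ∈ Finset.range D, ‖fc g n0 x j‖ₑ ^ (1:ℝ)) ^ (q/1)) := by
  obtain ⟨C, hC⟩ := linV r hr1 hr2 p Nb hp
  refine ⟨1 + C, fun f g hf hg n0 D => ?_⟩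
  have key := fun x => pw_spec (V (wF r (fc f n0 x))) (fun a b => ∑ i ∈ Finset.Ico a b, ‖fc g n0 x i‖ₑ)
    (fc f n0 x) (fc g n0 x) r 1 t p q (by linarith) one_pos ht h
    (by linarith) (by linarith) (fun j n hj => V_chain _ (Nat.zero_le _) n hj) (Ico_super _)
    (fun j n hj => by
      rw [div_one, ENNReal.rpow_one]
      exact dP_spec2 r (by linarith) _ _) D
  refine (lintegral_mono key).trans ?_
  rw [lintegral_add_left ((V_meas_F f n0 D r).pow_const _)]
  simp only [ENNReal.rpow_one, Nat.Ico_zero_eq_range]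
  set X := ∫⁻ x, (∑ j ∈ Finset.range D, ‖fc f n0 x j‖ₑ ^ r) ^ (p/r)
  set Y := ∫⁻ x, (∑ j ∈ Finset.range D, ‖fc g n0 x j‖ₑ) ^ (q/1)
  calc _ ≤ C * X + Y := add_le_add (hC f hf n0 D) le_rfl
    _ ≤ C * X + Y + (X + C * Y) := le_self_add
    _ = _ := by push_cast; ring

lemma ev_ne (c : ℝ) : ∀ᶠ η in nhdsWithin (0:ℝ) (Set.Ioi 0), η ≠ c := by
  by_cases hc : c = 0
  · filter_upwards [self_mem_nhdsWithin] with η hη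
    rw [hc]; exact ne_of_gt hη
  · exact mem_nhdsWithin_of_mem_nhds (isOpen_ne.mem_nhds (Ne.symm hc))

lemma thmT2 (p q r s t Nb : ℝ) (hp : 1 < p) (hq : 1 < q)
    (hr1 : 1 ≤ r) (hr2 : r ≤ 2) (hs1 : 1 ≤ s) (hs2 : s ≤ 2)
    (ht : 0 < t) (hts : 1 / t ≤ 1 / r + 1 / s)
    (hcase : max r s < 2 ∨ r * s / (r + s) < t) :
    ∃ t1 r' s' : ℝ, 0 < t1 ∧ t1 ≤ t ∧ r ≤ r' ∧ s ≤ s' ∧ 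
    ∃ C : ℝ≥0, ∀ f g : ℤ → SchwartzMap ℝ ℂ, (∀ i, Band Nb i (f i)) →
    (∀ i, Band Nb i (g i)) → ∀ (n0 : ℤ) (D : ℕ),
    ∫⁻ x, (V (wP t1 (fc f n0 x) (fc g n0 x)) 0 D) ^ (t1 * (1/p+1/q))⁻¹ ≤
    C * ((∫⁻ x, (∑ j ∈ Finset.range D, ‖fc f n0 x j‖ₑ ^ r') ^ (p/r')) +
      ∫⁻ x, (∑ j ∈ Finset.range D, ‖fc g n0 x j‖ₑ ^ s') ^ (q/s')) := by
  have hr0 : 0 < r := by linarith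
  have hs0 : 0 < s := by linarith
  rcases hts.eq_or_lt with heq | hlt
  · have hmax : max r s < 2 := by
      rcases hcase with h | h
      · exact h
      · exfalso
        have : t = r * s / (r + s) := by
          have h2 : t = (1/r+1/s)⁻¹ := by rw [← heq]; simp
          rw [h2]; field_simp; ring
        linarith
    have hr2' : r < 2 := lt_of_le_of_lt (le_max_left _ _) hmax
    have hs2' : s < 2 := lt_of_le_of_lt (le_max_right _ _) hmax
    refine ⟨t, r, s, ht, le_rfl, le_rfl, le_rfl, ?_⟩
    rcases hr1.eq_or_lt with rfl | hr1
    · exact spec1 s t p q Nb hs1 hs2' ht heq hp hq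
    rcases hs1.eq_or_lt with rfl | hs1
    · exact spec2 r t p q Nb hr1.le hr2' ht heq hp hq
    have hx : Exps r s r s t := ⟨hr0, hr2, le_rfl, hr2'.ne, hs0, hs2, le_rfl, hs2'.ne, ht, heq⟩
    obtain ⟨C, hC⟩ := thmT hx hr1 hs1 p q Nb hp hq
    exact ⟨C, fun f g hf hg n0 D => (lintegral_mono fun x => le_add_self).trans (hC f g hf hg n0 D)⟩
  · have hcont : ContinuousAt (fun η : ℝ => 1/(r+η) + 1/(s+η)) 0 := by
      have a1 : r + 0 ≠ 0 := by simpa using hr0.ne'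
      have a2 : s + 0 ≠ 0 := by simpa using hs0.ne'
      fun_prop (disch := assumption)
    have hev : ∀ᶠ η in nhdsWithin (0:ℝ) (Set.Ioi 0), 1/t < 1/(r+η) + 1/(s+η) := by
      refine Filter.Eventually.filter_mono nhdsWithin_le_nhds ?_
      exact hcont.eventually_const_lt (by simpa using hlt)
    obtain ⟨η, h1, h2, h3, h4⟩ := ((hev.and ((ev_ne (2-r)).and ((ev_ne (2-s)).and
      self_mem_nhdsWithin)))).exists
    have h4 : 0 < η := h4
    have hT : 0 < 1/(r+η) + 1/(s+η) := by positivity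
    have hx : Exps (min (r+η) 2) (min (s+η) 2) (r+η) (s+η) (1/(r+η) + 1/(s+η))⁻¹ :=
      ⟨lt_min (by linarith) two_pos, min_le_right _ _, min_le_left _ _, fun h => h2 (by linarith),
       lt_min (by linarith) two_pos, min_le_right _ _, min_le_left _ _, fun h => h3 (by linarith),
       by positivity, by simp⟩
    refine ⟨_, min (r+η) 2, min (s+η) 2, hx.t0, ?_, le_min (by linarith) hr2, le_min (by linarith) hs2, ?_⟩
    · rw [inv_le_comm₀ hT ht, ← one_div]
      exact h1.le
    obtain ⟨C, hC⟩ := thmT hx (lt_min (by linarith) (by norm_num)) (lt_min (by linarith) (by norm_num))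
      p q Nb hp hq
    exact ⟨C, fun f g hf hg n0 D => (lintegral_mono fun x => le_add_self).trans (hC f g hf hg n0 D)⟩

end BVP

namespace BVP

lemma tsum_nest {ι : Type} (x : ι → ℝ≥0∞) {r r' : ℝ} (hr : 0 < r) (h : r ≤ r') :
    (∑' i, x i ^ r') ^ (1/r') ≤ (∑' i, x i ^ r) ^ (1/r) := by
  have hr' : 0 < r' := by linarith
  have h1 : ∑' i, x i ^ r' ≤ (∑' i, x i ^ r) ^ (r'/r) := by
    rw [ENNReal.tsum_eq_iSup_sum (f := fun i => x i ^ r')]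
    refine iSup_le fun I => ?_
    have := sum_rpow_le I (fun i => x i ^ r') (t := r/r') (by positivity) (by rwa [div_le_one hr'])
    have e : ∀ i, (x i ^ r') ^ (r/r') = x i ^ r := fun i => by
      rw [← ENNReal.rpow_mul]; congr 1; field_simp
    simp only [e] at this
    have h2 := ENNReal.rpow_le_rpow (this.trans (ENNReal.sum_le_tsum I)) (z := r'/r) (by positivity)
    rw [← ENNReal.rpow_mul] at h2
    have e2 : r / r' * (r'/r) = 1 := by field_simp
    rwa [e2, ENNReal.rpow_one] at h2
  refine (ENNReal.rpow_le_rpow h1 (by positivity)).trans (le_of_eq ?_)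
  rw [← ENNReal.rpow_mul]
  congr 1
  field_simp

lemma liminf_rpow (u : ℕ → ℝ≥0∞) (z : ℝ) (hz : 0 < z) :
    (Filter.liminf u Filter.atTop) ^ z = Filter.liminf (fun n => u n ^ z) Filter.atTop :=
  OrderIso.liminf_apply (ENNReal.orderIsoRpow z hz)

lemma dF_block (f : ℤ → SchwartzMap ℝ ℂ) (n0 : ℤ) (x : ℝ) (m n : ℕ) :
    ∑ i ∈ Finset.Ioo (n0 + (m:ℤ)) (n0 + (n:ℤ) + 1), f i x = dF (fc f n0 x) m n := by
  unfold dF fc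
  refine Finset.sum_nbij' (fun i => (i - n0 - 1).toNat) (fun k => n0 + (k:ℤ) + 1) ?_ ?_ ?_ ?_ ?_
  · intro i hi
    simp only [Finset.mem_Ioo, Finset.mem_Ico] at *
    omega
  · intro i hi
    simp only [Finset.mem_Ioo, Finset.mem_Ico] at *
    omega
  · intro i hi
    simp only [Finset.mem_Ioo] at *
    omega
  · intro i hi
    simp only [Finset.mem_Ico] at *
    omega
  · intro i hi
    simp only [Finset.mem_Ioo] at hi
    congr 2
    omega

lemma dP_block (f g : ℤ → SchwartzMap ℝ ℂ) (n0 : ℤ) (x : ℝ) (m n : ℕ) :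
    ∑ j ∈ Finset.Ioc (n0 + (m:ℤ)) (n0 + (n:ℤ)), ∑ i ∈ Finset.Ioo (n0 + (m:ℤ)) j, f i x * g j x =
      dP (fc f n0 x) (fc g n0 x) m n := by
  unfold dP
  refine Finset.sum_nbij' (fun i => (i - n0 - 1).toNat) (fun k => n0 + (k:ℤ) + 1) ?_ ?_ ?_ ?_ ?_
  · intro i hi
    simp only [Finset.mem_Ioc, Finset.mem_Ico] at *
    omega
  · intro i hi
    simp only [Finset.mem_Ioc, Finset.mem_Ico] at *
    omega
  · intro i hi
    simp only [Finset.mem_Ioc] at *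
    omega
  · intro i hi
    simp only [Finset.mem_Ico] at *
    omega
  · intro j hj
    simp only [Finset.mem_Ioc] at hj
    obtain ⟨k, rfl⟩ : ∃ k : ℕ, j = n0 + (k:ℤ) + 1 := ⟨(j - n0 - 1).toNat, by omega⟩
    rw [← Finset.sum_mul, dF_block]
    have : (n0 + (k:ℤ) + 1 - n0 - 1).toNat = k := by omega
    simp only [this]
    rfl

/-- block of the paraproduct -/
def blk (f g : ℤ → SchwartzMap ℝ ℂ) (x : ℝ) (a b : ℤ) : ℂ :=
  ∑ j ∈ Finset.Ioc a b, ∑ i ∈ Finset.Ioo a j, f i x * g j x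

lemma blk_smul (c d : ℂ) (f g : ℤ → SchwartzMap ℝ ℂ) (x : ℝ) (a b : ℤ) :
    blk (fun i => c • f i) (fun i => d • g i) x a b = c * d * blk f g x a b := by
  unfold blk
  simp only [Finset.mul_sum, SchwartzMap.smul_apply, smul_eq_mul]
  refine Finset.sum_congr rfl fun j _ => Finset.sum_congr rfl fun i _ => ?_
  ring

lemma sum_blk_le (f g : ℤ → SchwartzMap ℝ ℂ) (x : ℝ) (N : ℕ → ℤ) (hN : Monotone N) (t : ℝ) (ht : 0 < t)
    (K L : ℕ) (h1 : -(L:ℤ) ≤ N 0) (h2 : N K ≤ L) :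
    ∑ k ∈ Finset.range K, ‖blk f g x (N k) (N (k+1))‖ₑ ^ t ≤
      V (wP t (fc f (-(L:ℤ)) x) (fc g (-(L:ℤ)) x)) 0 (2*L) := by
  set n0 : ℤ := -(L:ℤ)
  have hb0 : ∀ k, n0 ≤ N k := fun k => h1.trans (hN (Nat.zero_le k))
  set M : ℕ → ℕ := fun k => (N (min k K) - n0).toNat with hM
  have hMc : ∀ k, n0 + (M k : ℤ) = N (min k K) := fun k => by
    have := hb0 (min k K)
    simp only [hM]
    omega
  have hMm : Monotone M := by
    intro a b hab
    have h3 : N (min a K) ≤ N (min b K) := hN (min_le_min_right K hab)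
    have h4 := hMc a
    have h5 := hMc b
    omega
  have hMD : ∀ k, M k ≤ 2*L := by
    intro k
    have h3 : N (min k K) ≤ N K := hN (min_le_right _ _)
    have h4 := hMc k
    omega
  refine le_trans ?_ (tsum_le_V (wP t (fc f n0 x) (fc g n0 x)) (fun a => by simp [wP, ht]) M hMm (2*L) hMD)
  refine le_trans (Finset.sum_le_sum fun k hk => ?_) (ENNReal.sum_le_tsum (Finset.range K))
  have hk := Finset.mem_range.1 hk
  unfold wP
  rw [← dP_block, hMc, hMc, min_eq_left hk.le, min_eq_left (show k+1 ≤ K by omega)]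
  rfl

lemma tsum_blk_le (f g : ℤ → SchwartzMap ℝ ℂ) (x : ℝ) (N : ℕ → ℤ) (hN : Monotone N) (t : ℝ) (ht : 0 < t) :
    ∑' k, ‖blk f g x (N k) (N (k+1))‖ₑ ^ t ≤
      Filter.liminf (fun L : ℕ => V (wP t (fc f (-(L:ℤ)) x) (fc g (-(L:ℤ)) x)) 0 (2*L)) Filter.atTop := by
  refine ENNReal.tsum_le_of_sum_range_le fun K => ?_
  refine Filter.le_liminf_of_le (by isBoundedDefault) ?_
  filter_upwards [Filter.eventually_ge_atTop ((N 0).natAbs + (N K).natAbs)] with L hL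
  exact sum_blk_le f g x N hN t ht K L (by omega) (by omega)

/-- power of the mixed norm -/
def XX (p r : ℝ) (f : ℤ → SchwartzMap ℝ ℂ) : ℝ≥0∞ :=
  ∫⁻ x : ℝ, ((∑' i : ℤ, ‖f i x‖ₑ ^ r) ^ (1 / r)) ^ p

lemma XX_ge (p r r' : ℝ) (hp : 0 < p) (hr : 0 < r) (h : r ≤ r') (f : ℤ → SchwartzMap ℝ ℂ) (n0 : ℤ) (D : ℕ) :
    ∫⁻ x, (∑ j ∈ Finset.range D, ‖fc f n0 x j‖ₑ ^ r') ^ (p/r') ≤ XX p r f := by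
  refine lintegral_mono fun x => ?_
  have hr' : 0 < r' := by linarith
  have inj : Function.Injective (fun j : ℕ => n0 + (j:ℤ) + 1) := by
    intro a b h
    simp only at h
    omega
  have h1 : ∑ j ∈ Finset.range D, ‖fc f n0 x j‖ₑ ^ r' ≤ ∑' i : ℤ, ‖f i x‖ₑ ^ r' :=
    (ENNReal.sum_le_tsum _).trans
      (ENNReal.tsum_comp_le_tsum_of_injective inj (fun i : ℤ => ‖f i x‖ₑ ^ r'))
  calc _ ≤ (∑' i : ℤ, ‖f i x‖ₑ ^ r') ^ (p/r') := ENNReal.rpow_le_rpow h1 (by positivity)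
    _ = ((∑' i : ℤ, ‖f i x‖ₑ ^ r') ^ (1/r')) ^ p := by
        rw [← ENNReal.rpow_mul]; congr 1; ring
    _ ≤ _ := ENNReal.rpow_le_rpow (tsum_nest _ hr h) hp.le

lemma XX_smul (p r : ℝ) (hp : 0 < p) (hr : 0 < r) (c : ℂ) (f : ℤ → SchwartzMap ℝ ℂ) :
    XX p r (fun i => c • f i) = ‖c‖ₑ ^ p * XX p r f := by
  unfold XX
  rw [← lintegral_const_mul' _ _ (ENNReal.rpow_ne_top_of_nonneg hp.le enorm_ne_top)]
  refine lintegral_congr fun x => ?_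
  simp only [SchwartzMap.smul_apply, smul_eq_mul, enorm_mul]
  simp only [ENNReal.mul_rpow_of_nonneg _ _ hr.le, ENNReal.tsum_mul_left]
  rw [ENNReal.mul_rpow_of_nonneg _ _ (by positivity), ← ENNReal.rpow_mul, mul_one_div_cancel hr.ne',
    ENNReal.rpow_one, ENNReal.mul_rpow_of_nonneg _ _ hp.le]

lemma XX_zero (p r : ℝ) (hp : 0 < p) (hr : 0 < r) (f : ℤ → SchwartzMap ℝ ℂ) (h : XX p r f = 0) :
    ∀ᵐ x : ℝ, ∀ i, f i x = 0 := by
  unfold XX at h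
  rw [lintegral_eq_zero_iff] at h
  · filter_upwards [h] with x hx i
    simp only [Pi.zero_apply] at hx
    have h1 := (ENNReal.rpow_eq_zero_iff_of_pos hp).1 hx
    have h2 := (ENNReal.rpow_eq_zero_iff_of_pos (by positivity)).1 h1
    have h3 := ENNReal.tsum_eq_zero.1 h2 i
    simpa using (ENNReal.rpow_eq_zero_iff_of_pos hr).1 h3
  · refine ((Measurable.ennreal_tsum fun i => ?_).pow_const _).pow_const _
    exact (f i).continuous.enorm.measurable.pow_const r

lemma Band_smul (Nb : ℝ) (i : ℤ) (c : ℂ) (f : SchwartzMap ℝ ℂ) (h : Band Nb i f) : Band Nb i (c • f) := by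
  intro ξ hξ
  refine h ξ fun h0 => hξ ?_
  have e : 𝓕 (⇑(c • f)) ξ = c • 𝓕 (⇑f) ξ := by
    have : ⇑(c • f) = c • ⇑f := rfl
    rw [this, Real.fourier_eq, Real.fourier_eq]
    rw [← integral_smul]
    congr 1
    ext v
    simp only [Pi.smul_apply]
    rw [smul_comm]
  rw [e, h0, smul_zero]

/-- the left side integral -/
def II (P t : ℝ) (f g : ℤ → SchwartzMap ℝ ℂ) (Nk : ℕ → ℝ → ℤ) : ℝ≥0∞ :=
  ∫⁻ x : ℝ, ((∑' k : ℕ, ‖blk f g x (Nk k x) (Nk (k+1) x)‖ₑ ^ t) ^ (1/t)) ^ P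

lemma II_smul (P t : ℝ) (hP : 0 < P) (ht : 0 < t) (c d : ℂ) (f g : ℤ → SchwartzMap ℝ ℂ) (Nk : ℕ → ℝ → ℤ) :
    II P t (fun i => c • f i) (fun i => d • g i) Nk = ‖c * d‖ₑ ^ P * II P t f g Nk := by
  unfold II
  rw [← lintegral_const_mul' _ _ (ENNReal.rpow_ne_top_of_nonneg hP.le enorm_ne_top)]
  refine lintegral_congr fun x => ?_
  simp only [blk_smul, enorm_mul _ (blk _ _ _ _ _)]
  simp only [ENNReal.mul_rpow_of_nonneg _ _ ht.le, ENNReal.tsum_mul_left]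
  rw [ENNReal.mul_rpow_of_nonneg _ _ (by positivity), ← ENNReal.rpow_mul, mul_one_div_cancel ht.ne',
    ENNReal.rpow_one, ENNReal.mul_rpow_of_nonneg _ _ hP.le]

lemma II_zero (P t : ℝ) (hP : 0 < P) (ht : 0 < t) (f g : ℤ → SchwartzMap ℝ ℂ) (Nk : ℕ → ℝ → ℤ)
    (h : ∀ᵐ x : ℝ, ∀ i j, f i x * g j x = 0) : II P t f g Nk = 0 := by
  unfold II
  rw [lintegral_congr_ae (g := fun _ => 0), lintegral_zero]
  filter_upwards [h] with x hx
  simp [blk, hx, ht, hP]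

lemma II_le (p q r s t Nb : ℝ) (hp : 1 < p) (hq : 1 < q)
    (hr1 : 1 ≤ r) (hr2 : r ≤ 2) (hs1 : 1 ≤ s) (hs2 : s ≤ 2)
    (ht : 0 < t) (hts : 1 / t ≤ 1 / r + 1 / s)
    (hcase : max r s < 2 ∨ r * s / (r + s) < t) :
    ∃ C : ℝ≥0, ∀ f g : ℤ → SchwartzMap ℝ ℂ, (∀ i, Band Nb i (f i)) → (∀ i, Band Nb i (g i)) →
      ∀ Nk : ℕ → ℝ → ℤ, (∀ x, Monotone fun k => Nk k x) →
      II (p*q/(p+q)) t f g Nk ≤ C * (XX p r f + XX q s g) := by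
  obtain ⟨t1, r', s', ht1, htt, hrr, hss, C, hC⟩ := thmT2 p q r s t Nb hp hq hr1 hr2 hs1 hs2 ht hts hcase
  have hp0 : 0 < p := by linarith
  have hq0 : 0 < q := by linarith
  have hP : 0 < p * q / (p + q) := by positivity
  have hz : 0 < (t1 * (1/p+1/q))⁻¹ := by positivity
  refine ⟨C, fun f g hf hg Nk hN => ?_⟩
  unfold II
  calc _ ≤ ∫⁻ x, Filter.liminf (fun L : ℕ =>
        V (wP t1 (fc f (-(L:ℤ)) x) (fc g (-(L:ℤ)) x)) 0 (2*L) ^ (t1 * (1/p+1/q))⁻¹) Filter.atTop := by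
        refine lintegral_mono fun x => ?_
        simp only
        rw [← liminf_rpow _ _ hz]
        calc _ ≤ ((∑' k : ℕ, ‖blk f g x (Nk k x) (Nk (k+1) x)‖ₑ ^ t1) ^ (1/t1)) ^ (p*q/(p+q)) :=
              ENNReal.rpow_le_rpow (tsum_nest _ ht1 htt) hP.le
          _ = (∑' k : ℕ, ‖blk f g x (Nk k x) (Nk (k+1) x)‖ₑ ^ t1) ^ (t1 * (1/p+1/q))⁻¹ := by
              rw [← ENNReal.rpow_mul]
              congr 1
              field_simp
              ring
          _ ≤ _ := ENNReal.rpow_le_rpow (tsum_blk_le f g x (fun k => Nk k x) (hN x) t1 ht1) hz.le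
    _ ≤ Filter.liminf (fun L : ℕ => ∫⁻ x,
        V (wP t1 (fc f (-(L:ℤ)) x) (fc g (-(L:ℤ)) x)) 0 (2*L) ^ (t1 * (1/p+1/q))⁻¹) Filter.atTop :=
        lintegral_liminf_le fun L => (V_meas_P f g _ _ t1).pow_const _
    _ ≤ _ := by
        refine Filter.liminf_le_of_frequently_le' (Filter.Frequently.of_forall fun L => ?_)
        refine (hC f g hf hg _ _).trans (mul_le_mul_right (add_le_add ?_ ?_) _)
        · exact XX_ge p r r' hp0 (by linarith) hrr f _ _
        · exact XX_ge q s s' hq0 (by linarith) hss g _ _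

lemma final (p q r s t Nb : ℝ) (hp : 1 < p) (hq : 1 < q)
    (hr1 : 1 ≤ r) (hr2 : r ≤ 2) (hs1 : 1 ≤ s) (hs2 : s ≤ 2)
    (ht : 0 < t) (hts : 1 / t ≤ 1 / r + 1 / s)
    (hcase : max r s < 2 ∨ r * s / (r + s) < t) :
    ∃ C : ℝ≥0, 0 < C ∧ 
      ∀ f g : ℤ → SchwartzMap ℝ ℂ, (∀ i, Band Nb i (f i)) → (∀ i, Band Nb i (g i)) →
      ∀ Nk : ℕ → ℝ → ℤ, (∀ x, Monotone fun k => Nk k x) →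
      (II (p*q/(p+q)) t f g Nk) ^ ((p+q)/(p*q)) ≤ C * XX p r f ^ (1/p) * XX q s g ^ (1/q) := by
  obtain ⟨C, hC⟩ := II_le p q r s t Nb hp hq hr1 hr2 hs1 hs2 ht hts hcase
  have hp0 : 0 < p := by linarith
  have hq0 : 0 < q := by linarith
  have hr0 : 0 < r := by linarith
  have hs0 : 0 < s := by linarith
  set P := p*q/(p+q) with hPd
  have hP : 0 < P := by positivity
  have hPi : (p+q)/(p*q) = P⁻¹ := by rw [hPd, inv_div]
  rw [hPi]
  have hC1 : 0 < 2 * C + 1 := by positivity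
  refine ⟨(2*C+1) ^ P⁻¹, NNReal.rpow_pos hC1, fun f g hf hg Nk hN => ?_⟩
  rw [ENNReal.coe_rpow_of_nonneg _ (by positivity)]
  set A := XX p r f with hA
  set B := XX q s g with hB
  have hPz : (0:ℝ≥0∞) ^ P⁻¹ = 0 := ENNReal.zero_rpow_of_pos (by positivity)
  by_cases hA0 : A = 0
  · rw [II_zero P t hP ht, hPz]
    · exact zero_le
    · filter_upwards [XX_zero p r hp0 hr0 f hA0] with x hx i j
      rw [hx, zero_mul]
  by_cases hB0 : B = 0
  · rw [II_zero P t hP ht, hPz]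
    · exact zero_le
    · filter_upwards [XX_zero q s hq0 hs0 g hB0] with x hx i j
      rw [hx, mul_zero]
  have hK0 : (((2*C+1 : ℝ≥0) : ℝ≥0∞)) ^ P⁻¹ ≠ 0 := by
    rw [← ENNReal.coe_rpow_of_nonneg _ (by positivity)]
    exact_mod_cast (NNReal.rpow_pos hC1).ne'
  have hAp0 : A ^ (1/p) ≠ 0 := by
    rw [Ne, ENNReal.rpow_eq_zero_iff_of_pos (by positivity)]; exact hA0
  have hBp0 : B ^ (1/q) ≠ 0 := by
    rw [Ne, ENNReal.rpow_eq_zero_iff_of_pos (by positivity)]; exact hB0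
  by_cases hAt : A = ∞
  · rw [hAt, ENNReal.top_rpow_of_pos (by positivity), ENNReal.mul_top hK0, ENNReal.top_mul hBp0]
    exact le_top
  by_cases hBt : B = ∞
  · rw [hBt, ENNReal.top_rpow_of_pos (by positivity), ENNReal.mul_top (mul_ne_zero hK0 hAp0)]
    exact le_top
  have hApt : A ^ (1/p) ≠ ∞ := ENNReal.rpow_ne_top_of_nonneg (by positivity) hAt
  have hBpt : B ^ (1/q) ≠ ∞ := ENNReal.rpow_ne_top_of_nonneg (by positivity) hBt
  have aux : ∀ Z : ℝ≥0∞, Z ≠ 0 → Z ≠ ∞ → ∃ c : ℂ, ‖c‖ₑ = Z⁻¹ := by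
    intro Z h0 h1
    refine ⟨((Z⁻¹).toReal : ℂ), ?_⟩
    rw [← ofReal_norm, Complex.norm_real, Real.norm_of_nonneg ENNReal.toReal_nonneg,
      ENNReal.ofReal_toReal (ENNReal.inv_ne_top.2 h0)]
  obtain ⟨c, hc⟩ := aux _ hAp0 hApt
  obtain ⟨d, hd⟩ := aux _ hBp0 hBpt
  have key := hC (fun i => c • f i) (fun i => d • g i) (fun i => Band_smul Nb i c _ (hf i))
    (fun i => Band_smul Nb i d _ (hg i)) Nk hN
  rw [II_smul P t hP ht, XX_smul p r hp0 hr0, XX_smul q s hq0 hs0, enorm_mul, hc, hd, ← hA, ← hB] at key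
  have norm1 : ∀ (Z : ℝ≥0∞) (w : ℝ), 0 < w → Z ≠ 0 → Z ≠ ∞ → ((Z ^ (1/w))⁻¹) ^ w * Z = 1 := by
    intro Z w hw h0 h1
    rw [ENNReal.inv_rpow, ← ENNReal.rpow_mul, one_div_mul_cancel hw.ne', ENNReal.rpow_one,
      ENNReal.inv_mul_cancel h0 h1]
  rw [norm1 A p hp0 hA0 hAt, norm1 B q hq0 hB0 hBt] at key
  set a := A ^ (1/p)
  set b := B ^ (1/q)
  have hab : a⁻¹ * b⁻¹ = (a*b)⁻¹ := by
    rw [ENNReal.mul_inv (Or.inl hAp0) (Or.inl hApt)]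
  have hab0 : a * b ≠ 0 := mul_ne_zero hAp0 hBp0
  have habt : a * b ≠ ∞ := ENNReal.mul_ne_top hApt hBpt
  have h3 : (II P t f g Nk) ^ P⁻¹ = a * b * (((a*b)⁻¹) ^ P * II P t f g Nk) ^ P⁻¹ := by
    rw [ENNReal.mul_rpow_of_nonneg _ _ (by positivity), ENNReal.rpow_rpow_inv hP.ne', ← mul_assoc,
      ENNReal.mul_inv_cancel hab0 habt, one_mul]
  rw [hab] at key
  rw [h3, mul_comm, mul_assoc]
  refine mul_le_mul_left (ENNReal.rpow_le_rpow (key.trans ?_) (by positivity)) _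
  push_cast
  calc (C:ℝ≥0∞) * (1 + 1) = 2 * C := by ring
    _ ≤ _ := le_self_add

end BVP

/-- Strong-type bilinear variational paraproduct estimate, continuous case. -/
theorem bilinear_variational_paraproduct_continuous
    (p q r s t Nb : ℝ) (hp : 1 < p) (hq : 1 < q)
    (hr1 : 1 ≤ r) (hr2 : r ≤ 2) (hs1 : 1 ≤ s) (hs2 : s ≤ 2)
    (ht : 0 < t) (hts : 1 / t ≤ 1 / r + 1 / s)
    (hcase : max r s < 2 ∨ r * s / (r + s) < t) (hNb : 0 < Nb) :
    ∃ C : ℝ≥0, 0 < C ∧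
      ∀ (f g : ℤ → SchwartzMap ℝ ℂ), IsContLPFamily Nb f → IsContLPFamily Nb g →
      ∀ (Nk : ℕ → ℝ → ℤ), IsJumpCollection Nk →
      (∫⁻ x : ℝ,
          ((∑' k : ℕ, (ENNReal.ofReal (norm
              (∑ j ∈ Finset.Ioc (Nk k x) (Nk (k + 1) x),
                ∑ i ∈ Finset.Ioo (Nk k x) j, f i x * g j x))) ^ t) ^ (1 / t))
            ^ (p * q / (p + q))) ^ ((p + q) / (p * q))
        ≤ (C : ℝ≥0∞) * mixedNorm p r f * mixedNorm q s g := by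
  obtain ⟨C, hC0, hC⟩ := BVP.final p q r s t Nb hp hq hr1 hr2 hs1 hs2 ht hts hcase
  refine ⟨C, hC0, fun f g hf hg Nk hNk => ?_⟩
  have h := hC f g hf hg Nk (fun x => monotone_nat_of_le_succ fun k => hNk.2 k x)
  simp only [BVP.II, BVP.XX, BVP.blk] at h
  simp only [mixedNorm, ofReal_norm]
  exact h


end
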